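/- Let n ≥ 0, let 2 ≤ e < ∞, let κ = (κ_1,…,κ_ℓ) ∈ Z^ℓ be a multicharge with κ_l − κ_{l+1} ≥ n for 1 ≤ l < ℓ, let (O,t) be an e-idempotent subring of a field K, let m be a maximal ideal of O and set k = O/m and t̄ = t + m ∈ k. Then the cyclotomic quiver Hecke algebra R_n^Λ(k), for Λ = Σ_{l=1}^ℓ Λ_{κ_l mod e}, is isomorphic as a k-algebra to the cyclotomic Hecke algebra H_n(k, t̄, κ) (the Brundan–Kleshchev isomorphism). -/

import Mathlib

open scoped BigOperators
open scoped Classical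

namespace Paper

/-! ## Quantum integers -/

/-- The quantum integer `[d]_x` in a field, for `d ∈ ℤ`. -/
noncomputable def qint {K : Type*} [Field K] (x : K) (d : ℤ) : K :=
  if 0 ≤ d then ∑ k ∈ Finset.range d.toNat, x ^ k
  else -∑ k ∈ Finset.range (-d).toNat, x ^ (-((k : ℤ) + 1))

/-- The quantum integer `[d]_t` in a commutative ring, for an invertible `t` and `d ∈ ℤ`. -/
def qintU {O : Type*} [CommRing O] (t : Oˣ) (d : ℤ) : O :=
  if 0 ≤ d then ∑ k ∈ Finset.range d.toNat, (t : O) ^ k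
  else -∑ k ∈ Finset.range (-d).toNat, ((t ^ (-((k : ℤ) + 1)) : Oˣ) : O)

/-! ## Nodes, multipartitions and standard tableaux -/

/-- A node `(l, r, c)`: component `l`, row `r`, column `c` (all `0`-based). -/
abbrev Node : Type := ℕ × ℕ × ℕ

/-- `nodeBelow A B` holds when `B` is strictly below `A`, i.e. `A < B` lexicographically. -/
def nodeBelow (A B : Node) : Prop :=
  A.1 < B.1 ∨ (A.1 = B.1 ∧ (A.2.1 < B.2.1 ∨ (A.2.1 = B.2.1 ∧ A.2.2 < B.2.2)))

/-- An `ℓ`-multipartition of `n`. -/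
structure Multipartition (ℓ n : ℕ) : Type where
  part : ℕ → ℕ → ℕ
  comp_bound : ∀ l, ℓ ≤ l → ∀ r, part l r = 0
  antitone : ∀ l, Antitone (part l)
  row_bound : ∀ l r, n ≤ r → part l r = 0
  size : (∑ l ∈ Finset.range ℓ, ∑ r ∈ Finset.range n, part l r) = n

/-- The diagram of a multipartition. -/
def Multipartition.diagram {ℓ n : ℕ} (μ : Multipartition ℓ n) : Set Node :=
  {A | A.2.2 < μ.part A.1 A.2.1}

/-- A standard tableau: a bijection from the diagram of its shape onto `{1, …, n}`
that increases along rows and down columns of each component (it takes the value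
`0` off the diagram, so that it is determined by its entries). -/
structure StdTableau (ℓ n : ℕ) : Type where
  shape : Multipartition ℓ n
  entry : Node → ℕ
  entry_zero : ∀ A, A ∉ shape.diagram → entry A = 0
  bijOn : Set.BijOn entry shape.diagram (Set.Icc 1 n)
  row_inc : ∀ l r c, (l, r, c + 1) ∈ shape.diagram → entry (l, r, c) < entry (l, r, c + 1)
  col_inc : ∀ l r c, (l, r + 1, c) ∈ shape.diagram → entry (l, r, c) < entry (l, r + 1, c)

/-- The node of a standard tableau containing the entry `k`. -/
noncomputable def StdTableau.node {ℓ n : ℕ} (T : StdTableau ℓ n) (k : ℕ) : Node :=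
  Function.invFunOn T.entry T.shape.diagram k

/-- The content `c_k(T) = κ_l + c - r` of the entry `k` in the tableau `T`
(`1 ≤ k ≤ n`). -/
noncomputable def content {ℓ n : ℕ} (κ : ℕ → ℤ) (T : StdTableau ℓ n) (k : ℕ) : ℤ :=
  κ (T.node k).1 + ((T.node k).2.2 : ℤ) - ((T.node k).2.1 : ℤ)

/-- The residue sequence of a standard tableau, in `I^n` with `I = ℤ/eℤ`. -/
noncomputable def resSeq {ℓ n : ℕ} (e : ℕ) (κ : ℕ → ℤ) (T : StdTableau ℓ n) :
    Fin n → ZMod e :=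
  fun k => ((content κ T (k.1 + 1) : ℤ) : ZMod e)

/-- The residue of a node. -/
def resNode (e : ℕ) (κ : ℕ → ℤ) (A : Node) : ZMod e :=
  ((κ A.1 + (A.2.2 : ℤ) - (A.2.1 : ℤ) : ℤ) : ZMod e)

/-- A set of nodes is the diagram of a multipartition (with at most `ℓ` components)
iff it is finite and downward closed in rows and columns. -/
def IsDiagramSet (ℓ : ℕ) (S : Set Node) : Prop :=
  S.Finite ∧ (∀ A ∈ S, A.1 < ℓ) ∧
    (∀ l r c, (l, r, c + 1) ∈ S → (l, r, c) ∈ S) ∧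
    (∀ l r c, (l, r + 1, c) ∈ S → (l, r, c) ∈ S)

/-- `A` is an addable node of the diagram `S`. -/
def Addable (ℓ : ℕ) (S : Set Node) (A : Node) : Prop :=
  A ∉ S ∧ IsDiagramSet ℓ (S ∪ {A})

/-- `A` is a removable node of the diagram `S`. -/
def Removable (ℓ : ℕ) (S : Set Node) (A : Node) : Prop :=
  A ∈ S ∧ IsDiagramSet ℓ (S \ {A})

/-- `d_A(S)`: the number of addable nodes of `S` of the same residue as `A` strictly
below `A`, minus the number of removable ones. -/
noncomputable def dNode (ℓ e : ℕ) (κ : ℕ → ℤ) (S : Set Node) (A : Node) : ℤ :=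
  (Set.ncard {B | Addable ℓ S B ∧ resNode e κ B = resNode e κ A ∧ nodeBelow A B} : ℤ) -
    (Set.ncard {B | Removable ℓ S B ∧ resNode e κ B = resNode e κ A ∧ nodeBelow A B} : ℤ)

/-- The Brundan–Kleshchev–Wang degree `deg_e(T)` of a standard tableau, written as the
telescoping sum of the recursion `deg_e(T) = deg_e(T↓(n-1)) + d_A(Shape(T))`. -/
noncomputable def degE {ℓ n : ℕ} (e : ℕ) (κ : ℕ → ℤ) (T : StdTableau ℓ n) : ℤ :=
  ∑ m ∈ Finset.Icc 1 n,
    dNode ℓ e κ {A | A ∈ T.shape.diagram ∧ T.entry A ≤ m} (T.node m)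

/-- The restriction of the diagram of `T` to entries `≤ m` (the diagram of `Shape(T↓m)`). -/
def restDiag {ℓ n : ℕ} (T : StdTableau ℓ n) (m : ℕ) : Set Node :=
  {A | A ∈ T.shape.diagram ∧ T.entry A ≤ m}

/-- Dominance order on standard tableaux: `domTab S T` iff `S ⊵ T`. -/
def domTab {ℓ n : ℕ} (S T : StdTableau ℓ n) : Prop :=
  ∀ m l i : ℕ,
    Set.ncard {A | A ∈ restDiag T m ∧ (A.1 < l ∨ (A.1 = l ∧ A.2.1 ≤ i))} ≤
      Set.ncard {A | A ∈ restDiag S m ∧ (A.1 < l ∨ (A.1 = l ∧ A.2.1 ≤ i))}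

/-- Interchange the entries `r` and `r + 1` in an entry function. -/
def swapEntry (f : Node → ℕ) (r : ℕ) : Node → ℕ :=
  fun A => if f A = r then r + 1 else if f A = r + 1 then r else f A

/-- `ρ_r(T) = c_r(T) - c_{r+1}(T)`, the axial distance. -/
noncomputable def rhoTab {ℓ n : ℕ} (κ : ℕ → ℤ) (T : StdTableau ℓ n) (r : ℕ) : ℤ :=
  content κ T r - content κ T (r + 1)

/-- The entry function of the row-reading initial tableau `t^λ`. -/
noncomputable def tlamEntry {ℓ n : ℕ} (μ : Multipartition ℓ n) (A : Node) : ℕ :=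
  if A ∈ μ.diagram then
    (∑ l ∈ Finset.range A.1, ∑ r ∈ Finset.range n, μ.part l r) +
      (∑ r ∈ Finset.range A.2.1, μ.part A.1 r) + A.2.2 + 1
  else 0

/-- The finite set of possible contents of standard tableaux of size `n`. -/
noncomputable def contFinset (ℓ n : ℕ) (κ : ℕ → ℤ) : Finset ℤ :=
  ((Finset.range ℓ ×ˢ Finset.range n ×ˢ Finset.range n).image
      (fun x => κ x.1 + (x.2.2 : ℤ) - (x.2.1 : ℤ))).filter
    (fun c => ∃ T : StdTableau ℓ n, ∃ k, 1 ≤ k ∧ k ≤ n ∧ content κ T k = c)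

/-- The standard tableau (if any) obtained from `T` by interchanging the entries
`r` and `r + 1`; i.e. `T·s_r` if it is standard, and `none` otherwise. -/
noncomputable def oSwapO {ℓ n : ℕ} (T : StdTableau ℓ n) (r : ℕ) :
    Option (StdTableau ℓ n) :=
  if h : ∃ V : StdTableau ℓ n, V.entry = swapEntry T.entry r then some (Classical.choose h)
  else none

/-- `oSwap` extended to `Option`. -/
noncomputable def oSwap {ℓ n : ℕ} (X : Option (StdTableau ℓ n)) (r : ℕ) :
    Option (StdTableau ℓ n) :=
  X.bind fun T => oSwapO T r

/-- Evaluate a seminormal coefficient system on an optional tableau (by `0` if none). -/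
noncomputable def aE {ℓ n : ℕ} {K : Type*} [Field K] (α : ℕ → StdTableau ℓ n → K) (r : ℕ)
    (X : Option (StdTableau ℓ n)) : K :=
  X.elim 0 (α r)

/-! ## Separation and idempotent subrings -/

/-- `(K, t)` separates `Std(P_n)` (field version):
`[n]!_t ∏_{1 ≤ l < m ≤ ℓ} ∏_{-n < d < n} [κ_l - κ_m + d]_t ≠ 0`. -/
def SeparatesF {K : Type*} [Field K] (t : Kˣ) (n ℓ : ℕ) (κ : ℕ → ℤ) : Prop :=
  ((∏ d ∈ Finset.Icc 1 n, qint (t : K) (d : ℤ)) *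
      ∏ l ∈ Finset.range ℓ, ∏ m ∈ Finset.Ioo l ℓ,
        ∏ d ∈ Finset.Ioo (-(n : ℤ)) (n : ℤ), qint (t : K) (κ l - κ m + d)) ≠ 0

/-- `(O, t)` separates `Std(P_n)` (subring version): the separation element is a unit. -/
def SeparatesU {O : Type*} [CommRing O] (t : Oˣ) (n ℓ : ℕ) (κ : ℕ → ℤ) : Prop :=
  IsUnit ((∏ d ∈ Finset.Icc 1 n, qintU t (d : ℤ)) *
      ∏ l ∈ Finset.range ℓ, ∏ m ∈ Finset.Ioo l ℓ,
        ∏ d ∈ Finset.Ioo (-(n : ℤ)) (n : ℤ), qintU t (κ l - κ m + d))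

/-- `(O, t)` is an `e`-idempotent subring of the field `K`. -/
def IsIdempotentSubring {K : Type*} [Field K] (O : Subring K) (t : Oˣ) (e n ℓ : ℕ)
    (κ : ℕ → ℤ) : Prop :=
  SeparatesU t n ℓ κ ∧
    (∀ k : ℤ, ¬(e : ℤ) ∣ k → IsUnit (qintU t k)) ∧
    (∀ k : ℤ, (e : ℤ) ∣ k → qintU t k ∈ Ideal.jacobson (⊥ : Ideal O))

/-! ## The cyclotomic Hecke algebra, by generators and relations -/

/-- Generators `L_1, …, L_n`, `T_1, …, T_{n-1}` (here `0`-based). -/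
inductive HeckeGen (n : ℕ) : Type
  | L : Fin n → HeckeGen n
  | T : Fin (n - 1) → HeckeGen n

/-- The position `r` of the pair `(r, r+1)` interchanged by the `r`-th transposition. -/
def pL {n : ℕ} (r : Fin (n - 1)) : Fin n := ⟨r.1, by have := r.2; omega⟩

/-- The position `r + 1` of the pair interchanged by the `r`-th transposition. -/
def pR {n : ℕ} (r : Fin (n - 1)) : Fin n := ⟨r.1 + 1, by have := r.2; omega⟩

/-- The position `r + 2`, used in braid relations. -/
def pM {n : ℕ} (r : Fin (n - 1)) (hr : r.1 + 1 < n - 1) : Fin n := ⟨r.1 + 2, by omega⟩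

/-- The free algebra generator `L_k`. -/
def hL (R : Type*) [CommRing R] {n : ℕ} (k : Fin n) : FreeAlgebra R (HeckeGen n) :=
  FreeAlgebra.ι R (HeckeGen.L k)

/-- The free algebra generator `T_r`. -/
def hT (R : Type*) [CommRing R] {n : ℕ} (r : Fin (n - 1)) : FreeAlgebra R (HeckeGen n) :=
  FreeAlgebra.ι R (HeckeGen.T r)

/-- The defining relations of the integral cyclotomic Hecke algebra `H_n(R, t, κ)`. -/
inductive HeckeRel (R : Type*) [CommRing R] (t : Rˣ) (n ℓ : ℕ) (κ : ℕ → ℤ) :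
    FreeAlgebra R (HeckeGen n) → FreeAlgebra R (HeckeGen n) → Prop
  | cyc (h : 0 < n) :
      HeckeRel R t n ℓ κ
        (((List.range ℓ).map fun l =>
          hL R (⟨0, h⟩ : Fin n) - algebraMap R _ (qintU t (κ l))).prod) 0
  | quad (r : Fin (n - 1)) :
      HeckeRel R t n ℓ κ ((hT R r + 1) * (hT R r - algebraMap R _ (t : R))) 0
  | LL (k m : Fin n) : HeckeRel R t n ℓ κ (hL R k * hL R m) (hL R m * hL R k)
  | TTfar (r s : Fin (n - 1)) (h : r.1 + 1 < s.1 ∨ s.1 + 1 < r.1) :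
      HeckeRel R t n ℓ κ (hT R r * hT R s) (hT R s * hT R r)
  | braid (r s : Fin (n - 1)) (h : s.1 = r.1 + 1) :
      HeckeRel R t n ℓ κ (hT R r * hT R s * hT R r) (hT R s * hT R r * hT R s)
  | TL (r : Fin (n - 1)) (k : Fin n) (h : k.1 ≠ r.1 ∧ k.1 ≠ r.1 + 1) :
      HeckeRel R t n ℓ κ (hT R r * hL R k) (hL R k * hT R r)
  | LT (r : Fin (n - 1)) :
      HeckeRel R t n ℓ κ (hL R (pR r) * (hT R r - algebraMap R _ (t : R) + 1))
        (hT R r * hL R (pL r) + 1)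

/-- The integral cyclotomic Hecke algebra of type `A`, `H_n(R, t, κ)`. -/
noncomputable abbrev CycHecke (R : Type*) [CommRing R] (t : Rˣ) (n ℓ : ℕ) (κ : ℕ → ℤ) :
    Type _ :=
  RingQuot (HeckeRel R t n ℓ κ)

/-- The generator `L_k` of the cyclotomic Hecke algebra. -/
noncomputable def Lgen (R : Type*) [CommRing R] (t : Rˣ) (n ℓ : ℕ) (κ : ℕ → ℤ)
    (k : Fin n) : CycHecke R t n ℓ κ :=
  RingQuot.mkAlgHom R (HeckeRel R t n ℓ κ) (hL R k)

/-- The generator `T_r` of the cyclotomic Hecke algebra. -/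
noncomputable def Tgen (R : Type*) [CommRing R] (t : Rˣ) (n ℓ : ℕ) (κ : ℕ → ℤ)
    (r : Fin (n - 1)) : CycHecke R t n ℓ κ :=
  RingQuot.mkAlgHom R (HeckeRel R t n ℓ κ) (hT R r)

end Paper
/-! ## Quiver Hecke (KLR) algebras, by generators and relations -/

namespace Paper

/-- Generators `e(i)` (`i ∈ I^n`), `ψ_1, …, ψ_{n-1}`, `y_1, …, y_n` (here `0`-based). -/
inductive KLRGen (n e : ℕ) : Type
  | idem : (Fin n → ZMod e) → KLRGen n e
  | psi : Fin (n - 1) → KLRGen n e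
  | y : Fin n → KLRGen n e

/-- The free algebra generator `e(i)`. -/
def kE (R : Type*) [CommRing R] {n e : ℕ} (i : Fin n → ZMod e) :
    FreeAlgebra R (KLRGen n e) :=
  FreeAlgebra.ι R (KLRGen.idem i)

/-- The free algebra generator `ψ_r`. -/
def kPsi (R : Type*) [CommRing R] {n e : ℕ} (r : Fin (n - 1)) :
    FreeAlgebra R (KLRGen n e) :=
  FreeAlgebra.ι R (KLRGen.psi r)

/-- The free algebra generator `y_k`. -/
def kY (R : Type*) [CommRing R] {n e : ℕ} (k : Fin n) : FreeAlgebra R (KLRGen n e) :=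
  FreeAlgebra.ι R (KLRGen.y k)

/-- `s_r · i`: interchange the entries of `i` at positions `r` and `r + 1`. -/
def swapSeq {n e : ℕ} (i : Fin n → ZMod e) (r : Fin (n - 1)) : Fin n → ZMod e :=
  fun k => if k = pL r then i (pR r) else if k = pR r then i (pL r) else i k

/-- The defining relations of the cyclotomic quiver Hecke algebra `R_n^Λ(R)` where
`Λ = Σ_l Λ_{κ_l mod e}`. -/
inductive KLRRel (R : Type*) [CommRing R] (n e ℓ : ℕ) [NeZero e] (κ : ℕ → ℤ) :
    FreeAlgebra R (KLRGen n e) → FreeAlgebra R (KLRGen n e) → Prop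
  | cyc (h : 0 < n) (i : Fin n → ZMod e) :
      KLRRel R n e ℓ κ
        ((kY R (⟨0, h⟩ : Fin n)) ^
            (((Finset.range ℓ).filter fun l => ((κ l : ZMod e) = i ⟨0, h⟩)).card) *
          kE R i) 0
  | orth (i j : Fin n → ZMod e) (h : i ≠ j) : KLRRel R n e ℓ κ (kE R i * kE R j) 0
  | idem (i : Fin n → ZMod e) : KLRRel R n e ℓ κ (kE R i * kE R i) (kE R i)
  | complete : KLRRel R n e ℓ κ (∑ i : Fin n → ZMod e, kE R i) 1
  | yE (k : Fin n) (i : Fin n → ZMod e) :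
      KLRRel R n e ℓ κ (kY R k * kE R i) (kE R i * kY R k)
  | psiE (r : Fin (n - 1)) (i : Fin n → ZMod e) :
      KLRRel R n e ℓ κ (kPsi R r * kE R i) (kE R (swapSeq i r) * kPsi R r)
  | yy (k m : Fin n) : KLRRel R n e ℓ κ (kY R k * kY R m) (kY R m * kY R k)
  | psiyEq (r : Fin (n - 1)) (i : Fin n → ZMod e) (h : i (pL r) = i (pR r)) :
      KLRRel R n e ℓ κ (kPsi R r * kY R (pR r) * kE R i)
        ((kY R (pL r) * kPsi R r + 1) * kE R i)
  | psiyNe (r : Fin (n - 1)) (i : Fin n → ZMod e) (h : i (pL r) ≠ i (pR r)) :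
      KLRRel R n e ℓ κ (kPsi R r * kY R (pR r) * kE R i)
        (kY R (pL r) * kPsi R r * kE R i)
  | ypsiEq (r : Fin (n - 1)) (i : Fin n → ZMod e) (h : i (pL r) = i (pR r)) :
      KLRRel R n e ℓ κ (kY R (pR r) * kPsi R r * kE R i)
        ((kPsi R r * kY R (pL r) + 1) * kE R i)
  | ypsiNe (r : Fin (n - 1)) (i : Fin n → ZMod e) (h : i (pL r) ≠ i (pR r)) :
      KLRRel R n e ℓ κ (kY R (pR r) * kPsi R r * kE R i)
        (kPsi R r * kY R (pL r) * kE R i)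
  | psiyFar (r : Fin (n - 1)) (k : Fin n) (h : k.1 ≠ r.1 ∧ k.1 ≠ r.1 + 1) :
      KLRRel R n e ℓ κ (kPsi R r * kY R k) (kY R k * kPsi R r)
  | psipsiFar (r s : Fin (n - 1)) (h : r.1 + 1 < s.1 ∨ s.1 + 1 < r.1) :
      KLRRel R n e ℓ κ (kPsi R r * kPsi R s) (kPsi R s * kPsi R r)
  | quadEq (r : Fin (n - 1)) (i : Fin n → ZMod e) (h : i (pL r) = i (pR r)) :
      KLRRel R n e ℓ κ (kPsi R r ^ 2 * kE R i) 0
  | quadR (r : Fin (n - 1)) (i : Fin n → ZMod e)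
      (h1 : i (pR r) = i (pL r) + 1) (h2 : i (pL r) ≠ i (pR r) + 1) :
      KLRRel R n e ℓ κ (kPsi R r ^ 2 * kE R i) ((kY R (pL r) - kY R (pR r)) * kE R i)
  | quadL (r : Fin (n - 1)) (i : Fin n → ZMod e)
      (h1 : i (pL r) = i (pR r) + 1) (h2 : i (pR r) ≠ i (pL r) + 1) :
      KLRRel R n e ℓ κ (kPsi R r ^ 2 * kE R i) ((kY R (pR r) - kY R (pL r)) * kE R i)
  | quadBoth (r : Fin (n - 1)) (i : Fin n → ZMod e)
      (h1 : i (pR r) = i (pL r) + 1) (h2 : i (pL r) = i (pR r) + 1) :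
      KLRRel R n e ℓ κ (kPsi R r ^ 2 * kE R i)
        ((kY R (pR r) - kY R (pL r)) * (kY R (pL r) - kY R (pR r)) * kE R i)
  | quadNone (r : Fin (n - 1)) (i : Fin n → ZMod e) (h1 : i (pL r) ≠ i (pR r))
      (h2 : i (pR r) ≠ i (pL r) + 1) (h3 : i (pL r) ≠ i (pR r) + 1) :
      KLRRel R n e ℓ κ (kPsi R r ^ 2 * kE R i) (kE R i)
  | braidR (r : Fin (n - 1)) (hr : r.1 + 1 < n - 1) (i : Fin n → ZMod e)
      (h0 : i (pM r hr) = i (pL r)) (h1 : i (pR r) = i (pL r) + 1)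
      (h2 : i (pL r) ≠ i (pR r) + 1) :
      KLRRel R n e ℓ κ (kPsi R r * kPsi R ⟨r.1 + 1, hr⟩ * kPsi R r * kE R i)
        ((kPsi R ⟨r.1 + 1, hr⟩ * kPsi R r * kPsi R ⟨r.1 + 1, hr⟩ - 1) * kE R i)
  | braidL (r : Fin (n - 1)) (hr : r.1 + 1 < n - 1) (i : Fin n → ZMod e)
      (h0 : i (pM r hr) = i (pL r)) (h1 : i (pL r) = i (pR r) + 1)
      (h2 : i (pR r) ≠ i (pL r) + 1) :
      KLRRel R n e ℓ κ (kPsi R r * kPsi R ⟨r.1 + 1, hr⟩ * kPsi R r * kE R i)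
        ((kPsi R ⟨r.1 + 1, hr⟩ * kPsi R r * kPsi R ⟨r.1 + 1, hr⟩ + 1) * kE R i)
  | braidBoth (r : Fin (n - 1)) (hr : r.1 + 1 < n - 1) (i : Fin n → ZMod e)
      (h0 : i (pM r hr) = i (pL r)) (h1 : i (pR r) = i (pL r) + 1)
      (h2 : i (pL r) = i (pR r) + 1) :
      KLRRel R n e ℓ κ (kPsi R r * kPsi R ⟨r.1 + 1, hr⟩ * kPsi R r * kE R i)
        ((kPsi R ⟨r.1 + 1, hr⟩ * kPsi R r * kPsi R ⟨r.1 + 1, hr⟩ +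
            kY R (pL r) - 2 * kY R (pR r) + kY R (pM r hr)) * kE R i)
  | braidNone (r : Fin (n - 1)) (hr : r.1 + 1 < n - 1) (i : Fin n → ZMod e)
      (h : ¬(i (pM r hr) = i (pL r) ∧
        (i (pR r) = i (pL r) + 1 ∨ i (pL r) = i (pR r) + 1))) :
      KLRRel R n e ℓ κ (kPsi R r * kPsi R ⟨r.1 + 1, hr⟩ * kPsi R r * kE R i)
        (kPsi R ⟨r.1 + 1, hr⟩ * kPsi R r * kPsi R ⟨r.1 + 1, hr⟩ * kE R i)

/-- The cyclotomic quiver Hecke algebra `R_n^Λ(R)`, `Λ = Σ_l Λ_{κ_l mod e}`. -/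
noncomputable abbrev KLR (R : Type*) [CommRing R] (n e ℓ : ℕ) [NeZero e] (κ : ℕ → ℤ) :
    Type _ :=
  RingQuot (KLRRel R n e ℓ κ)

/-- The generator `e(i)` of the cyclotomic quiver Hecke algebra. -/
noncomputable def KeGen (R : Type*) [CommRing R] (n e ℓ : ℕ) [NeZero e] (κ : ℕ → ℤ)
    (i : Fin n → ZMod e) : KLR R n e ℓ κ :=
  RingQuot.mkAlgHom R (KLRRel R n e ℓ κ) (kE R i)

/-- The generator `ψ_r` of the cyclotomic quiver Hecke algebra. -/
noncomputable def KpsiGen (R : Type*) [CommRing R] (n e ℓ : ℕ) [NeZero e] (κ : ℕ → ℤ)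
    (r : Fin (n - 1)) : KLR R n e ℓ κ :=
  RingQuot.mkAlgHom R (KLRRel R n e ℓ κ) (kPsi R r)

/-- The generator `y_k` of the cyclotomic quiver Hecke algebra. -/
noncomputable def KyGen (R : Type*) [CommRing R] (n e ℓ : ℕ) [NeZero e] (κ : ℕ → ℤ)
    (k : Fin n) : KLR R n e ℓ κ :=
  RingQuot.mkAlgHom R (KLRRel R n e ℓ κ) (kY R k)

end Paper
/-! ## The deformed cyclotomic quiver Hecke algebra -/

namespace Paper

/-- `y_k^⟨d⟩ = t^d y_k + [d]_t` in the free algebra. -/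
def ydot (R : Type*) [CommRing R] (t : Rˣ) {n e : ℕ} (d : ℤ) (k : Fin n) :
    FreeAlgebra R (KLRGen n e) :=
  algebraMap R _ ((t ^ d : Rˣ) : R) * kY R k + algebraMap R _ (qintU t d)

/-- `ρ_r(i) = î_r - î_{r+1}` for `i ∈ I^n`. -/
def rhoI {n e : ℕ} (i : Fin n → ZMod e) (r : Fin (n - 1)) : ℤ :=
  ((i (pL r)).val : ℤ) - ((i (pR r)).val : ℤ)

/-- The defining relations of the deformed cyclotomic quiver Hecke algebra `R_n(O)`. -/
inductive DefKLRRel (R : Type*) [CommRing R] (t : Rˣ) (n e ℓ : ℕ) [NeZero e] (κ : ℕ → ℤ) :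
    FreeAlgebra R (KLRGen n e) → FreeAlgebra R (KLRGen n e) → Prop
  | cyc (h : 0 < n) (i : Fin n → ZMod e) :
      DefKLRRel R t n e ℓ κ
        ((((List.range ℓ).map fun l =>
            if ((κ l : ZMod e) = i ⟨0, h⟩) then
              kY R (⟨0, h⟩ : Fin n) -
                algebraMap R _ (qintU t (κ l - ((i ⟨0, h⟩).val : ℤ)))
            else 1).prod) * kE R i) 0
  | orth (i j : Fin n → ZMod e) (h : i ≠ j) : DefKLRRel R t n e ℓ κ (kE R i * kE R j) 0
  | idem (i : Fin n → ZMod e) : DefKLRRel R t n e ℓ κ (kE R i * kE R i) (kE R i)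
  | complete : DefKLRRel R t n e ℓ κ (∑ i : Fin n → ZMod e, kE R i) 1
  | yE (k : Fin n) (i : Fin n → ZMod e) :
      DefKLRRel R t n e ℓ κ (kY R k * kE R i) (kE R i * kY R k)
  | psiE (r : Fin (n - 1)) (i : Fin n → ZMod e) :
      DefKLRRel R t n e ℓ κ (kPsi R r * kE R i) (kE R (swapSeq i r) * kPsi R r)
  | yy (k m : Fin n) : DefKLRRel R t n e ℓ κ (kY R k * kY R m) (kY R m * kY R k)
  | psiyEq (r : Fin (n - 1)) (i : Fin n → ZMod e) (h : i (pL r) = i (pR r)) :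
      DefKLRRel R t n e ℓ κ (kPsi R r * kY R (pR r) * kE R i)
        ((kY R (pL r) * kPsi R r + 1) * kE R i)
  | psiyNe (r : Fin (n - 1)) (i : Fin n → ZMod e) (h : i (pL r) ≠ i (pR r)) :
      DefKLRRel R t n e ℓ κ (kPsi R r * kY R (pR r) * kE R i)
        (kY R (pL r) * kPsi R r * kE R i)
  | ypsiEq (r : Fin (n - 1)) (i : Fin n → ZMod e) (h : i (pL r) = i (pR r)) :
      DefKLRRel R t n e ℓ κ (kY R (pR r) * kPsi R r * kE R i)
        ((kPsi R r * kY R (pL r) + 1) * kE R i)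
  | ypsiNe (r : Fin (n - 1)) (i : Fin n → ZMod e) (h : i (pL r) ≠ i (pR r)) :
      DefKLRRel R t n e ℓ κ (kY R (pR r) * kPsi R r * kE R i)
        (kPsi R r * kY R (pL r) * kE R i)
  | psiyFar (r : Fin (n - 1)) (k : Fin n) (h : k.1 ≠ r.1 ∧ k.1 ≠ r.1 + 1) :
      DefKLRRel R t n e ℓ κ (kPsi R r * kY R k) (kY R k * kPsi R r)
  | psipsiFar (r s : Fin (n - 1)) (h : r.1 + 1 < s.1 ∨ s.1 + 1 < r.1) :
      DefKLRRel R t n e ℓ κ (kPsi R r * kPsi R s) (kPsi R s * kPsi R r)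
  | quadEq (r : Fin (n - 1)) (i : Fin n → ZMod e) (h : i (pL r) = i (pR r)) :
      DefKLRRel R t n e ℓ κ (kPsi R r ^ 2 * kE R i) 0
  | quadR (r : Fin (n - 1)) (i : Fin n → ZMod e)
      (h1 : i (pR r) = i (pL r) + 1) (h2 : i (pL r) ≠ i (pR r) + 1) :
      DefKLRRel R t n e ℓ κ (kPsi R r ^ 2 * kE R i)
        ((ydot R t (1 + rhoI i r) (pL r) - kY R (pR r)) * kE R i)
  | quadL (r : Fin (n - 1)) (i : Fin n → ZMod e)
      (h1 : i (pL r) = i (pR r) + 1) (h2 : i (pR r) ≠ i (pL r) + 1) :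
      DefKLRRel R t n e ℓ κ (kPsi R r ^ 2 * kE R i)
        ((ydot R t (1 - rhoI i r) (pR r) - kY R (pL r)) * kE R i)
  | quadBoth (r : Fin (n - 1)) (i : Fin n → ZMod e)
      (h1 : i (pR r) = i (pL r) + 1) (h2 : i (pL r) = i (pR r) + 1) :
      DefKLRRel R t n e ℓ κ (kPsi R r ^ 2 * kE R i)
        ((ydot R t (1 + rhoI i r) (pL r) - kY R (pR r)) *
          (ydot R t (1 - rhoI i r) (pR r) - kY R (pL r)) * kE R i)
  | quadNone (r : Fin (n - 1)) (i : Fin n → ZMod e) (h1 : i (pL r) ≠ i (pR r))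
      (h2 : i (pR r) ≠ i (pL r) + 1) (h3 : i (pL r) ≠ i (pR r) + 1) :
      DefKLRRel R t n e ℓ κ (kPsi R r ^ 2 * kE R i) (kE R i)
  | braidBoth (r : Fin (n - 1)) (hr : r.1 + 1 < n - 1) (i : Fin n → ZMod e)
      (h0 : i (pM r hr) = i (pL r)) (h1 : i (pR r) = i (pL r) + 1)
      (h2 : i (pL r) = i (pR r) + 1) :
      DefKLRRel R t n e ℓ κ
        ((kPsi R r * kPsi R ⟨r.1 + 1, hr⟩ * kPsi R r -
            kPsi R ⟨r.1 + 1, hr⟩ * kPsi R r * kPsi R ⟨r.1 + 1, hr⟩) * kE R i)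
        ((ydot R t (1 + rhoI i r) (pL r) + ydot R t (1 + rhoI i r) (pM r hr) -
            ydot R t (1 + rhoI i r) (pR r) - ydot R t (1 - rhoI i r) (pR r)) * kE R i)
  | braidR (r : Fin (n - 1)) (hr : r.1 + 1 < n - 1) (i : Fin n → ZMod e)
      (h0 : i (pM r hr) = i (pL r)) (h1 : i (pR r) = i (pL r) + 1)
      (h2 : i (pL r) ≠ i (pR r) + 1) :
      DefKLRRel R t n e ℓ κ
        ((kPsi R r * kPsi R ⟨r.1 + 1, hr⟩ * kPsi R r -
            kPsi R ⟨r.1 + 1, hr⟩ * kPsi R r * kPsi R ⟨r.1 + 1, hr⟩) * kE R i)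
        (algebraMap R _ (-(((t ^ (1 + rhoI i r) : Rˣ) : R))) * kE R i)
  | braidL (r : Fin (n - 1)) (hr : r.1 + 1 < n - 1) (i : Fin n → ZMod e)
      (h0 : i (pM r hr) = i (pL r)) (h1 : i (pL r) = i (pR r) + 1)
      (h2 : i (pR r) ≠ i (pL r) + 1) :
      DefKLRRel R t n e ℓ κ
        ((kPsi R r * kPsi R ⟨r.1 + 1, hr⟩ * kPsi R r -
            kPsi R ⟨r.1 + 1, hr⟩ * kPsi R r * kPsi R ⟨r.1 + 1, hr⟩) * kE R i)
        (kE R i)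
  | braidNone (r : Fin (n - 1)) (hr : r.1 + 1 < n - 1) (i : Fin n → ZMod e)
      (h : ¬(i (pM r hr) = i (pL r) ∧
        (i (pR r) = i (pL r) + 1 ∨ i (pL r) = i (pR r) + 1))) :
      DefKLRRel R t n e ℓ κ
        ((kPsi R r * kPsi R ⟨r.1 + 1, hr⟩ * kPsi R r -
            kPsi R ⟨r.1 + 1, hr⟩ * kPsi R r * kPsi R ⟨r.1 + 1, hr⟩) * kE R i) 0

/-- The deformed cyclotomic quiver Hecke algebra `R_n(R)`. -/
noncomputable abbrev DefKLR (R : Type*) [CommRing R] (t : Rˣ) (n e ℓ : ℕ) [NeZero e]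
    (κ : ℕ → ℤ) : Type _ :=
  RingQuot (DefKLRRel R t n e ℓ κ)

/-- The generator `f_i` of the deformed cyclotomic quiver Hecke algebra. -/
noncomputable def DfGen (R : Type*) [CommRing R] (t : Rˣ) (n e ℓ : ℕ) [NeZero e]
    (κ : ℕ → ℤ) (i : Fin n → ZMod e) : DefKLR R t n e ℓ κ :=
  RingQuot.mkAlgHom R (DefKLRRel R t n e ℓ κ) (kE R i)

/-- The generator `ψ_r` of the deformed cyclotomic quiver Hecke algebra. -/
noncomputable def DpsiGen (R : Type*) [CommRing R] (t : Rˣ) (n e ℓ : ℕ) [NeZero e]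
    (κ : ℕ → ℤ) (r : Fin (n - 1)) : DefKLR R t n e ℓ κ :=
  RingQuot.mkAlgHom R (DefKLRRel R t n e ℓ κ) (kPsi R r)

/-- The generator `y_k` of the deformed cyclotomic quiver Hecke algebra. -/
noncomputable def DyGen (R : Type*) [CommRing R] (t : Rˣ) (n e ℓ : ℕ) [NeZero e]
    (κ : ℕ → ℤ) (k : Fin n) : DefKLR R t n e ℓ κ :=
  RingQuot.mkAlgHom R (DefKLRRel R t n e ℓ κ) (kY R k)

/-! ## Seminormal idempotents -/

/-- The seminormal idempotent `F_T` of the semisimple cyclotomic Hecke algebra: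
`F_T = ∏_{k=1}^n ∏_{c ∈ Cont(n), [c_k(T)] ≠ [c]} (L_k - [c]) / ([c_k(T)] - [c])`. -/
noncomputable def Fidem (K : Type*) [Field K] (tK : Kˣ) (n ℓ : ℕ) (κ : ℕ → ℤ)
    (T : StdTableau ℓ n) : CycHecke K tK n ℓ κ :=
  ((List.finRange n).map (fun k =>
    (((contFinset ℓ n κ).sort (· ≤ ·)).map (fun c =>
      if qint (tK : K) (content κ T (k.1 + 1)) ≠ qint (tK : K) c then
        (Lgen K tK n ℓ κ k - algebraMap K _ (qint (tK : K) c)) *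
          algebraMap K _ ((qint (tK : K) (content κ T (k.1 + 1)) - qint (tK : K) c)⁻¹)
      else 1)).prod)).prod

/-- The residue idempotent `f_i = Σ_{T ∈ Std(i)} F_T`. -/
noncomputable def fres (K : Type*) [Field K] (tK : Kˣ) (n ℓ e : ℕ) (κ : ℕ → ℤ)
    (i : Fin n → ZMod e) : CycHecke K tK n ℓ κ :=
  ∑ᶠ T : {T : StdTableau ℓ n // resSeq e κ T = i}, Fidem K tK n ℓ κ T.1

/-- The simultaneous two-sided eigenspace `H_{S,T}` of the Jucys–Murphy elements. -/
noncomputable def eigSub (K : Type*) [Field K] (tK : Kˣ) (n ℓ : ℕ) (κ : ℕ → ℤ)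
    (S T : StdTableau ℓ n) : Submodule K (CycHecke K tK n ℓ κ) where
  carrier := {h | ∀ k : Fin n,
      Lgen K tK n ℓ κ k * h = qint (tK : K) (content κ S (k.1 + 1)) • h ∧
      h * Lgen K tK n ℓ κ k = qint (tK : K) (content κ T (k.1 + 1)) • h}
  add_mem' := by
    intro a b ha hb
    intro k
    obtain ⟨h1, h2⟩ := ha k
    obtain ⟨h3, h4⟩ := hb k
    exact ⟨by rw [mul_add, h1, h3, smul_add], by rw [add_mul, h2, h4, smul_add]⟩
  zero_mem' := by intro k; simp
  smul_mem' := by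
    intro c a ha
    intro k
    obtain ⟨h1, h2⟩ := ha k
    constructor
    · rw [mul_smul_comm, h1, smul_comm]
    · rw [smul_mul_assoc, h2, smul_comm]

end Paper

open scoped BigOperators
open scoped Classical

set_option linter.all false

namespace Paper.BK

/-! ## Parameters -/

/-- Parameters: an invertible scalar `t` and the quantum integers `c a = [a]_t`, `a ∈ ℤ/e`. -/
structure Par (k : Type*) [Field k] (e : ℕ) where
  t : k
  c : ZMod e → k
  t_ne : t ≠ 0
  inj : Function.Injective c
  c_succ : ∀ a, c (a + 1) = 1 + t * c a
  he : 2 ≤ e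

section par
variable {k : Type*} [Field k] {e : ℕ} (P : Par k e)

/-- The power `t ^ a`, `a ∈ ℤ/e`. -/
def Par.q (a : ZMod e) : k := 1 + (P.t - 1) * P.c a

lemma Par.q_succ (a : ZMod e) : P.q (a + 1) = P.t * P.q a := by
  simp only [Par.q, P.c_succ]; ring

lemma Par.ne_succ (P : Par k e) (a : ZMod e) : a ≠ a + 1 := by
  haveI : Fact (1 < e) := ⟨P.he⟩
  intro h
  have : (1 : ZMod e) = 0 := by simpa using h
  exact one_ne_zero this

lemma Par.q_ne (a : ZMod e) : P.q a ≠ 0 := by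
  intro h
  apply P.ne_succ a
  apply P.inj
  rw [P.c_succ]
  simp only [Par.q] at h
  linear_combination -h

end par

/-- A family of affine functions in two variables, indexed by a pair of residues. -/
structure Lin (k : Type*) (e : ℕ) where
  u0 : ZMod e → ZMod e → k
  u1 : ZMod e → ZMod e → k
  u2 : ZMod e → ZMod e → k

/-- The family does not vanish at the residues. -/
def Lin.Nz {k : Type*} [Field k] {e : ℕ} (u : Lin k e) (P : Par k e) : Prop :=
  ∀ a b, u.u0 a b + u.u1 a b * P.c a + u.u2 a b * P.c b ≠ 0

/-! ## Systems of commuting elements with their spectral idempotents -/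

/-- Commuting elements `x` with a complete system of spectral idempotents `E`. -/
structure Sys {k : Type*} [Field k] {e : ℕ} [NeZero e] (P : Par k e) (n : ℕ)
    (C : Type*) [CommRing C] [Algebra k C] where
  x : Fin n → C
  E : (Fin n → ZMod e) → C
  orth : ∀ i j, i ≠ j → E i * E j = 0
  idem : ∀ i, E i * E i = E i
  complete : ∑ i, E i = 1
  nil : ∀ a i, IsNilpotent ((x a - algebraMap k C (P.c (i a))) * E i)

section sys
variable {k : Type*} [Field k] {e : ℕ} [NeZero e] {P : Par k e} {n : ℕ}
  {C : Type*} [CommRing C] [Algebra k C] (S : Sys P n C)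

namespace Sys

lemma sum_mul_E (f : (Fin n → ZMod e) → C) (i : Fin n → ZMod e) :
    (∑ j, f j * S.E j) * S.E i = f i * S.E i := by
  rw [Finset.sum_mul, Finset.sum_eq_single i]
  · rw [mul_assoc, S.idem]
  · intro j _ hj; rw [mul_assoc, S.orth j i hj, mul_zero]
  · simp

lemma ext_E {f g : C} (h : ∀ i, f * S.E i = g * S.E i) : f = g := by
  rw [← mul_one f, ← mul_one g, ← S.complete, Finset.mul_sum, Finset.mul_sum]
  exact Finset.sum_congr rfl fun i _ => h i

lemma inv_exists (f : (Fin n → ZMod e) → C) (s : (Fin n → ZMod e) → k) (hs : ∀ i, s i ≠ 0)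
    (hf : ∀ i, IsNilpotent ((f i - algebraMap k C (s i)) * S.E i)) :
    ∃ g : C, ∀ i, g * f i * S.E i = S.E i := by
  have key : ∀ i, ∃ w : C, w * f i * S.E i = S.E i := by
    intro i
    have hu : IsUnit (algebraMap k C (s i)) := (IsUnit.mk0 _ (hs i)).map _
    have h2 := IsNilpotent.isUnit_add_left_of_commute (hf i) hu (Commute.all _ _)
    obtain ⟨w, hw⟩ := h2.exists_left_inv
    refine ⟨w, ?_⟩
    linear_combination (S.E i) * hw - w * (f i - algebraMap k C (s i)) * S.idem i
  choose w hw using key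
  refine ⟨∑ j, w j * S.E j, fun i => ?_⟩
  rw [mul_right_comm, S.sum_mul_E, mul_right_comm, hw]

/-- The glued affine function of positions `a`, `b`. -/
noncomputable def lin (u : Lin k e) (a b : Fin n) : C :=
  ∑ i, (algebraMap k C (u.u0 (i a) (i b)) + algebraMap k C (u.u1 (i a) (i b)) * S.x a +
    algebraMap k C (u.u2 (i a) (i b)) * S.x b) * S.E i

lemma lin_E (u : Lin k e) (a b : Fin n) (i) : S.lin u a b * S.E i =
    (algebraMap k C (u.u0 (i a) (i b)) + algebraMap k C (u.u1 (i a) (i b)) * S.x a +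
    algebraMap k C (u.u2 (i a) (i b)) * S.x b) * S.E i :=
  S.sum_mul_E _ i

lemma linv_exists (u : Lin k e) (hu : u.Nz P) (a b : Fin n) :
    ∃ g : C, S.lin u a b * g = 1 := by
  obtain ⟨g, hg⟩ := S.inv_exists (fun i => algebraMap k C (u.u0 (i a) (i b)) +
    algebraMap k C (u.u1 (i a) (i b)) * S.x a +
    algebraMap k C (u.u2 (i a) (i b)) * S.x b)
    (fun i => u.u0 (i a) (i b) + u.u1 (i a) (i b) * P.c (i a) + u.u2 (i a) (i b) * P.c (i b))
    (fun i => hu _ _) (fun i => by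
      have h1 := (S.nil a i)
      have h2 := (S.nil b i)
      have := (Commute.all _ _).isNilpotent_add
        ((Commute.all (algebraMap k C (u.u1 (i a) (i b))) _).isNilpotent_mul_left h1)
        ((Commute.all (algebraMap k C (u.u2 (i a) (i b))) _).isNilpotent_mul_left h2)
      convert this using 1
      simp only [map_add, map_mul]
      ring)
  refine ⟨g, S.ext_E fun i => ?_⟩
  rw [mul_right_comm, S.lin_E, one_mul]
  linear_combination hg i

/-- The inverse of `lin`. -/
noncomputable def linv (u : Lin k e) (hu : u.Nz P) (a b : Fin n) : C :=
  Classical.choose (S.linv_exists u hu a b)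

lemma lin_linv (u : Lin k e) (hu : u.Nz P) (a b : Fin n) :
    S.lin u a b * S.linv u hu a b = 1 :=
  Classical.choose_spec (S.linv_exists u hu a b)

lemma linv_lin (u : Lin k e) (hu : u.Nz P) (a b : Fin n) :
    S.linv u hu a b * S.lin u a b = 1 := by rw [mul_comm, lin_linv]

/-! ### Weight vectors -/

variable {V : Type*} [AddCommGroup V] [Module k V] [Module C V] [IsScalarTower k C V]

/-- `Z` has weight `i`. -/
def wt (S : Sys P n C) {V : Type*} [AddCommGroup V] [Module C V]
    (i : Fin n → ZMod e) (Z : V) : Prop := S.E i • Z = Z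

variable {S}

lemma wt_E (i) (Z : V) : S.wt i (S.E i • Z) := by
  rw [wt, ← mul_smul, S.idem]

lemma wt.fn {i} {Z : V} (h : S.wt i Z) (f : C) : S.wt i (f • Z) := by
  rw [wt, ← mul_smul, mul_comm, mul_smul, h]

lemma wt.congr {i} {Z : V} (h : S.wt i Z) {f g : C} (hfg : f * S.E i = g * S.E i) :
    f • Z = g • Z := by
  rw [← h, ← mul_smul, hfg, mul_smul]

lemma wt.add {i} {Z W : V} (h : S.wt i Z) (h' : S.wt i W) : S.wt i (Z + W) := by
  rw [wt, smul_add, h, h']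

lemma wt.sub {i} {Z W : V} (h : S.wt i Z) (h' : S.wt i W) : S.wt i (Z - W) := by
  rw [wt, smul_sub, h, h']

lemma wt.ne {i j} {Z : V} (h : S.wt i Z) (hij : j ≠ i) : S.E j • Z = 0 := by
  rw [← h, ← mul_smul, S.orth j i hij, zero_smul]

lemma wt.lin {i} {Z : V} (h : S.wt i Z) (u : Lin k e) (a b : Fin n) :
    S.lin u a b • Z = (algebraMap k C (u.u0 (i a) (i b)) +
      algebraMap k C (u.u1 (i a) (i b)) * S.x a +
      algebraMap k C (u.u2 (i a) (i b)) * S.x b) • Z :=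
  h.congr (S.lin_E u a b i)

lemma op_alg (W : V →ₗ[k] V) (s : k) (Z : V) :
    W (algebraMap k C s • Z) = algebraMap k C s • W Z := by
  rw [algebraMap_smul, algebraMap_smul, map_smul]

/-- Two operators which agree on all weight vectors agree. -/
lemma ext_V {W W' : V →ₗ[k] V} (h : ∀ i Z, S.wt i Z → W Z = W' Z) (Z : V) : W Z = W' Z := by
  rw [← one_smul C Z, ← S.complete, Finset.sum_smul, map_sum, map_sum]
  exact Finset.sum_congr rfl fun i _ => h i _ (wt_E i Z)

lemma vec_sum (Z : V) : ∑ i, S.E i • Z = Z := by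
  rw [← Finset.sum_smul, S.complete, one_smul]

lemma vec_ext {Z W : V} (h : ∀ i, S.E i • Z = S.E i • W) : Z = W := by
  rw [← vec_sum (S := S) Z, ← vec_sum (S := S) W]
  exact Finset.sum_congr rfl fun i _ => h i

/-- Eigenvalue argument: intertwiners between different generalized eigenspaces vanish. -/
lemma intertwine_zero {i j} {a b : Fin n} (hab : j a ≠ i b) (W : V →ₗ[k] V)
    (hW : ∀ Z, S.wt i Z → S.x a • W Z = W (S.x b • Z)) {Z : V} (hZ : S.wt i Z) :
    S.E j • W Z = 0 := by
  set u : C := S.x a - algebraMap k C (P.c (i b)) with hu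
  set v : C := S.x b - algebraMap k C (P.c (i b)) with hv
  have h1 : ∀ Z, S.wt i Z → u • W Z = W (v • Z) := by
    intro Z hZ
    rw [hu, hv, sub_smul, sub_smul, map_sub, hW Z hZ, op_alg]
  have h2 : ∀ N : ℕ, ∀ Z, S.wt i Z → u ^ N • W Z = W (v ^ N • Z) := by
    intro N
    induction N with
    | zero => simp
    | succ N ih =>
      intro Z hZ
      rw [pow_succ, mul_smul, h1 Z hZ, ih _ (hZ.fn v), pow_succ, mul_smul]
  obtain ⟨N, hN⟩ := S.nil b i
  have hv0 : v ^ (N + 1) • Z = 0 := by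
    have : v ^ (N + 1) * S.E i = 0 * S.E i := by
      have hE : S.E i ^ (N + 1) = S.E i := by
        have : IsIdempotentElem (S.E i) := S.idem i
        exact this.pow_succ_eq N
      rw [← hE, ← mul_pow, pow_succ, hN]; simp
    rw [hZ.congr this, zero_smul]
  have h3 : u ^ (N + 1) • W Z = 0 := by rw [h2 _ Z hZ, hv0, map_zero]
  obtain ⟨g, hg⟩ := S.inv_exists
    (fun m => if m = j then u else 1) (fun m => if m = j then P.c (j a) - P.c (i b) else 1)
    (by
      intro m; split_ifs
      · exact sub_ne_zero.mpr fun h => hab (P.inj h)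
      · exact one_ne_zero)
    (by
      intro m; split_ifs with h
      · subst h
        have := S.nil a m
        rw [hu, map_sub]
        convert this using 2
        ring
      · simp)
  have h4 := hg j
  simp only [if_true] at h4
  have h5 : ∀ N : ℕ, g ^ N * u ^ N * S.E j = S.E j := by
    intro N
    induction N with
    | zero => simp
    | succ N ih => linear_combination ih * (g * u) + h4
  rw [← h5 (N + 1), mul_right_comm, mul_smul, h3, smul_zero]

end Sys
end sys
end Paper.BK

open scoped BigOperators
open scoped Classical
set_option linter.all false

namespace Paper.BK

/-! ## Operators which permute the weights -/

/-- The transposition of positions. -/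
def sw {n : ℕ} (r : Fin (n - 1)) (a : Fin n) : Fin n :=
  if a = pL r then pR r else if a = pR r then pL r else a

lemma pL_ne_pR {n : ℕ} (r : Fin (n - 1)) : pL r ≠ pR r := by
  simp [pL, pR, Fin.ext_iff]

lemma sw_L {n : ℕ} (r : Fin (n - 1)) : sw r (pL r) = pR r := by simp [sw]

lemma sw_R {n : ℕ} (r : Fin (n - 1)) : sw r (pR r) = pL r := by
  simp [sw, (pL_ne_pR r).symm]

lemma sw_far {n : ℕ} (r : Fin (n - 1)) {a : Fin n} (h1 : a ≠ pL r) (h2 : a ≠ pR r) :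
    sw r a = a := by simp [sw, h1, h2]

lemma sw_sw {n : ℕ} (r : Fin (n - 1)) (a : Fin n) : sw r (sw r a) = a := by
  by_cases h1 : a = pL r
  · rw [h1, sw_L, sw_R]
  by_cases h2 : a = pR r
  · rw [h2, sw_R, sw_L]
  rw [sw_far r h1 h2, sw_far r h1 h2]

lemma swapSeq_apply {n e : ℕ} (i : Fin n → ZMod e) (r : Fin (n - 1)) (a : Fin n) :
    swapSeq i r a = i (sw r a) := by
  simp only [swapSeq, sw]; split_ifs <;> rfl

lemma swapSeq_swapSeq {n e : ℕ} (i : Fin n → ZMod e) (r : Fin (n - 1)) :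
    swapSeq (swapSeq i r) r = i := by
  funext a; rw [swapSeq_apply, swapSeq_apply, sw_sw]

lemma swapSeq_eq {n e : ℕ} (i : Fin n → ZMod e) (r : Fin (n - 1)) (h : i (pL r) = i (pR r)) :
    swapSeq i r = i := by
  funext a; simp only [swapSeq]; split_ifs with h1 h2
  · rw [h1, h]
  · rw [h2, h]
  · rfl

/-- The correction terms of the commutation relations. -/
noncomputable def dx {k : Type*} [Field k] {n e : ℕ} (h : ZMod e → k) (r : Fin (n - 1))
    (i : Fin n → ZMod e) (a : Fin n) : k :=
  if i (pL r) = i (pR r) then (if a = pR r then h (i (pL r)) else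
    if a = pL r then - h (i (pL r)) else 0) else 0

section dxs
variable {k : Type*} [Field k] {n e : ℕ} (h : ZMod e → k) (r : Fin (n - 1))
    (i : Fin n → ZMod e)

lemma dx_ne (hi : i (pL r) ≠ i (pR r)) (a : Fin n) : dx h r i a = 0 := by simp [dx, hi]

lemma dx_R (hi : i (pL r) = i (pR r)) : dx h r i (pR r) = h (i (pL r)) := by simp [dx, hi]

lemma dx_L (hi : i (pL r) = i (pR r)) : dx h r i (pL r) = - h (i (pL r)) := by
  simp [dx, hi, pL_ne_pR]

lemma dx_far {a : Fin n} (h1 : a ≠ pL r) (h2 : a ≠ pR r) : dx h r i a = 0 := by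
  simp [dx, h1, h2]

end dxs

section pre
variable {k : Type*} [Field k] {e : ℕ} [NeZero e] {P : Par k e} {n : ℕ}
  {C : Type*} [CommRing C] [Algebra k C] (S : Sys P n C)
variable {V : Type*} [AddCommGroup V] [Module k V] [Module C V] [IsScalarTower k C V]

/-- Operators with all the relations of an affine quiver Hecke type algebra except the
braid relations. -/
structure Pre (h : ZMod e → k) (Q : Fin (n - 1) → (Fin n → ZMod e) → C)
    (τ : Fin (n - 1) → V →ₗ[k] V) : Prop where
  wt : ∀ r i Z, S.wt i Z → S.wt (swapSeq i r) (τ r Z)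
  mv : ∀ r i Z, S.wt i Z → ∀ a, S.x a • τ r Z = τ r (S.x (sw r a) • Z) +
    algebraMap k C (dx h r i a) • Z
  sq : ∀ r i Z, S.wt i Z → τ r (τ r Z) = Q r i • Z
  comm : ∀ r s : Fin (n - 1), (r.1 + 1 < s.1 ∨ s.1 + 1 < r.1) → ∀ Z, τ r (τ s Z) = τ s (τ r Z)

/-- `f` moves through `τ` to `g`, up to `d`. -/
def Mvd (τ : V →ₗ[k] V) (i : Fin n → ZMod e) (f g d : C) : Prop :=
  ∀ Z, S.wt i Z → f • τ Z = τ (g • Z) + d • Z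

variable {S}
variable {τ : V →ₗ[k] V} {i : Fin n → ZMod e}

lemma Mvd.add {f g d f' g' d' : C} (h : Mvd S τ i f g d) (h' : Mvd S τ i f' g' d') :
    Mvd S τ i (f + f') (g + g') (d + d') := by
  intro Z hZ
  rw [add_smul, h Z hZ, h' Z hZ, add_smul, map_add]; module

lemma Mvd.mul {f g d f' g' d' : C} (h : Mvd S τ i f g d) (h' : Mvd S τ i f' g' d') :
    Mvd S τ i (f * f') (g * g') (d * g' + f * d') := by
  intro Z hZ
  rw [mul_smul, h' Z hZ, smul_add, h _ (hZ.fn _), mul_smul]; module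

lemma Mvd.alg (s : k) : Mvd S τ i (algebraMap k C s) (algebraMap k C s) 0 := by
  intro Z hZ
  rw [Sys.op_alg]; module

lemma Mvd.inv {f g d f' g' : C} (h : Mvd S τ i f g d) (hf : f * f' = 1) (hg : g * g' = 1) :
    Mvd S τ i f' g' (- (f' * d * g')) := by
  intro Z hZ
  have h1 := h (g' • Z) (hZ.fn _)
  rw [← mul_smul g, hg, one_smul] at h1
  have h2 := congrArg (fun v => f' • v) h1
  simp only [← mul_smul, smul_add] at h2
  rw [mul_comm f', hf, one_smul] at h2
  rw [h2, ← mul_assoc]; module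

lemma Mvd.congr {f g d f' g' d' : C} (hw : ∀ Z, S.wt i Z → S.wt (swapSeq i r) (τ Z)) 
    (h : Mvd S τ i f g d) 
    (hf : f * S.E (swapSeq i r) = f' * S.E (swapSeq i r)) (hg : g * S.E i = g' * S.E i)
    (hd : d * S.E i = d' * S.E i) : Mvd S τ i f' g' d' := by
  intro Z hZ
  rw [← (hw Z hZ).congr hf, h Z hZ, hZ.congr hg, hZ.congr hd]

variable {h : ZMod e → k} {Q : Fin (n - 1) → (Fin n → ZMod e) → C}
    {τ : Fin (n - 1) → V →ₗ[k] V}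

lemma Pre.mx (p : Pre S h Q τ) (r i a) : Mvd S (τ r) i (S.x a) (S.x (sw r a))
    (algebraMap k C (dx h r i a)) := fun Z hZ => p.mv r i Z hZ a

/-- Moving a glued affine function. -/
lemma Pre.mlin (p : Pre S h Q τ) (r i) (u : Lin k e) (a b : Fin n) :
    Mvd S (τ r) i (S.lin u a b) (S.lin u (sw r a) (sw r b))
      (algebraMap k C (u.u1 (i (sw r a)) (i (sw r b)) * dx h r i a +
        u.u2 (i (sw r a)) (i (sw r b)) * dx h r i b)) := by
  intro Z hZ
  rw [(p.wt r i Z hZ).lin, hZ.lin, swapSeq_apply, swapSeq_apply]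
  rw [((Mvd.alg (u.u0 (i (sw r a)) (i (sw r b)))).add ((Mvd.alg _).mul (p.mx r i a))).add
    ((Mvd.alg _).mul (p.mx r i b)) Z hZ]
  simp only [map_add, map_mul]
  module

lemma Pre.mlinv (p : Pre S h Q τ) (r i) (u : Lin k e) (hu : u.Nz P) (a b : Fin n) :
    Mvd S (τ r) i (S.linv u hu a b) (S.linv u hu (sw r a) (sw r b))
      (- (S.linv u hu a b * (algebraMap k C (u.u1 (i (sw r a)) (i (sw r b)) * dx h r i a +
        u.u2 (i (sw r a)) (i (sw r b)) * dx h r i b)) * S.linv u hu (sw r a) (sw r b))) :=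
  (p.mlin r i u a b).inv (S.lin_linv u hu a b) (S.lin_linv u hu _ _)

/-- Version of the move lemma without correction term. -/
lemma Pre.mlin0 (p : Pre S h Q τ) (r i) (u : Lin k e) {a b a' b' : Fin n}
    (ha : sw r a = a') (hb : sw r b = b')
    (h0 : u.u1 (i a') (i b') * dx h r i a + u.u2 (i a') (i b') * dx h r i b = 0)
    {Z : V} (hZ : S.wt i Z) : S.lin u a b • τ r Z = τ r (S.lin u a' b' • Z) := by
  have := p.mlin r i u a b Z hZ
  rwa [ha, hb, h0, map_zero, zero_smul, add_zero] at this

lemma Pre.mlinv0 (p : Pre S h Q τ) (r i) (u : Lin k e) (hu : u.Nz P) {a b a' b' : Fin n}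
    (ha : sw r a = a') (hb : sw r b = b')
    (h0 : u.u1 (i a') (i b') * dx h r i a + u.u2 (i a') (i b') * dx h r i b = 0)
    {Z : V} (hZ : S.wt i Z) : S.linv u hu a b • τ r Z = τ r (S.linv u hu a' b' • Z) := by
  have := p.mlinv r i u hu a b Z hZ
  rwa [ha, hb, h0, map_zero, mul_zero, zero_mul, neg_zero, zero_smul, add_zero] at this

/-- Rescaling of the operators. -/
lemma Pre.rescale (p : Pre S h Q τ) (g g' : Fin (n - 1) → C) (s : ZMod e → k)
    (τ' : Fin (n - 1) → V →ₗ[k] V) (hτ' : ∀ r i Z, S.wt i Z → τ' r Z = τ r (g r • Z))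
    (hg : ∀ r i Z, S.wt i Z → g r • τ r Z = τ r (g' r • Z))
    (hs : ∀ r i, i (pL r) = i (pR r) → g r * S.E i = algebraMap k C (s (i (pL r))) * S.E i)
    (hfar : ∀ r s : Fin (n - 1), (r.1 + 1 < s.1 ∨ s.1 + 1 < r.1) → ∀ i Z, S.wt i Z →
      g r • τ s Z = τ s (g r • Z))
    (h' : ZMod e → k) (hh : ∀ a, h' a = h a * s a)
    (Q' : Fin (n - 1) → (Fin n → ZMod e) → C)
    (hQ : ∀ r i, Q' r i * S.E i = Q r i * (g r * g' r) * S.E i) : Pre S h' Q' τ' := by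
  have hwt : ∀ r i Z, S.wt i Z → S.wt (swapSeq i r) (τ' r Z) := by
    intro r i Z hZ
    rw [hτ' r i Z hZ]; exact p.wt r i _ (hZ.fn _)
  refine ⟨hwt, ?_, ?_, ?_⟩
  · intro r i Z hZ a
    rw [hτ' r i Z hZ, hτ' r i _ (hZ.fn _), p.mv r i _ (hZ.fn _), ← mul_smul, ← mul_smul,
      mul_comm (S.x _)]
    congr 1
    rw [← mul_smul]
    by_cases hi : i (pL r) = i (pR r)
    · apply hZ.congr
      rw [mul_assoc, hs r i hi, ← mul_assoc, ← map_mul]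
      congr 2
      simp only [dx, if_pos hi, hh]; split_ifs <;> ring
    · rw [dx_ne _ _ _ hi, dx_ne _ _ _ hi]; simp
  · intro r i Z hZ
    rw [hτ' r _ _ (hwt r i Z hZ), hτ' r i Z hZ, hg r i _ (hZ.fn _), ← mul_smul, 
      p.sq r i _ (hZ.fn _), ← mul_smul]
    apply hZ.congr
    rw [hQ]; ring
  · intro r s hrs Z
    have := Sys.ext_V (S := S) (W := τ' r ∘ₗ τ' s) (W' := τ' s ∘ₗ τ' r) (fun i Z hZ => by
      simp only [LinearMap.comp_apply]
      rw [hτ' r _ _ (hwt s i Z hZ), hτ' s i Z hZ, hτ' s _ _ (hwt r i Z hZ), hτ' r i Z hZ,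
        hfar r s hrs i _ (hZ.fn _), hfar s r hrs.symm i _ (hZ.fn _), p.comm r s hrs, ← mul_smul,
        ← mul_smul, mul_comm]) Z
    exact this

end pre
end Paper.BK

open scoped BigOperators
open scoped Classical
set_option linter.all false

namespace Paper.BK

section data
variable {k : Type*} [Field k] {e : ℕ} [NeZero e] (P : Par k e)

/-- `1 - x_a + t x_b`. -/
def uM : Lin k e := ⟨fun _ _ => 1, fun _ _ => -1, fun _ _ => P.t⟩

/-- The rescaling units. -/
noncomputable def uG : Lin k e :=
  ⟨fun p q => if p = q then (P.q p)⁻¹ else if p = q + 1 then P.q p else 1,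
   fun p q => if p = q then 0 else if p = q + 1 then 0 else -1,
   fun p q => if p = q then 0 else if p = q + 1 then 0 else P.t⟩

lemma uG_nz : (uG P).Nz P := by
  intro a b
  simp only [uG]
  split_ifs with h1 h2
  · simpa using P.q_ne a
  · simpa using P.q_ne a
  · intro h
    apply h2
    apply P.inj
    rw [P.c_succ]
    linear_combination -h

variable {P} {n : ℕ}
  {C : Type*} [CommRing C] [Algebra k C] (S : Sys P n C)

namespace Sys

/-- `1 - x_a + t x_b`. -/
noncomputable def M (a b : Fin n) : C := S.lin (uM P) a b

lemma M_eq (a b : Fin n) : S.M a b = 1 - S.x a + algebraMap k C P.t * S.x b := by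
  apply S.ext_E
  intro i
  rw [M, lin_E]
  simp only [uM, map_one, map_neg]
  ring

/-- The nilpotent KLR elements `y_a`. -/
noncomputable def y (a : Fin n) : C :=
  ∑ i, (algebraMap k C (P.q (i a))⁻¹ * (S.x a - algebraMap k C (P.c (i a)))) * S.E i

lemma y_E (a : Fin n) (i) : S.y a * S.E i =
    algebraMap k C (P.q (i a))⁻¹ * (S.x a - algebraMap k C (P.c (i a))) * S.E i :=
  S.sum_mul_E _ i

lemma x_E (a : Fin n) (i) : S.x a * S.E i =
    (algebraMap k C (P.q (i a)) * S.y a + algebraMap k C (P.c (i a))) * S.E i := by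
  have h1 : algebraMap k C (P.q (i a)) * algebraMap k C (P.q (i a))⁻¹ = 1 := by
    rw [← map_mul, mul_inv_cancel₀ (P.q_ne _), map_one]
  linear_combination - algebraMap k C (P.q (i a)) * S.y_E a i -
    (S.x a - algebraMap k C (P.c (i a))) * S.E i * h1

/-- The quadratic polynomials of the intertwiners. -/
noncomputable def QI (r : Fin (n - 1)) (i : Fin n → ZMod e) : C :=
  if i (pL r) = i (pR r) then 0 else S.M (pL r) (pR r) * S.M (pR r) (pL r)

/-- The KLR polynomial in `y_a, y_b`. -/
noncomputable def QK' (p q : ZMod e) (a b : Fin n) : C :=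
  if p = q then 0 else
  if q = p + 1 then (if p = q + 1 then (S.y b - S.y a) * (S.y a - S.y b) else S.y a - S.y b)
  else (if p = q + 1 then S.y b - S.y a else 1)

/-- The KLR quadratic polynomials. -/
noncomputable def QK (r : Fin (n - 1)) (i : Fin n → ZMod e) : C :=
  S.QK' (i (pL r)) (i (pR r)) (pL r) (pR r)

/-- Braid correction for intertwiners. -/
noncomputable def BI (i : Fin n → ZMod e) (a b c : Fin n) : C :=
  if i c = i a ∧ i a ≠ i b then S.M b c - algebraMap k C P.t * S.M a b else 0

/-- Braid correction for KLR generators. -/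
noncomputable def BK (i : Fin n → ZMod e) (a b c : Fin n) : C :=
  if i c = i a then
    (if i b = i a + 1 then (if i a = i b + 1 then S.y a - 2 * S.y b + S.y c else -1)
      else (if i a = i b + 1 then 1 else 0))
  else 0

/-- The rescaling units. -/
noncomputable def G (a b : Fin n) : C := S.lin (uG P) a b

lemma G_diag {a b : Fin n} {i} (h : i a = i b) :
    S.G a b * S.E i = algebraMap k C (P.q (i a))⁻¹ * S.E i := by
  rw [G, lin_E]; simp [uG, h]

lemma G_succ {a b : Fin n} {i} (h : i a = i b + 1) :
    S.G a b * S.E i = algebraMap k C (P.q (i a)) * S.E i := by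
  have := (P.ne_succ (i b)).symm
  rw [G, lin_E]; simp [uG, h, this]

lemma G_other {a b : Fin n} {i} (h : i a ≠ i b) (h' : i a ≠ i b + 1) :
    S.G a b * S.E i = S.M a b * S.E i := by
  rw [G, lin_E, M_eq]; simp [uG, h, h']; ring

lemma M_succ {a b : Fin n} {i} (h : i a = i b + 1) :
    S.M a b * S.E i = algebraMap k C (P.q (i a)) * (S.y b - S.y a) * S.E i := by
  have h1 := congrArg (algebraMap k C) (P.c_succ (i b))
  have h2 := congrArg (algebraMap k C) (P.q_succ (i b))
  rw [← h] at h1 h2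
  simp only [map_add, map_mul, map_one] at h1 h2
  rw [M_eq]
  linear_combination - S.x_E a i + algebraMap k C P.t * S.x_E b i - S.E i * h1
    - S.y b * S.E i * h2

/-- The basic identity between the two kinds of quadratic polynomials. -/
lemma MM_E {a b : Fin n} {i} (h : i a ≠ i b) :
    S.M a b * S.M b a * S.E i = S.QK' (i a) (i b) a b * (S.G a b * S.G b a) * S.E i := by
  simp only [QK', if_neg h]
  split_ifs with h1 h2 h2
  · linear_combination S.M b a * S.M_succ h2 +
      algebraMap k C (P.q (i a)) * (S.y b - S.y a) * S.M_succ h1 -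
      (S.y b - S.y a) * (S.y a - S.y b) * (S.G b a * S.G_succ h2 +
        algebraMap k C (P.q (i a)) * S.G_succ h1)
  · linear_combination S.M a b * S.M_succ h1 - (S.y a - S.y b) * (S.G b a * S.G_other h h2 +
      S.M a b * S.G_succ h1)
  · linear_combination S.M b a * S.M_succ h2 - (S.y b - S.y a) * (S.G a b * S.G_other h.symm h1 +
      S.M b a * S.G_succ h2)
  · linear_combination - S.G a b * S.G_other h.symm h1 - S.M b a * S.G_other h h2

/-- The basic identity for the braid corrections. -/
lemma braid_E {a b c : Fin n} {i} (h : i c = i a) (h' : i a ≠ i b) :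
    (S.M b c - algebraMap k C P.t * S.M a b +
      algebraMap k C ((uG P).u2 (i b) (i a)) * S.QK' (i a) (i b) a b * S.G a b
      + algebraMap k C ((uG P).u1 (i a) (i b)) * S.QK' (i b) (i c) b c * S.G b c) * S.E i
     = S.BK i a b c * (S.G a b * S.G b c * algebraMap k C (P.q (i a))⁻¹) * S.E i := by
  have hu : algebraMap k C (P.q (i a)) * algebraMap k C (P.q (i a))⁻¹ = 1 := by
    rw [← map_mul, mul_inv_cancel₀ (P.q_ne _), map_one]
  have hM1 := S.M_eq a b
  have hM2 := S.M_eq b c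
  have hxa := S.x_E a i
  have hxb := S.x_E b i
  have hxc := S.x_E c i
  simp only [QK', h, if_neg h', if_neg h'.symm, BK, uG, if_true]
  rw [h] at hxc
  split_ifs with h1 h2 h2
  · have e1 := S.G_succ h2
    have e2 := S.G_succ (a := b) (b := c) (i := i) (by rw [h]; exact h1)
    have e3 := S.M_succ h2
    have e4 := S.M_succ (a := b) (b := c) (i := i) (by rw [h]; exact h1)
    have q1 := congrArg (algebraMap k C) (P.q_succ (i a))
    have q2 := congrArg (algebraMap k C) (P.q_succ (i b))
    rw [← h1] at q1
    rw [← h2] at q2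
    simp only [map_mul] at q1 q2
    simp only [map_zero, zero_mul, add_zero]
    linear_combination e4 - algebraMap k C P.t * e3 + (S.y b - S.y a) * S.E i * q1
      - (S.y a - 2 * S.y b + S.y c) * algebraMap k C (P.q (i a))⁻¹ *
        (S.G b c * e1 + algebraMap k C (P.q (i a)) * e2)
      - (S.y a - 2 * S.y b + S.y c) * algebraMap k C (P.q (i b)) * S.E i * hu
  · have e1 := S.G_other h' h2
    have e2 := S.G_succ (a := b) (b := c) (i := i) (by rw [h]; exact h1)
    have q1 := congrArg (algebraMap k C) (P.q_succ (i a))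
    rw [← h1] at q1
    simp only [map_mul] at q1
    simp only [map_zero, map_neg, map_one, zero_mul, add_zero]
    have e4 := S.M_succ (a := b) (b := c) (i := i) (by rw [h]; exact h1)
    linear_combination e4 - (S.y c - S.y b) * e2 + algebraMap k C (P.q (i a))⁻¹ *
        (S.G b c * e1 + S.M a b * e2) + S.M a b * S.E i *
        (algebraMap k C (P.q (i a))⁻¹ * q1 + algebraMap k C P.t * hu)
  · have e1 := S.G_succ h2
    have e2 := S.G_other (a := b) (b := c) (i := i) (by rw [h]; exact h'.symm)
      (by rw [h]; exact h1)
    simp only [map_zero, zero_mul, add_zero]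
    have e3 := S.M_succ h2
    linear_combination - algebraMap k C P.t * e3 + algebraMap k C P.t * (S.y b - S.y a) * e1
      - algebraMap k C (P.q (i a))⁻¹ * (S.G b c * e1 + algebraMap k C (P.q (i a)) * e2)
      - S.M b c * S.E i * hu
  · have e1 := S.G_other h' h2
    have e2 := S.G_other (a := b) (b := c) (i := i) (by rw [h]; exact h'.symm)
      (by rw [h]; exact h1)
    simp only [map_neg, map_one]
    linear_combination algebraMap k C P.t * e1 - e2

end Sys
end data
end Paper.BK

open scoped BigOperators
open scoped Classical
set_option linter.all false

namespace Paper.BK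

section
variable {n : ℕ} {r s : Fin (n - 1)}

lemma pL_s (hs : s.1 = r.1 + 1) : pL s = pR r := by
  simp [pL, pR, Fin.ext_iff, hs]

lemma p3_ne1 (hs : s.1 = r.1 + 1) : pR s ≠ pL r := by
  simp only [pL, pR, ne_eq, Fin.ext_iff]; omega

lemma p3_ne2 (hs : s.1 = r.1 + 1) : pR s ≠ pR r := by
  simp only [pL, pR, ne_eq, Fin.ext_iff]; omega

lemma sw_r3 (hs : s.1 = r.1 + 1) : sw r (pR s) = pR s := sw_far r (p3_ne1 hs) (p3_ne2 hs)

lemma sw_s1 (hs : s.1 = r.1 + 1) : sw s (pL r) = pL r :=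
  sw_far s (by rw [pL_s hs]; exact pL_ne_pR r) (p3_ne1 hs).symm

lemma sw_s2 (hs : s.1 = r.1 + 1) : sw s (pR r) = pR s := by rw [← pL_s hs, sw_L]

lemma sw_s3 (hs : s.1 = r.1 + 1) : sw s (pR s) = pR r := by rw [sw_R, pL_s hs]

end

section cmp
variable {k : Type*} [Field k] {e : ℕ} [NeZero e] {P : Par k e} {n : ℕ}
  {C : Type*} [CommRing C] [Algebra k C] {S : Sys P n C}
variable {V : Type*} [AddCommGroup V] [Module k V] [Module C V] [IsScalarTower k C V]
variable {h : ZMod e → k} {Q : Fin (n - 1) → (Fin n → ZMod e) → C}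
    {τ ψ : Fin (n - 1) → V →ₗ[k] V}

lemma Pre.mG (p : Pre S h Q ψ) (r i) {a b a' b' : Fin n}
    (ha : sw r a = a') (hb : sw r b = b') {Z : V} (hZ : S.wt i Z) :
    S.G a b • ψ r Z = ψ r (S.G a' b' • Z) +
      algebraMap k C ((uG P).u1 (i a') (i b') * dx h r i a +
        (uG P).u2 (i a') (i b') * dx h r i b) • Z := by
  have := p.mlin r i (uG P) a b Z hZ
  rwa [ha, hb] at this

lemma uG_u1_diag (a : ZMod e) : (uG P).u1 a a = 0 := by simp [uG]
lemma uG_u2_diag (a : ZMod e) : (uG P).u2 a a = 0 := by simp [uG]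

lemma cmp_left (p : Pre S h Q ψ) (hτ : ∀ r Z, τ r Z = ψ r (S.G (pL r) (pR r) • Z))
    {r s : Fin (n - 1)} (hs : s.1 = r.1 + 1) {i} {Z : V} (hZ : S.wt i Z) :
    τ r (τ s (τ r Z)) =
      ψ r (ψ s (ψ r ((S.G (pR r) (pR s) * S.G (pL r) (pR s) * S.G (pL r) (pR r)) • Z))) -
      ((if i (pL r) = i (pR s) then
        algebraMap k C ((uG P).u2 (i (pR r)) (i (pL r)) * h (i (pL r))) else 0) *
        Q r i * S.G (pL r) (pR s) * S.G (pL r) (pR r)) • Z := by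
  have g1 : ∀ Z' : V, S.wt i Z' → S.G (pR r) (pR s) • ψ r Z' =
      ψ r (S.G (pL r) (pR s) • Z') +
        algebraMap k C ((uG P).u1 (i (pL r)) (i (pR s)) * dx h r i (pR r)) • Z' := by
    intro Z' hZ'
    rw [p.mG r i (sw_R r) (sw_r3 hs) hZ', dx_far h r i (p3_ne1 hs) (p3_ne2 hs), mul_zero, add_zero]
  have g2 : ∀ Z' : V, S.wt i Z' → S.G (pL r) (pR s) • ψ r Z' =
      ψ r (S.G (pR r) (pR s) • Z') +
        algebraMap k C ((uG P).u1 (i (pR r)) (i (pR s)) * dx h r i (pL r)) • Z' := by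
    intro Z' hZ'
    rw [p.mG r i (sw_L r) (sw_r3 hs) hZ', dx_far h r i (p3_ne1 hs) (p3_ne2 hs), mul_zero, add_zero]
  have g3 : ∀ j, ∀ Z' : V, S.wt j Z' → S.G (pL r) (pR r) • ψ s Z' =
      ψ s (S.G (pL r) (pR s) • Z') +
        algebraMap k C ((uG P).u2 (j (pL r)) (j (pR s)) * dx h s j (pR r)) • Z' := by
    intro j Z' hZ'
    rw [p.mG s j (sw_s1 hs) (sw_s2 hs) hZ', dx_far h s j (by rw [pL_s hs]; exact pL_ne_pR r)
      (p3_ne1 hs).symm, mul_zero, zero_add]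
  have c0 : (uG P).u1 (i (pR r)) (i (pR s)) * dx h r i (pL r) =
      - ((uG P).u1 (i (pL r)) (i (pR s)) * dx h r i (pR r)) := by
    by_cases hi : i (pL r) = i (pR r)
    · rw [dx_L _ _ _ hi, dx_R _ _ _ hi, hi]; ring
    · rw [dx_ne _ _ _ hi, dx_ne _ _ _ hi]; ring
  have c1 : ((uG P).u1 (i (pL r)) (i (pR s)) * dx h r i (pR r)) *
      ((uG P).u2 (i (pL r)) (i (pR s)) * dx h s i (pR r)) = 0 := by
    by_cases hi : i (pL r) = i (pR r)
    · by_cases hi' : i (pR r) = i (pR s)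
      · rw [hi, hi', uG_u1_diag]; ring
      · rw [dx_ne h s i (by rwa [pL_s hs])]; ring
    · rw [dx_ne _ _ _ hi]; ring
  have c2 : (uG P).u2 (swapSeq i r (pL r)) (swapSeq i r (pR s)) * dx h s (swapSeq i r) (pR r) =
      - (if i (pL r) = i (pR s) then ((uG P).u2 (i (pR r)) (i (pL r)) * h (i (pL r))) else 0) := by
    split_ifs with hi
    · rw [← pL_s hs, dx_L, pL_s hs]
      · simp only [swapSeq_apply, sw_L, sw_R, sw_r3 hs]
        rw [hi]; ring
      · simp only [swapSeq_apply, pL_s hs, sw_L, sw_R, sw_r3 hs, hi]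
    · rw [dx_ne]
      · ring
      · simpa only [swapSeq_apply, pL_s hs, sw_L, sw_R, sw_r3 hs] using hi
  have hW := p.wt r i _ ((hZ.fn (S.G (pL r) (pR r))).fn (S.G (pL r) (pR s)))
  rw [hτ r, hτ s, hτ r, pL_s hs, g1 _ (hZ.fn _), map_add, smul_add, g3 _ _ hW, Sys.op_alg,
    smul_comm (S.G (pL r) (pR r)) (algebraMap k C _), g3 i _ (hZ.fn _), g2 _ ((hZ.fn _).fn _), c2, c0]
  simp only [map_add, smul_add, Sys.op_alg]
  rw [p.sq r i _ ((hZ.fn _).fn _)]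
  have c3 := congrArg (algebraMap k C) c1
  simp only [map_mul, map_zero] at c3
  have c4 : algebraMap k C (- (if i (pL r) = i (pR s) then ((uG P).u2 (i (pR r)) (i (pL r)) *
      h (i (pL r))) else 0)) = - (if i (pL r) = i (pR s) then
        algebraMap k C ((uG P).u2 (i (pR r)) (i (pL r)) * h (i (pL r))) else 0) := by
    split_ifs <;> simp
  rw [c4]
  simp only [← mul_smul, map_neg, map_mul, mul_comm, mul_left_comm, mul_assoc]
  linear_combination (norm := module) c3 • (ψ r (S.G (pL r) (pR r) • Z))

lemma cmp_right (p : Pre S h Q ψ) (hτ : ∀ r Z, τ r Z = ψ r (S.G (pL r) (pR r) • Z))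
    {r s : Fin (n - 1)} (hs : s.1 = r.1 + 1) {i} {Z : V} (hZ : S.wt i Z) :
    τ s (τ r (τ s Z)) =
      ψ s (ψ r (ψ s ((S.G (pR r) (pR s) * S.G (pL r) (pR s) * S.G (pL r) (pR r)) • Z))) +
      ((if i (pL r) = i (pR s) then
        algebraMap k C ((uG P).u1 (i (pL r)) (i (pR r)) * h (i (pL r))) else 0) *
        Q s i * S.G (pL r) (pR s) * S.G (pR r) (pR s)) • Z := by
  have far1 : ∀ j, dx h s j (pL r) = 0 := fun j =>
    dx_far h s j (by rw [pL_s hs]; exact pL_ne_pR r) (p3_ne1 hs).symm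
  have g1 : ∀ Z' : V, S.wt i Z' → S.G (pL r) (pR r) • ψ s Z' =
      ψ s (S.G (pL r) (pR s) • Z') +
        algebraMap k C ((uG P).u2 (i (pL r)) (i (pR s)) * dx h s i (pR r)) • Z' := by
    intro Z' hZ'
    rw [p.mG s i (sw_s1 hs) (sw_s2 hs) hZ', far1, mul_zero, zero_add]
  have g2 : ∀ Z' : V, S.wt i Z' → S.G (pL r) (pR s) • ψ s Z' =
      ψ s (S.G (pL r) (pR r) • Z') +
        algebraMap k C ((uG P).u2 (i (pL r)) (i (pR r)) * dx h s i (pR s)) • Z' := by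
    intro Z' hZ'
    rw [p.mG s i (sw_s1 hs) (sw_s3 hs) hZ', far1, mul_zero, zero_add]
  have g3 : ∀ j, ∀ Z' : V, S.wt j Z' → S.G (pR r) (pR s) • ψ r Z' =
      ψ r (S.G (pL r) (pR s) • Z') +
        algebraMap k C ((uG P).u1 (j (pL r)) (j (pR s)) * dx h r j (pR r)) • Z' := by
    intro j Z' hZ'
    rw [p.mG r j (sw_R r) (sw_r3 hs) hZ', dx_far h r j (p3_ne1 hs) (p3_ne2 hs), mul_zero, add_zero]
  have c0 : (uG P).u2 (i (pL r)) (i (pR r)) * dx h s i (pR s) =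
      - ((uG P).u2 (i (pL r)) (i (pR s)) * dx h s i (pR r)) := by
    rw [← pL_s hs]
    by_cases hi : i (pL s) = i (pR s)
    · rw [dx_L _ _ _ hi, dx_R _ _ _ hi, hi]; ring
    · rw [dx_ne _ _ _ hi, dx_ne _ _ _ hi]; ring
  have c1 : ((uG P).u2 (i (pL r)) (i (pR s)) * dx h s i (pR r)) *
      ((uG P).u1 (i (pL r)) (i (pR s)) * dx h r i (pR r)) = 0 := by
    by_cases hi : i (pL r) = i (pR r)
    · by_cases hi' : i (pR r) = i (pR s)
      · rw [hi, hi', uG_u1_diag]; ring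
      · rw [dx_ne h s i (by rwa [pL_s hs])]; ring
    · rw [dx_ne h r i hi]; ring
  have c2 : (uG P).u1 (swapSeq i s (pL r)) (swapSeq i s (pR s)) * dx h r (swapSeq i s) (pR r) =
      (if i (pL r) = i (pR s) then ((uG P).u1 (i (pL r)) (i (pR r)) * h (i (pL r))) else 0) := by
    split_ifs with hi
    · rw [dx_R]
      · simp only [swapSeq_apply, sw_s1 hs, sw_s2 hs, sw_s3 hs]
      · simp only [swapSeq_apply, sw_s1 hs, sw_s2 hs, sw_s3 hs, hi]
    · rw [dx_ne]
      · ring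
      · simpa only [swapSeq_apply, sw_s1 hs, sw_s2 hs, sw_s3 hs] using hi
  have hW := p.wt s i _ ((hZ.fn (S.G (pR r) (pR s))).fn (S.G (pL r) (pR s)))
  rw [hτ s, hτ r, hτ s, pL_s hs, g1 _ (hZ.fn _), map_add, smul_add, g3 _ _ hW, Sys.op_alg,
    smul_comm (S.G (pR r) (pR s)) (algebraMap k C _), g3 i _ (hZ.fn _), g2 _ ((hZ.fn _).fn _),
    c2, c0]
  simp only [map_add, smul_add, Sys.op_alg]
  rw [p.sq s i _ ((hZ.fn _).fn _)]
  have c3 := congrArg (algebraMap k C) c1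
  simp only [map_mul, map_zero] at c3
  have c4 : algebraMap k C (if i (pL r) = i (pR s) then ((uG P).u1 (i (pL r)) (i (pR r)) *
      h (i (pL r))) else 0) = (if i (pL r) = i (pR s) then
        algebraMap k C ((uG P).u1 (i (pL r)) (i (pR r)) * h (i (pL r))) else 0) := by
    split_ifs <;> simp
  rw [c4]
  simp only [← mul_smul, map_neg, map_mul, mul_comm, mul_left_comm, mul_assoc]
  linear_combination (norm := module) c3 • (ψ s (S.G (pR r) (pR s) • Z))

/-- The product of the rescaling units of a braid. -/
noncomputable def GG (S : Sys P n C) (r s : Fin (n - 1)) : C :=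
  S.G (pR r) (pR s) * S.G (pL r) (pR s) * S.G (pL r) (pR r)

/-- Comparison of the braid relations of the KLR generators and of the intertwiners. -/
lemma braid_cmp (p : Pre S P.q S.QK ψ) (hτ : ∀ r Z, τ r Z = ψ r (S.G (pL r) (pR r) • Z))
    {r s : Fin (n - 1)} (hs : s.1 = r.1 + 1) {i} {Z : V} (hZ : S.wt i Z) :
    τ r (τ s (τ r Z)) - τ s (τ r (τ s Z)) - S.BI i (pL r) (pR r) (pR s) • Z =
    ψ r (ψ s (ψ r (GG S r s • Z))) - ψ s (ψ r (ψ s (GG S r s • Z)))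
      - S.BK i (pL r) (pR r) (pR s) • GG S r s • Z := by
  rw [cmp_left p hτ hs hZ, cmp_right p hτ hs hZ, ← GG]
  have key : S.BI i (pL r) (pR r) (pR s) • Z + ((if i (pL r) = i (pR s) then
        algebraMap k C ((uG P).u2 (i (pR r)) (i (pL r)) * P.q (i (pL r))) else 0) *
        S.QK r i * S.G (pL r) (pR s) * S.G (pL r) (pR r)) • Z + ((if i (pL r) = i (pR s) then
        algebraMap k C ((uG P).u1 (i (pL r)) (i (pR r)) * P.q (i (pL r))) else 0) *
        S.QK s i * S.G (pL r) (pR s) * S.G (pR r) (pR s)) • Z =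
      (S.BK i (pL r) (pR r) (pR s) * GG S r s) • Z := by
    by_cases h1 : i (pL r) = i (pR s)
    · by_cases h2 : i (pL r) = i (pR r)
      · have h3 := P.ne_succ (i (pR r))
        have h4 := h1
        rw [h2] at h4
        simp only [Sys.BI, Sys.BK, h2, ← h4, uG_u1_diag, uG_u2_diag, if_true, if_neg h3]
        simp
      · have hB := S.braid_E h1.symm h2
        have hG := S.G_diag h1
        have hu : algebraMap k C (P.q (i (pL r))) * algebraMap k C (P.q (i (pL r)))⁻¹ = 1 := by
          rw [← map_mul, mul_inv_cancel₀ (P.q_ne _), map_one]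
        rw [← add_smul, ← add_smul]
        apply hZ.congr
        simp only [if_pos h1, Sys.QK, pL_s hs, Sys.BI, if_pos (And.intro h1.symm h2), map_mul, GG]
        linear_combination hB + (
            algebraMap k C ((uG P).u2 (i (pR r)) (i (pL r))) * algebraMap k C (P.q (i (pL r))) *
              S.QK' (i (pL r)) (i (pR r)) (pL r) (pR r) * S.G (pL r) (pR r)
            + algebraMap k C ((uG P).u1 (i (pL r)) (i (pR r))) * algebraMap k C (P.q (i (pL r))) *
              S.QK' (i (pR r)) (i (pR s)) (pR r) (pR s) * S.G (pR r) (pR s)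
            - S.BK i (pL r) (pR r) (pR s) * S.G (pR r) (pR s) * S.G (pL r) (pR r)) * hG +
          (algebraMap k C ((uG P).u2 (i (pR r)) (i (pL r))) *
              S.QK' (i (pL r)) (i (pR r)) (pL r) (pR r) * S.G (pL r) (pR r)
            + algebraMap k C ((uG P).u1 (i (pL r)) (i (pR r))) *
              S.QK' (i (pR r)) (i (pR s)) (pR r) (pR s) * S.G (pR r) (pR s)) * S.E i * hu
    · have h1' : ¬ (i (pR s) = i (pL r)) := fun h => h1 h.symm
      simp [Sys.BI, Sys.BK, h1, h1']
  rw [← mul_smul]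
  linear_combination (norm := module) - key

end cmp
end Paper.BK

open scoped BigOperators
open scoped Classical
set_option linter.all false

namespace Paper.BK

section resc
variable {k : Type*} [Field k] {e : ℕ} [NeZero e] {P : Par k e} {n : ℕ}
  {C : Type*} [CommRing C] [Algebra k C] {S : Sys P n C}
variable {V : Type*} [AddCommGroup V] [Module k V] [Module C V] [IsScalarTower k C V]
variable {h : ZMod e → k} {Q : Fin (n - 1) → (Fin n → ZMod e) → C}
    {τ ψ : Fin (n - 1) → V →ₗ[k] V}

/-- The inverses of the rescaling units. -/
noncomputable def Sys.Gi (S : Sys P n C) (a b : Fin n) : C := S.linv (uG P) (uG_nz P) a b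

lemma Sys.G_Gi (S : Sys P n C) (a b : Fin n) : S.G a b * S.Gi a b = 1 :=
  S.lin_linv _ _ _ _

lemma Sys.Gi_diag (S : Sys P n C) {a b : Fin n} {i : Fin n → ZMod e} (h : i a = i b) :
    S.Gi a b * S.E i = algebraMap k C (P.q (i a)) * S.E i := by
  have h1 := S.G_Gi a b
  have h2 := S.G_diag h
  have hu : algebraMap k C (P.q (i a)) * algebraMap k C (P.q (i a))⁻¹ = 1 := by
    rw [← map_mul, mul_inv_cancel₀ (P.q_ne _), map_one]
  linear_combination - S.Gi a b * S.E i * hu - algebraMap k C (P.q (i a)) * S.Gi a b * h2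
    + algebraMap k C (P.q (i a)) * S.E i * h1

lemma uG_corr (r : Fin (n - 1)) (i : Fin n → ZMod e) :
    (uG P).u1 (i (pR r)) (i (pL r)) * dx h r i (pL r) +
      (uG P).u2 (i (pR r)) (i (pL r)) * dx h r i (pR r) = 0 := by
  by_cases hi : i (pL r) = i (pR r)
  · rw [hi, uG_u1_diag, uG_u2_diag]; ring
  · rw [dx_ne _ _ _ hi, dx_ne _ _ _ hi]; ring

lemma far_ne {r s : Fin (n - 1)} (hrs : r.1 + 1 < s.1 ∨ s.1 + 1 < r.1) :
    (pL r ≠ pL s ∧ pL r ≠ pR s) ∧ (pR r ≠ pL s ∧ pR r ≠ pR s) := by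
  simp only [pL, pR, ne_eq, Fin.ext_iff]; omega

lemma pre_KtoI (p : Pre S P.q S.QK ψ) (hτ : ∀ r Z, τ r Z = ψ r (S.G (pL r) (pR r) • Z)) :
    Pre S (fun _ => 1) S.QI τ := by
  refine p.rescale (fun r => S.G (pL r) (pR r)) (fun r => S.G (pR r) (pL r))
    (fun a => (P.q a)⁻¹) τ (fun r i Z _ => hτ r Z) ?_ ?_ ?_ _ ?_ _ ?_
  · intro r i Z hZ
    exact p.mlin0 r i (uG P) (sw_L r) (sw_R r) (uG_corr r i) hZ
  · intro r i hi
    exact S.G_diag hi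
  · intro r s hrs i Z hZ
    obtain ⟨⟨h1, h2⟩, h3, h4⟩ := far_ne hrs
    exact p.mlin0 s i (uG P) (sw_far s h1 h2) (sw_far s h3 h4)
      (by rw [dx_far _ _ _ h1 h2, dx_far _ _ _ h3 h4]; ring) hZ
  · intro a
    exact (mul_inv_cancel₀ (P.q_ne a)).symm
  · intro r i
    by_cases hi : i (pL r) = i (pR r)
    · simp [Sys.QI, Sys.QK, Sys.QK', hi]
    · rw [Sys.QI, if_neg hi, S.MM_E hi, Sys.QK]

lemma pre_ItoK (p : Pre S (fun _ => 1) S.QI τ)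
    (hψ : ∀ r Z, ψ r Z = τ r (S.Gi (pL r) (pR r) • Z)) : Pre S P.q S.QK ψ := by
  refine p.rescale (fun r => S.Gi (pL r) (pR r)) (fun r => S.Gi (pR r) (pL r))
    (fun a => P.q a) ψ (fun r i Z _ => hψ r Z) ?_ ?_ ?_ _ ?_ _ ?_
  · intro r i Z hZ
    exact p.mlinv0 r i (uG P) (uG_nz P) (sw_L r) (sw_R r) (uG_corr r i) hZ
  · intro r i hi
    exact S.Gi_diag hi
  · intro r s hrs i Z hZ
    obtain ⟨⟨h1, h2⟩, h3, h4⟩ := far_ne hrs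
    exact p.mlinv0 s i (uG P) (uG_nz P) (sw_far s h1 h2) (sw_far s h3 h4)
      (by rw [dx_far _ _ _ h1 h2, dx_far _ _ _ h3 h4]; ring) hZ
  · intro a
    simp
  · intro r i
    by_cases hi : i (pL r) = i (pR r)
    · simp [Sys.QI, Sys.QK, Sys.QK', hi]
    · rw [Sys.QI, if_neg hi, Sys.QK]
      have h1 := S.G_Gi (pL r) (pR r)
      have h2 := S.G_Gi (pR r) (pL r)
      have h3 := S.MM_E hi
      linear_combination - S.Gi (pL r) (pR r) * S.Gi (pR r) (pL r) * h3
        - S.QK' (i (pL r)) (i (pR r)) (pL r) (pR r) * S.E i *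
          (S.G (pR r) (pL r) * S.Gi (pR r) (pL r) * h1 + h2)

/-- The braid relations for KLR generators. -/
def BraidK (S : Sys P n C) (ψ : Fin (n - 1) → V →ₗ[k] V) : Prop :=
  ∀ (r s : Fin (n - 1)), s.1 = r.1 + 1 → ∀ i Z, S.wt i Z →
    ψ r (ψ s (ψ r Z)) - ψ s (ψ r (ψ s Z)) = S.BK i (pL r) (pR r) (pR s) • Z

/-- The braid relations for intertwiners. -/
def BraidI (S : Sys P n C) (τ : Fin (n - 1) → V →ₗ[k] V) : Prop :=
  ∀ (r s : Fin (n - 1)), s.1 = r.1 + 1 → ∀ i Z, S.wt i Z →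
    τ r (τ s (τ r Z)) - τ s (τ r (τ s Z)) = S.BI i (pL r) (pR r) (pR s) • Z

lemma braid_KtoI (p : Pre S P.q S.QK ψ) (hτ : ∀ r Z, τ r Z = ψ r (S.G (pL r) (pR r) • Z))
    (b : BraidK S ψ) : BraidI S τ := by
  intro r s hs i Z hZ
  have h1 := braid_cmp p hτ hs hZ
  rw [b r s hs i _ (hZ.fn _), sub_self] at h1
  exact sub_eq_zero.mp h1

lemma braid_ItoK (p : Pre S P.q S.QK ψ) (hτ : ∀ r Z, τ r Z = ψ r (S.G (pL r) (pR r) • Z))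
    (b : BraidI S τ) : BraidK S ψ := by
  intro r s hs i Z hZ
  have hu : GG S r s * (S.Gi (pR r) (pR s) * S.Gi (pL r) (pR s) * S.Gi (pL r) (pR r)) = 1 := by
    have h1 := S.G_Gi (pR r) (pR s)
    have h2 := S.G_Gi (pL r) (pR s)
    have h3 := S.G_Gi (pL r) (pR r)
    rw [GG]
    linear_combination (S.G (pL r) (pR s) * S.Gi (pL r) (pR s) * S.G (pL r) (pR r) *
      S.Gi (pL r) (pR r)) * h1 + S.G (pL r) (pR r) * S.Gi (pL r) (pR r) * h2 + h3
  have h1 := braid_cmp p hτ hs (hZ.fn (S.Gi (pR r) (pR s) * S.Gi (pL r) (pR s) * S.Gi (pL r) (pR r)))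
  rw [b r s hs i _ (hZ.fn _), sub_self, ← mul_smul, hu, one_smul] at h1
  exact (sub_eq_zero.mp h1.symm)

end resc
end Paper.BK

open scoped BigOperators
open scoped Classical
set_option linter.all false

namespace Paper.BK

section hecke
variable {k : Type*} [Field k] {e : ℕ} [NeZero e] {P : Par k e} {n : ℕ}
  {C : Type*} [CommRing C] [Algebra k C] (S : Sys P n C)
variable {V : Type*} [AddCommGroup V] [Module k V] [Module C V] [IsScalarTower k C V]

/-- The scalar `t` in `C`. -/
def tt (S : Sys P n C) : C := algebraMap k C P.t

/-- `X_a = 1 + (t - 1) x_a`. -/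
def Sys.X (a : Fin n) : C := 1 + (tt S - 1) * S.x a

/-- Operators with all the relations of an affine Hecke algebra except the braid relations. -/
structure HPre (T : Fin (n - 1) → V →ₗ[k] V) : Prop where
  quad : ∀ r Z, T r (T r Z) = (tt S - 1) • T r Z + tt S • Z
  far : ∀ r a, a ≠ pL r → a ≠ pR r → ∀ Z, T r (S.x a • Z) = S.x a • T r Z
  LT : ∀ r Z, S.x (pR r) • T r Z = T r (S.x (pL r) • Z) + Z + ((tt S - 1) * S.x (pR r)) • Z
  comm : ∀ r s : Fin (n - 1), (r.1 + 1 < s.1 ∨ s.1 + 1 < r.1) → ∀ Z, T r (T s Z) = T s (T r Z)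

variable (P) in
/-- `x_b - x_a` off the diagonal. -/
noncomputable def uD : Lin k e :=
  ⟨fun p q => if p = q then 1 else 0, fun p q => if p = q then 0 else -1,
    fun p q => if p = q then 0 else 1⟩

variable (P) in
lemma uD_nz : (uD (k := k) (e := e)).Nz P := by
  intro a b
  simp only [uD]
  split_ifs with h1
  · simp
  · intro h
    apply h1
    apply P.inj
    linear_combination -h

variable (P) in
/-- `M` on the diagonal. -/
noncomputable def uN : Lin k e :=
  ⟨fun _ _ => 1, fun p q => if p = q then -1 else 0, fun p q => if p = q then P.t else 0⟩

variable (P) in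
lemma uN_nz : (uN P).Nz P := by
  intro a b
  simp only [uN]
  split_ifs with h1
  · subst h1
    have := P.q_ne a
    rw [Par.q] at this
    intro h
    apply this
    linear_combination h
  · simp

variable (P) in
/-- `-1` on the diagonal, `X_b` off the diagonal. -/
noncomputable def uX : Lin k e :=
  ⟨fun p q => if p = q then -1 else 1, fun p q => 0, fun p q => if p = q then 0 else P.t - 1⟩

namespace Sys

noncomputable def Df (a b : Fin n) : C := S.lin uD a b
noncomputable def Di (a b : Fin n) : C := S.linv uD (uD_nz P) a b
noncomputable def N (a b : Fin n) : C := S.lin (uN P) a b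
noncomputable def Ni (a b : Fin n) : C := S.linv (uN P) (uN_nz P) a b
noncomputable def kX (a b : Fin n) : C := S.lin (uX P) a b

lemma Df_Di (a b) : S.Df a b * S.Di a b = 1 := S.lin_linv _ _ _ _
lemma N_Ni (a b) : S.N a b * S.Ni a b = 1 := S.lin_linv _ _ _ _

variable {S} {a b : Fin n} {i : Fin n → ZMod e}

lemma Df_eq (h : i a = i b) : S.Df a b * S.E i = 1 * S.E i := by
  rw [Df, lin_E]; simp [uD, h]
lemma Df_ne (h : i a ≠ i b) : S.Df a b * S.E i = (S.x b - S.x a) * S.E i := by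
  rw [Df, lin_E]; simp [uD, h]; ring
lemma N_eq (h : i a = i b) : S.N a b * S.E i = S.M a b * S.E i := by
  rw [N, lin_E, M_eq]; simp [uN, h]; ring
lemma N_ne (h : i a ≠ i b) : S.N a b * S.E i = 1 * S.E i := by
  rw [N, lin_E]; simp [uN, h]
lemma kX_eq (h : i a = i b) : S.kX a b * S.E i = (-1) * S.E i := by
  rw [kX, lin_E]; simp [uX, h]
lemma kX_ne (h : i a ≠ i b) : S.kX a b * S.E i = S.X b * S.E i := by
  rw [kX, lin_E]; simp [uX, h, X, tt]
lemma Di_eq (h : i a = i b) : S.Di a b * S.E i = 1 * S.E i := by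
  linear_combination S.E i * S.Df_Di a b - S.Di a b * S.Df_eq h
lemma Di_ne (h : i a ≠ i b) : S.Di a b * (S.x b - S.x a) * S.E i = 1 * S.E i := by
  linear_combination S.E i * S.Df_Di a b - S.Di a b * S.Df_ne h
lemma Di_neg (h : i a ≠ i b) : S.Di b a * S.E i = - S.Di a b * S.E i := by
  linear_combination - S.Di b a * Di_ne (S := S) h - S.Di a b * Di_ne (S := S) h.symm
lemma Ni_eq (h : i a = i b) : S.Ni a b * S.M a b * S.E i = 1 * S.E i := by
  linear_combination S.E i * S.N_Ni a b - S.Ni a b * S.N_eq h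
lemma Ni_ne (h : i a ≠ i b) : S.Ni a b * S.E i = 1 * S.E i := by
  linear_combination S.E i * S.N_Ni a b - S.Ni a b * S.N_ne h

end Sys

/-- The relation between the Hecke operators and the intertwiners. -/
def Rel (T τ : Fin (n - 1) → V →ₗ[k] V) : Prop :=
  ∀ r Z, T r Z = S.Di (pL r) (pR r) • (τ r (S.N (pL r) (pR r) • Z) + S.kX (pL r) (pR r) • Z)

variable {S} {T τ : Fin (n - 1) → V →ₗ[k] V}

lemma Rel.inv (h : Rel S T τ) (r Z) : τ r Z = S.Df (pL r) (pR r) • T r (S.Ni (pL r) (pR r) • Z)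
    - (S.kX (pL r) (pR r) * S.Ni (pL r) (pR r)) • Z := by
  rw [h r, ← mul_smul, S.Df_Di, one_smul, ← mul_smul, S.N_Ni, one_smul]; module

lemma Rel.of_inv (h : ∀ r Z, τ r Z = S.Df (pL r) (pR r) • T r (S.Ni (pL r) (pR r) • Z)
    - (S.kX (pL r) (pR r) * S.Ni (pL r) (pR r)) • Z) : Rel S T τ := by
  intro r Z
  have h1 : S.Ni (pL r) (pR r) * S.N (pL r) (pR r) = 1 := by rw [mul_comm, S.N_Ni]
  rw [h r, ← mul_smul (S.Ni _ _), h1, one_smul, ← mul_smul, mul_assoc, h1, mul_one, sub_add_cancel,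
    ← mul_smul, mul_comm, S.Df_Di, one_smul]

lemma Rel.eq (h : Rel S T τ) (p : Pre S (fun _ => 1) S.QI τ) {r i} {Z : V} (hZ : S.wt i Z)
    (hi : i (pL r) = i (pR r)) : T r Z = τ r (S.M (pL r) (pR r) • Z) - Z := by
  rw [h r, hZ.congr (S.N_eq hi), hZ.congr (S.kX_eq hi)]
  have h1 := p.wt r i _ (hZ.fn (S.M (pL r) (pR r)))
  rw [swapSeq_eq i r hi] at h1
  rw [(h1.add (hZ.fn _)).congr (Sys.Di_eq hi)]; module

lemma Rel.ne (h : Rel S T τ) {r i} {Z : V} (hZ : S.wt i Z)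
    (hi : i (pL r) ≠ i (pR r)) : T r Z = S.Di (pL r) (pR r) • (τ r Z + S.X (pR r) • Z) := by
  rw [h r, hZ.congr (S.N_ne hi), hZ.congr (S.kX_ne hi), one_smul]

lemma Pre.mv_eqR {h Q} (p : Pre S h Q τ) {r i} {Z : V} (hZ : S.wt i Z)
    (hi : i (pL r) = i (pR r)) : S.x (pR r) • τ r Z = τ r (S.x (pL r) • Z) +
      algebraMap k C (h (i (pL r))) • Z := by
  rw [p.mv r i Z hZ, sw_R, dx_R _ _ _ hi]

lemma Pre.mv_eqL {h Q} (p : Pre S h Q τ) {r i} {Z : V} (hZ : S.wt i Z)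
    (hi : i (pL r) = i (pR r)) : S.x (pL r) • τ r Z = τ r (S.x (pR r) • Z) -
      algebraMap k C (h (i (pL r))) • Z := by
  rw [p.mv r i Z hZ, sw_L, dx_L _ _ _ hi, map_neg]; module

lemma Pre.mv_neR {h Q} (p : Pre S h Q τ) {r i} {Z : V} (hZ : S.wt i Z)
    (hi : i (pL r) ≠ i (pR r)) : S.x (pR r) • τ r Z = τ r (S.x (pL r) • Z) := by
  rw [p.mv r i Z hZ, sw_R, dx_ne _ _ _ hi, map_zero, zero_smul, add_zero]

lemma Pre.mv_neL {h Q} (p : Pre S h Q τ) {r i} {Z : V} (hZ : S.wt i Z)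
    (hi : i (pL r) ≠ i (pR r)) : S.x (pL r) • τ r Z = τ r (S.x (pR r) • Z) := by
  rw [p.mv r i Z hZ, sw_L, dx_ne _ _ _ hi, map_zero, zero_smul, add_zero]

lemma Pre.mv_far {h Q} (p : Pre S h Q τ) {r i} {Z : V} (hZ : S.wt i Z) {a : Fin n}
    (h1 : a ≠ pL r) (h2 : a ≠ pR r) : S.x a • τ r Z = τ r (S.x a • Z) := by
  rw [p.mv r i Z hZ, sw_far _ h1 h2, dx_far _ _ _ h1 h2, map_zero, zero_smul, add_zero]

lemma op_tt (W : V →ₗ[k] V) (Z : V) : W (tt S • Z) = tt S • W Z := Sys.op_alg _ _ _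

lemma Pre.M_eq {Q} (p : Pre S (fun _ => 1) Q τ) {r i} {Z : V} (hZ : S.wt i Z)
    (hi : i (pL r) = i (pR r)) : S.M (pL r) (pR r) • τ r Z =
      τ r (S.M (pR r) (pL r) • Z) + (1 + tt S) • Z := by
  have h1 := p.mv_eqR hZ hi
  have h2 := p.mv_eqL hZ hi
  simp only [map_one] at h1 h2
  rw [S.M_eq, S.M_eq, ← tt]
  simp only [add_smul, sub_smul, mul_smul, one_smul, map_add, map_sub, h1, h2, smul_add, op_tt]
  module

lemma Pre.Di_ne {h Q} (p : Pre S h Q τ) {r i} {Z : V} (hZ : S.wt i Z)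
    (hi : i (pL r) ≠ i (pR r)) :
    τ r (S.Di (pL r) (pR r) • Z) = - S.Di (pL r) (pR r) • τ r Z := by
  have h1 := p.mlinv0 r i uD (uD_nz P) (sw_R r) (sw_L r)
    (by rw [dx_ne _ _ _ hi, dx_ne _ _ _ hi]; ring) hZ
  rw [← Sys.Di, ← Sys.Di] at h1
  rw [← h1]
  apply (p.wt r i Z hZ).congr
  apply Sys.Di_neg
  rw [swapSeq_apply, swapSeq_apply, sw_L, sw_R]
  exact hi.symm

lemma op_ext {W W' : V →ₗ[k] V} (S : Sys P n C) (h : ∀ i Z, S.wt i Z → W Z = W' Z) : W = W' :=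
  LinearMap.ext (Sys.ext_V h)

/-- Multiplication by an element of `C` as a `k`-linear map. -/
def mulC (f : C) : V →ₗ[k] V where
  toFun Z := f • Z
  map_add' := smul_add f
  map_smul' s Z := by
    rw [RingHom.id_apply]
    rw [← algebraMap_smul C s Z, ← algebraMap_smul C s (f • Z)]
    exact smul_comm _ _ _

@[simp] lemma mulC_apply (f : C) (Z : V) : (mulC f : V →ₗ[k] V) Z = f • Z := rfl

/-- From intertwiners to Hecke operators. -/
lemma hpre_of_pre (p : Pre S (fun _ => 1) S.QI τ) (h : Rel S T τ) : HPre S T := by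
  refine ⟨?_, ?_, ?_, ?_⟩
  · intro r Z
    have := Sys.ext_V (S := S) (W := T r ∘ₗ T r)
      (W' := mulC (tt S - 1) ∘ₗ T r + mulC (tt S)) ?_ Z
    · simpa using this
    intro i Z hZ
    simp only [LinearMap.comp_apply, LinearMap.add_apply, mulC_apply]
    by_cases hi : i (pL r) = i (pR r)
    · have h1 := p.wt r i _ (hZ.fn (S.M (pL r) (pR r)))
      rw [swapSeq_eq i r hi] at h1
      have h2 : S.wt i (T r Z) := by rw [h.eq p hZ hi]; exact h1.sub hZ
      rw [h.eq p h2 hi, h.eq p hZ hi, smul_sub, p.M_eq (hZ.fn _) hi]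
      simp only [map_sub, map_add, add_smul, one_smul, op_tt]
      rw [p.sq r i _ ((hZ.fn _).fn _), Sys.QI, if_pos hi]
      module
    · have hw := p.wt r i _ hZ
      have hi' : swapSeq i r (pL r) ≠ swapSeq i r (pR r) := by
        rw [swapSeq_apply, swapSeq_apply, sw_L, sw_R]; exact fun h => hi h.symm
      rw [h.ne hZ hi, smul_add, map_add, h.ne (hw.fn _) hi', h.ne ((hZ.fn _).fn _) hi,
        p.Di_ne hw hi', p.sq r i Z hZ, p.Di_ne (hZ.fn _) hi, Sys.QI, if_neg hi]
      have h3 : τ r (S.X (pR r) • Z) = S.X (pL r) • τ r Z := by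
        simp only [Sys.X, add_smul, map_add, sub_mul, sub_smul, mul_smul, one_smul, map_sub, op_tt,
          p.mv_neL hZ hi]
      rw [h3]
      have e1 : ((tt S - 1) * S.Di (pL r) (pR r)) • τ r Z = (S.Di (pL r) (pR r) *
          S.Di (pL r) (pR r) * (S.X (pR r) - S.X (pL r))) • τ r Z := by
        apply hw.congr
        simp only [Sys.X]
        linear_combination - (tt S - 1) * S.Di (pL r) (pR r) * Sys.Di_ne (S := S) hi'
      have e2 : ((tt S - 1) * S.Di (pL r) (pR r) * S.X (pR r) + tt S) • Z =
          (S.Di (pL r) (pR r) * S.Di (pL r) (pR r) * (S.X (pR r) * S.X (pR r) -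
            S.M (pL r) (pR r) * S.M (pR r) (pL r))) • Z := by
        apply hZ.congr
        simp only [Sys.X, S.M_eq]
        change _ * S.E i = (_ * (_ - (1 - _ + tt S * _) * (1 - _ + tt S * _))) * S.E i
        linear_combination - ((tt S - 1) * S.Di (pL r) (pR r) * (1 + (tt S - 1) * S.x (pR r)) +
          tt S * (1 + S.Di (pL r) (pR r) * (S.x (pR r) - S.x (pL r)))) * Sys.Di_ne (S := S) hi
      linear_combination (norm := module) - e1 - e2
  · intro r a h1 h2 Z
    have := Sys.ext_V (S := S) (W := T r ∘ₗ mulC (S.x a)) (W' := mulC (S.x a) ∘ₗ T r) ?_ Z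
    · simpa using this
    intro i Z hZ
    simp only [LinearMap.comp_apply, mulC_apply]
    rw [h r, h r, smul_comm (S.N _ _), ← p.mv_far (hZ.fn _) h1 h2]
    module
  · intro r Z
    have := Sys.ext_V (S := S) (W := mulC (S.x (pR r)) ∘ₗ T r)
      (W' := T r ∘ₗ mulC (S.x (pL r)) + LinearMap.id + mulC ((tt S - 1) * S.x (pR r))) ?_ Z
    · simpa using this
    intro i Z hZ
    simp only [LinearMap.comp_apply, mulC_apply, LinearMap.add_apply, LinearMap.id_apply]
    by_cases hi : i (pL r) = i (pR r)
    · have h1 := p.mv_eqR (hZ.fn (S.M (pL r) (pR r))) hi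
      rw [h.eq p hZ hi, h.eq p (hZ.fn _) hi, smul_sub, h1, smul_comm, map_one, one_smul, S.M_eq, ← tt]
      module
    · rw [h.ne hZ hi, h.ne (hZ.fn _) hi, ← p.mv_neR hZ hi]
      have e1 : (S.Di (pL r) (pR r) * (S.x (pR r) - S.x (pL r)) * S.X (pR r)) • Z =
        (S.X (pR r)) • Z := hZ.congr (by linear_combination S.X (pR r) * Sys.Di_ne (S := S) hi)
      have e2 : S.X (pR r) • Z = Z + ((tt S - 1) * S.x (pR r)) • Z := by rw [Sys.X]; module
      linear_combination (norm := module) e1 + e2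
  · intro r s hrs Z
    have key : ∀ r s : Fin (n - 1), (r.1 + 1 < s.1 ∨ s.1 + 1 < r.1) → ∀ (i Z), S.wt i Z →
        S.N (pL r) (pR r) • τ s Z = τ s (S.N (pL r) (pR r) • Z) ∧
        S.kX (pL r) (pR r) • τ s Z = τ s (S.kX (pL r) (pR r) • Z) ∧
        S.Di (pL r) (pR r) • τ s Z = τ s (S.Di (pL r) (pR r) • Z) := by
      intro r s hrs i Z hZ
      obtain ⟨⟨h1, h2⟩, h3, h4⟩ := far_ne hrs
      have h5 : ∀ j : Fin n → ZMod e, dx (fun _ => (1 : k)) s j (pL r) = 0 :=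
        fun j => dx_far _ _ _ h1 h2
      have h6 : ∀ j : Fin n → ZMod e, dx (fun _ => (1 : k)) s j (pR r) = 0 :=
        fun j => dx_far _ _ _ h3 h4
      exact ⟨p.mlin0 s i _ (sw_far s h1 h2) (sw_far s h3 h4) (by rw [h5, h6]; ring) hZ,
        p.mlin0 s i _ (sw_far s h1 h2) (sw_far s h3 h4) (by rw [h5, h6]; ring) hZ,
        p.mlinv0 s i _ _ (sw_far s h1 h2) (sw_far s h3 h4) (by rw [h5, h6]; ring) hZ⟩
    have key' : ∀ r s : Fin (n - 1), (r.1 + 1 < s.1 ∨ s.1 + 1 < r.1) → ∀ Z,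
        S.N (pL r) (pR r) • τ s Z = τ s (S.N (pL r) (pR r) • Z) ∧
        S.kX (pL r) (pR r) • τ s Z = τ s (S.kX (pL r) (pR r) • Z) ∧
        S.Di (pL r) (pR r) • τ s Z = τ s (S.Di (pL r) (pR r) • Z) := by
      intro r s hrs Z
      refine ⟨?_, ?_, ?_⟩
      · exact Sys.ext_V (S := S) (W := mulC (S.N (pL r) (pR r)) ∘ₗ τ s)
          (W' := τ s ∘ₗ mulC (S.N (pL r) (pR r))) (fun i Z hZ => (key r s hrs i Z hZ).1) Z
      · exact Sys.ext_V (S := S) (W := mulC (S.kX (pL r) (pR r)) ∘ₗ τ s)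
          (W' := τ s ∘ₗ mulC (S.kX (pL r) (pR r))) (fun i Z hZ => (key r s hrs i Z hZ).2.1) Z
      · exact Sys.ext_V (S := S) (W := mulC (S.Di (pL r) (pR r)) ∘ₗ τ s)
          (W' := τ s ∘ₗ mulC (S.Di (pL r) (pR r))) (fun i Z hZ => (key r s hrs i Z hZ).2.2) Z
    have half : ∀ r s : Fin (n - 1), (r.1 + 1 < s.1 ∨ s.1 + 1 < r.1) → T r (T s Z) =
      (S.Di (pL r) (pR r) * S.Di (pL s) (pR s)) •
        (τ r (τ s ((S.N (pL r) (pR r) * S.N (pL s) (pR s)) • Z)) +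
          τ r ((S.N (pL r) (pR r) * S.kX (pL s) (pR s)) • Z) +
          τ s ((S.N (pL s) (pR s) * S.kX (pL r) (pR r)) • Z) +
          (S.kX (pL r) (pR r) * S.kX (pL s) (pR s)) • Z) := by
      intro r s hrs
      rw [h r, h s, smul_comm (S.N (pL r) (pR r)), smul_add (S.N (pL r) (pR r)),
        (key' r s hrs _).1, ← (key' s r hrs.symm _).2.2,
        smul_comm (S.kX (pL r) (pR r)), smul_add (S.kX (pL r) (pR r)),
        (key' r s hrs _).2.1, map_add]
      simp only [← mul_smul]
      rw [mul_comm (S.kX (pL r) (pR r)) (S.N (pL s) (pR s))]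
      module
    rw [half r s hrs, half s r hrs.symm, p.comm s r hrs.symm, mul_comm (S.Di (pL s) _),
      mul_comm (S.N (pL s) (pR s)) (S.N (pL r) (pR r)), mul_comm (S.kX (pL s) _)]
    module

end hecke
end Paper.BK

open scoped BigOperators
open scoped Classical
set_option linter.all false

namespace Paper.BK

section hecke2
variable {k : Type*} [Field k] {e : ℕ} [NeZero e] {P : Par k e} {n : ℕ}
  {C : Type*} [CommRing C] [Algebra k C] {S : Sys P n C}
variable {V : Type*} [AddCommGroup V] [Module k V] [Module C V] [IsScalarTower k C V]
variable {T τ : Fin (n - 1) → V →ₗ[k] V}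

lemma tt_inv (S : Sys P n C) : algebraMap k C (P.t)⁻¹ * tt S = 1 := by
  rw [tt, ← map_mul, inv_mul_cancel₀ P.t_ne, map_one]

lemma HPre.TL (p : HPre S T) (r Z) : T r (S.x (pL r) • Z) =
    S.x (pR r) • T r Z - S.X (pR r) • Z := by
  have := p.LT r Z
  rw [Sys.X, add_smul, one_smul, this]; abel

lemma HPre.TR (p : HPre S T) (r Z) : T r (S.x (pR r) • Z) =
    S.x (pL r) • T r Z + S.X (pR r) • Z := by
  have h1 : T r (S.x (pL r) • T r Z) = (tt S * S.x (pR r)) • Z - T r Z := by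
    rw [p.TL, p.quad, Sys.X]; module
  have h2 := congrArg (T r) h1
  rw [p.quad, h1, map_sub, p.quad, mul_smul, op_tt] at h2
  have h3 : tt S • T r (S.x (pR r) • Z) = tt S • (S.x (pL r) • T r Z + S.X (pR r) • Z) := by
    rw [Sys.X]; linear_combination (norm := module) -h2
  have h4 := congrArg (fun v => algebraMap k C (P.t)⁻¹ • v) h3
  simpa only [← mul_smul, tt_inv, one_smul] using h4

lemma HPre.Tx (p : HPre S T) (r a Z) : ∃ s : C, S.x a • T r Z = T r (S.x (sw r a) • Z) + s • Z := by
  by_cases h1 : a = pL r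
  · subst h1; refine ⟨-S.X (pR r), ?_⟩; rw [sw_L, p.TR]; module
  by_cases h2 : a = pR r
  · subst h2; refine ⟨S.X (pR r), ?_⟩; rw [sw_R, p.TL]; module
  · refine ⟨0, ?_⟩; rw [sw_far r h1 h2, p.far r a h1 h2]; module

/-- `T_r` maps weight `i` to weights `i` and `s_r i`. -/
lemma HPre.supp (p : HPre S T) (r) {i j} {Z : V} (hZ : S.wt i Z) (h1 : j ≠ i)
    (h2 : j ≠ swapSeq i r) : S.E j • T r Z = 0 := by
  obtain ⟨a, ha⟩ := Function.ne_iff.mp h2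
  rw [swapSeq_apply] at ha
  have := Sys.intertwine_zero (S := S) (i := i) (j := j) ha (mulC (S.E j) ∘ₗ T r) ?_ hZ
  · simpa [← mul_smul, S.idem] using this
  · intro Z hZ
    obtain ⟨s, hs⟩ := p.Tx r a Z
    simp only [LinearMap.comp_apply, mulC_apply]
    rw [smul_comm, hs, smul_add, (hZ.fn s).ne h1, add_zero]

lemma HPre.supp_congr (p : HPre S T) (r) {i} {Z : V} (hZ : S.wt i Z) {f g : C}
    (h1 : f * S.E i = g * S.E i) (h2 : f * S.E (swapSeq i r) = g * S.E (swapSeq i r)) :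
    f • T r Z = g • T r Z := by
  apply Sys.vec_ext (S := S)
  intro j
  rw [← mul_smul, ← mul_smul, mul_comm, mul_comm _ g]
  by_cases hj : j = i
  · rw [hj, h1]
  by_cases hj' : j = swapSeq i r
  · rw [hj', h2]
  rw [mul_smul, mul_smul, p.supp r hZ hj hj', smul_zero, smul_zero]

lemma HPre.wt_eq (p : HPre S T) {r i} {Z : V} (hZ : S.wt i Z) (hi : i (pL r) = i (pR r)) :
    S.wt i (T r Z) := by
  rw [Sys.wt]
  have := p.supp_congr r hZ (f := S.E i) (g := 1) (by rw [S.idem, one_mul])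
    (by rw [swapSeq_eq i r hi, S.idem, one_mul])
  rw [this, one_smul]

lemma HPre.far_lin (p : HPre S T) (r) (u : Lin k e) {a b : Fin n}
    (h1 : a ≠ pL r) (h2 : a ≠ pR r) (h3 : b ≠ pL r) (h4 : b ≠ pR r) (Z : V) :
    S.lin u a b • T r Z = T r (S.lin u a b • Z) := by
  refine Sys.ext_V (S := S) (W := mulC (S.lin u a b) ∘ₗ T r)
          (W' := T r ∘ₗ mulC (S.lin u a b)) (fun i Z hZ => ?_) Z
  simp only [LinearMap.comp_apply, mulC_apply]
  rw [p.supp_congr r hZ (S.lin_E u a b i) ?_, hZ.lin]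
  · simp only [add_smul, mul_smul, map_add, Sys.op_alg, p.far r a h1 h2, p.far r b h3 h4]
  · rw [S.lin_E, swapSeq_apply, swapSeq_apply, sw_far r h1 h2, sw_far r h3 h4]

lemma HPre.far_linv (p : HPre S T) (r) (u : Lin k e) (hu : u.Nz P) {a b : Fin n}
    (h1 : a ≠ pL r) (h2 : a ≠ pR r) (h3 : b ≠ pL r) (h4 : b ≠ pR r) (Z : V) :
    S.linv u hu a b • T r Z = T r (S.linv u hu a b • Z) := by
  have h := p.far_lin r u h1 h2 h3 h4 (S.linv u hu a b • Z)
  rw [← mul_smul (S.lin u a b), S.lin_linv, one_smul] at h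
  rw [← h, ← mul_smul, S.linv_lin, one_smul]

/-- The intertwiner. -/
noncomputable def Phi (S : Sys P n C) (T : Fin (n - 1) → V →ₗ[k] V) (r : Fin (n - 1)) : V →ₗ[k] V :=
  mulC (S.x (pR r) - S.x (pL r)) ∘ₗ T r - mulC (S.X (pR r))

lemma Phi_apply (r) (Z : V) : Phi S T r Z = (S.x (pR r) - S.x (pL r)) • T r Z - S.X (pR r) • Z := rfl

lemma HPre.Phi_x (p : HPre S T) (r a) (Z : V) : S.x a • Phi S T r Z = Phi S T r (S.x (sw r a) • Z) := by
  rw [Phi_apply, Phi_apply]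
  by_cases h1 : a = pL r
  · subst h1; rw [sw_L, p.TR]; module
  by_cases h2 : a = pR r
  · subst h2; rw [sw_R, p.TL]; module
  · rw [sw_far r h1 h2, p.far r a h1 h2]; module

lemma HPre.Phi_wt (p : HPre S T) (r) {i} {Z : V} (hZ : S.wt i Z) :
    S.wt (swapSeq i r) (Phi S T r Z) := by
  rw [Sys.wt]
  conv_rhs => rw [← Sys.vec_sum (S := S) (Phi S T r Z)]
  rw [Finset.sum_eq_single (swapSeq i r)]
  · intro j _ hj
    obtain ⟨a, ha⟩ := Function.ne_iff.mp hj
    rw [swapSeq_apply] at ha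
    exact Sys.intertwine_zero ha _ (fun Z hZ => p.Phi_x r a Z) hZ
  · simp

lemma HPre.Phi_sq (p : HPre S T) (r) (Z : V) :
    Phi S T r (Phi S T r Z) = (S.M (pL r) (pR r) * S.M (pR r) (pL r)) • Z := by
  have hD : ∀ Z, T r ((S.x (pR r) - S.x (pL r)) • Z) = - (S.x (pR r) - S.x (pL r)) • T r Z +
      (2 * S.X (pR r)) • Z := by
    intro Z; rw [sub_smul, map_sub, p.TL, p.TR]; module
  have hX : T r (S.X (pR r) • Z) = S.X (pL r) • T r Z + ((tt S - 1) * S.X (pR r)) • Z := by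
    conv_lhs => rw [Sys.X]
    simp only [add_smul, sub_mul, one_mul, sub_smul, mul_smul, one_smul, map_add, map_sub, op_tt, p.TR]
    rw [Sys.X, Sys.X]; module
  rw [Phi_apply, Phi_apply, map_sub, hD, hX, p.quad, S.M_eq, S.M_eq, ← tt, Sys.X, Sys.X]
  module

lemma tau_ne (p : HPre S T)
  (h : ∀ r Z, τ r Z = S.Df (pL r) (pR r) • T r (S.Ni (pL r) (pR r) • Z)
    - (S.kX (pL r) (pR r) * S.Ni (pL r) (pR r)) • Z) {r i} {Z : V} (hZ : S.wt i Z)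
    (hi : i (pL r) ≠ i (pR r)) : τ r Z = Phi S T r Z := by
  rw [h, Phi_apply, mul_smul, hZ.congr (Sys.Ni_ne hi), one_smul, hZ.congr (Sys.kX_ne hi)]
  congr 1
  apply p.supp_congr r hZ (Sys.Df_ne hi)
  apply Sys.Df_ne
  rw [swapSeq_apply, swapSeq_apply, sw_L, sw_R]; exact hi.symm

lemma tau_eq (p : HPre S T)
  (h : ∀ r Z, τ r Z = S.Df (pL r) (pR r) • T r (S.Ni (pL r) (pR r) • Z)
    - (S.kX (pL r) (pR r) * S.Ni (pL r) (pR r)) • Z) {r i} {Z : V} (hZ : S.wt i Z)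
    (hi : i (pL r) = i (pR r)) : τ r Z = T r (S.Ni (pL r) (pR r) • Z) + S.Ni (pL r) (pR r) • Z := by
  rw [h, mul_smul, (p.wt_eq (hZ.fn _) hi).congr (Sys.Df_eq hi), (hZ.fn _).congr (Sys.kX_eq hi)]
  module

lemma pre_of_hpre (p : HPre S T)
  (h : ∀ r Z, τ r Z = S.Df (pL r) (pR r) • T r (S.Ni (pL r) (pR r) • Z)
    - (S.kX (pL r) (pR r) * S.Ni (pL r) (pR r)) • Z) : Pre S (fun _ => 1) S.QI τ := by
  have hwt : ∀ r i Z, S.wt i Z → S.wt (swapSeq i r) (τ r Z) := by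
    intro r i Z hZ
    by_cases hi : i (pL r) = i (pR r)
    · rw [tau_eq p h hZ hi, swapSeq_eq i r hi]; exact (p.wt_eq (hZ.fn _) hi).add (hZ.fn _)
    · rw [tau_ne p h hZ hi]; exact p.Phi_wt r hZ
  have hmv : ∀ r i Z, S.wt i Z → ∀ a, S.x a • τ r Z = τ r (S.x (sw r a) • Z) +
    algebraMap k C (dx (fun _ => 1) r i a) • Z := by
    intro r i Z hZ a
    by_cases hi : i (pL r) = i (pR r)
    · rw [tau_eq p h hZ hi, tau_eq p h (hZ.fn _) hi, smul_comm (S.Ni _ _)]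
      have hz : S.M (pL r) (pR r) • S.Ni (pL r) (pR r) • Z = Z := by
        rw [← mul_smul, mul_comm, hZ.congr (Sys.Ni_eq hi), one_smul]
      rw [S.M_eq, ← tt] at hz
      by_cases h1 : a = pL r
      · subst h1
        rw [sw_L, p.TR, Sys.X, dx_L _ _ _ hi, map_neg, map_one]
        linear_combination (norm := module) - hz
      by_cases h2 : a = pR r
      · subst h2
        rw [sw_R, p.TL, Sys.X, dx_R _ _ _ hi, map_one]
        linear_combination (norm := module) hz
      rw [sw_far r h1 h2, p.far r a h1 h2, dx_far _ _ _ h1 h2, map_zero]; module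
    · rw [tau_ne p h hZ hi, tau_ne p h (hZ.fn _) hi, p.Phi_x, dx_ne _ _ _ hi, map_zero]; module
  refine ⟨hwt, hmv, ?_, ?_⟩
  · intro r i Z hZ
    by_cases hi : i (pL r) = i (pR r)
    · have hw : ∀ Z, S.wt i Z → S.wt i (τ r Z) := by
        intro Z hZ; have := hwt r i Z hZ; rwa [swapSeq_eq i r hi] at this
      rw [Sys.QI, if_pos hi, zero_smul]
      have h1 : ∀ W, S.wt i W → τ r (S.M (pL r) (pR r) • W) = T r W + W := by
        intro W hW
        rw [tau_eq p h (hW.fn _) hi, ← mul_smul, hW.congr (Sys.Ni_eq hi), one_smul]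
      have h2 : ∀ W, S.wt i W → T r (τ r W) = tt S • τ r W := by
        intro W hW
        rw [tau_eq p h hW hi, map_add, p.quad]; module
      have h3 : ∀ W, S.wt i W → S.M (pL r) (pR r) • τ r W =
          τ r (S.M (pR r) (pL r) • W) + (1 + tt S) • W := by
        intro W hW
        have e1 := hmv r i W hW (pL r)
        have e2 := hmv r i W hW (pR r)
        rw [sw_L, dx_L _ _ _ hi, map_neg, map_one] at e1
        rw [sw_R, dx_R _ _ _ hi, map_one] at e2
        rw [S.M_eq, S.M_eq, ← tt]
        simp only [add_smul, sub_smul, mul_smul, one_smul, map_add, map_sub, e1, e2, smul_add, op_tt]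
        module
      have h4 : ∀ W, S.wt i W → τ r (τ r (S.M (pR r) (pL r) • W)) = 0 := by
        intro W hW
        have e1 := h1 _ (hw _ hW)
        rw [h2 _ hW, h3 _ hW, map_add, add_smul, map_add, op_tt, one_smul] at e1
        linear_combination (norm := module) e1
      have h5 := h4 (S.Ni (pR r) (pL r) • Z) (hZ.fn _)
      rwa [← mul_smul, mul_comm, hZ.congr (Sys.Ni_eq hi.symm), one_smul] at h5
    · have hi' : swapSeq i r (pL r) ≠ swapSeq i r (pR r) := by
        rw [swapSeq_apply, swapSeq_apply, sw_L, sw_R]; exact fun h => hi h.symm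
      rw [tau_ne p h (hwt r i Z hZ) hi', tau_ne p h hZ hi, p.Phi_sq, Sys.QI, if_neg hi]
  · intro r s hrs Z
    have key : ∀ r s : Fin (n - 1), (r.1 + 1 < s.1 ∨ s.1 + 1 < r.1) → ∀ Z,
        S.Ni (pL r) (pR r) • T s Z = T s (S.Ni (pL r) (pR r) • Z) ∧
        S.kX (pL r) (pR r) • T s Z = T s (S.kX (pL r) (pR r) • Z) ∧
        S.Df (pL r) (pR r) • T s Z = T s (S.Df (pL r) (pR r) • Z) := by
      intro r s hrs Z
      obtain ⟨⟨h1, h2⟩, h3, h4⟩ := far_ne hrs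
      exact ⟨p.far_linv s _ _ h1 h2 h3 h4 Z, p.far_lin s _ h1 h2 h3 h4 Z,
        p.far_lin s _ h1 h2 h3 h4 Z⟩
    have half : ∀ r s : Fin (n - 1), (r.1 + 1 < s.1 ∨ s.1 + 1 < r.1) → τ r (τ s Z) =
        (S.Df (pL r) (pR r) * S.Df (pL s) (pR s)) •
          T r (T s ((S.Ni (pL r) (pR r) * S.Ni (pL s) (pR s)) • Z)) -
        S.Df (pL r) (pR r) • T r ((S.kX (pL s) (pR s) *
          (S.Ni (pL r) (pR r) * S.Ni (pL s) (pR s))) • Z) -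
        S.Df (pL s) (pR s) • T s ((S.kX (pL r) (pR r) *
          (S.Ni (pL r) (pR r) * S.Ni (pL s) (pR s))) • Z) +
        (S.kX (pL s) (pR s) * S.kX (pL r) (pR r) *
          (S.Ni (pL r) (pR r) * S.Ni (pL s) (pR s))) • Z := by
      intro r s hrs
      rw [h r, h s, smul_sub, smul_sub, map_sub, smul_comm (S.Ni (pL r) (pR r)), 
        (key r s hrs _).1, ← (key s r hrs.symm _).2.2, mul_smul (S.kX (pL r) (pR r)) (S.Ni _ _),
        smul_comm (S.Ni (pL r) (pR r)) (S.Df _ _), (key r s hrs _).1, smul_comm (S.kX _ _),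
        (key r s hrs _).2.1]
      simp only [← mul_smul]
      rw [mul_left_comm (S.Ni (pL r) (pR r)) (S.kX (pL s) (pR s))]
      module
    rw [half r s hrs, half s r hrs.symm, p.comm s r hrs.symm, mul_comm (S.Df (pL s) _),
      mul_comm (S.Ni (pL s) (pR s)) (S.Ni (pL r) (pR r)), mul_comm (S.kX (pL s) (pR s)) (S.kX (pL r) (pR r))]
    abel

end hecke2
end Paper.BK

open scoped BigOperators
open scoped Classical
set_option linter.all false

namespace Paper.BK

section two
variable {k C V : Type*} [Field k] [CommRing C] [Algebra k C] [AddCommGroup V] [Module k V]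
  [Module C V] [IsScalarTower k C V]

/-- Two Hecke operators with neighbouring indices, without the braid relation. -/
structure Two (T1 T2 : V →ₗ[k] V) (t x1 x2 x3 : C) : Prop where
  t1 : ∀ Z, T1 (t • Z) = t • T1 Z
  t2 : ∀ Z, T2 (t • Z) = t • T2 Z
  a1 : ∀ Z, T1 (x1 • Z) = x2 • T1 Z - (1 + (t - 1) * x2) • Z
  a2 : ∀ Z, T1 (x2 • Z) = x1 • T1 Z + (1 + (t - 1) * x2) • Z
  a3 : ∀ Z, T1 (x3 • Z) = x3 • T1 Z
  b1 : ∀ Z, T2 (x1 • Z) = x1 • T2 Z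
  b2 : ∀ Z, T2 (x2 • Z) = x3 • T2 Z - (1 + (t - 1) * x3) • Z
  b3 : ∀ Z, T2 (x3 • Z) = x2 • T2 Z + (1 + (t - 1) * x3) • Z
  q1 : ∀ Z, T1 (T1 Z) = (t - 1) • T1 Z + t • Z
  q2 : ∀ Z, T2 (T2 Z) = (t - 1) • T2 Z + t • Z

variable {T1 T2 : V →ₗ[k] V} {t x1 x2 x3 : C} (w : Two T1 T2 t x1 x2 x3)

namespace Two

/-- The braid defect. -/
def br (T1 T2 : V →ₗ[k] V) : V →ₗ[k] V := T1 ∘ₗ T2 ∘ₗ T1 - T2 ∘ₗ T1 ∘ₗ T2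

lemma br_apply (Z : V) : br T1 T2 Z = T1 (T2 (T1 Z)) - T2 (T1 (T2 Z)) := rfl

lemma br1 (w : Two T1 T2 t x1 x2 x3) (Z : V) : br T1 T2 (x1 • Z) = x3 • br T1 T2 Z := by
  simp only [br_apply, sub_smul, add_smul, mul_smul, one_smul, smul_sub, smul_add, map_sub, map_add,
    w.t1, w.t2, w.a1, w.a2, w.a3, w.b1, w.b2, w.b3, w.q1, w.q2]
  module

lemma br2 (w : Two T1 T2 t x1 x2 x3) (Z : V) : br T1 T2 (x2 • Z) = x2 • br T1 T2 Z := by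
  simp only [br_apply, sub_smul, add_smul, mul_smul, one_smul, smul_sub, smul_add, map_sub, map_add,
    w.t1, w.t2, w.a1, w.a2, w.a3, w.b1, w.b2, w.b3, w.q1, w.q2]
  module

lemma br3 (w : Two T1 T2 t x1 x2 x3) (Z : V) : br T1 T2 (x3 • Z) = x1 • br T1 T2 Z := by
  simp only [br_apply, sub_smul, add_smul, mul_smul, one_smul, smul_sub, smul_add, map_sub, map_add,
    w.t1, w.t2, w.a1, w.a2, w.a3, w.b1, w.b2, w.b3, w.q1, w.q2]
  module

/-- intertwiner, as a function -/
def ph (T : V →ₗ[k] V) (t a b : C) (Z : V) : V := (b - a) • T Z - (1 + (t - 1) * b) • Z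

/-- `T + 1` -/
def ps (T : V →ₗ[k] V) (Z : V) : V := T Z + Z

lemma id_dist (w : Two T1 T2 t x1 x2 x3) (Z : V) :
    ph T1 t x1 x2 (ph T2 t x2 x3 (ph T1 t x1 x2 Z)) - ph T2 t x2 x3 (ph T1 t x1 x2 (ph T2 t x2 x3 Z))
    = ((x2 - x1) * (x3 - x1) * (x3 - x2)) • br T1 T2 Z := by
  simp only [br_apply, ph, sub_smul, add_smul, mul_smul, one_smul, smul_sub, smul_add, map_sub,
    map_add, w.t1, w.t2, w.a1, w.a2, w.a3, w.b1, w.b2, w.b3, w.q1, w.q2]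
  module

lemma id_iij (w : Two T1 T2 t x1 x2 x3) (Z : V) :
    ph T1 t x1 x2 (ph T2 t x2 x3 (ps T1 Z)) - ps T2 (ph T1 t x1 x2 (ph T2 t x2 x3 Z))
    = ((x2 - x1) * (x3 - x1)) • br T1 T2 Z := by
  simp only [br_apply, ph, ps, sub_smul, add_smul, mul_smul, one_smul, smul_sub, smul_add, map_sub,
    map_add, w.t1, w.t2, w.a1, w.a2, w.a3, w.b1, w.b2, w.b3, w.q1, w.q2]
  module

lemma id_jii (w : Two T1 T2 t x1 x2 x3) (Z : V) :
    ps T1 (ph T2 t x2 x3 (ph T1 t x1 x2 Z)) - ph T2 t x2 x3 (ph T1 t x1 x2 (ps T2 Z))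
    = ((x3 - x2) * (x3 - x1)) • br T1 T2 Z := by
  simp only [br_apply, ph, ps, sub_smul, add_smul, mul_smul, one_smul, smul_sub, smul_add, map_sub,
    map_add, w.t1, w.t2, w.a1, w.a2, w.a3, w.b1, w.b2, w.b3, w.q1, w.q2]
  module

lemma id_iji (w : Two T1 T2 t x1 x2 x3) (Z : V) :
    ph T1 t x1 x2 (ps T2 (ph T1 t x1 x2 Z)) - ph T2 t x2 x3 (ps T1 (ph T2 t x2 x3 Z))
    = ((x3 - x2) * (x2 - x1)) • br T1 T2 Z +
      ((1 - x2 + t * x3) - t * (1 - x1 + t * x2)) • (1 - x1 + t * x3) • Z := by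
  simp only [br_apply, ph, ps, sub_smul, add_smul, mul_smul, one_smul, smul_sub, smul_add, map_sub,
    map_add, w.t1, w.t2, w.a1, w.a2, w.a3, w.b1, w.b2, w.b3, w.q1, w.q2]
  module

lemma id_iii (w : Two T1 T2 t x1 x2 x3) (Z : V) :
    ps T1 (ps T2 (ps T1 Z)) - ps T2 (ps T1 (ps T2 Z))
    = br T1 T2 Z + t • (ps T1 Z - ps T2 Z) := by
  simp only [br_apply, ps, sub_smul, add_smul, mul_smul, one_smul, smul_sub, smul_add, map_sub,
    map_add, w.q1, w.q2]
  module

end Two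
end two
end Paper.BK

open scoped BigOperators
open scoped Classical
set_option linter.all false

namespace Paper.BK

section braid
variable {k : Type*} [Field k] {e : ℕ} [NeZero e] {P : Par k e} {n : ℕ}
  {C : Type*} [CommRing C] [Algebra k C] {S : Sys P n C}
variable {V : Type*} [AddCommGroup V] [Module k V] [Module C V] [IsScalarTower k C V]
variable {T τ : Fin (n - 1) → V →ₗ[k] V}

lemma HPre.two (p : HPre S T) {r s : Fin (n - 1)} (hs : s.1 = r.1 + 1) :
    Two (T r) (T s) (tt S) (S.x (pL r)) (S.x (pR r)) (S.x (pR s)) := by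
  refine ⟨op_tt _, op_tt _, p.TL r, p.TR r, p.far r _ (p3_ne1 hs) (p3_ne2 hs),
    p.far s _ ?_ (p3_ne1 hs).symm, ?_, ?_, p.quad r, p.quad s⟩
  · rw [pL_s hs]; exact pL_ne_pR r
  · rw [← pL_s hs]; exact p.TL s
  · rw [← pL_s hs]; exact p.TR s

/-- The longest element of the symmetric group on three letters. -/
def w3 (i : Fin n → ZMod e) (r s : Fin (n - 1)) : Fin n → ZMod e :=
  swapSeq (swapSeq (swapSeq i r) s) r

lemma HPre.br_wt (p : HPre S T) {r s : Fin (n - 1)} (hs : s.1 = r.1 + 1) {i} {Z : V}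
    (hZ : S.wt i Z) : S.wt (w3 i r s) (Two.br (T r) (T s) Z) := by
  have w := p.two hs
  have key : ∀ a Z, S.x a • Two.br (T r) (T s) Z =
      Two.br (T r) (T s) (S.x (sw r (sw s (sw r a))) • Z) := by
    intro a Z
    by_cases h1 : a = pL r
    · rw [h1, sw_L, sw_s2 hs, sw_r3 hs, w.br3]
    by_cases h2 : a = pR r
    · rw [h2, sw_R, sw_s1 hs, sw_L, w.br2]
    by_cases h3 : a = pR s
    · rw [h3, sw_r3 hs, sw_s3 hs, sw_R, w.br1]
    have h4 : a ≠ pL s := by rw [pL_s hs]; exact h2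
    rw [sw_far r h1 h2, sw_far s h4 h3, sw_far r h1 h2, Two.br_apply, Two.br_apply]
    simp only [p.far r a h1 h2, p.far s a h4 h3, smul_sub]
  rw [Sys.wt]
  conv_rhs => rw [← Sys.vec_sum (S := S) (Two.br (T r) (T s) Z)]
  rw [Finset.sum_eq_single (w3 i r s)]
  · intro j _ hj
    obtain ⟨a, ha⟩ := Function.ne_iff.mp hj
    rw [w3, swapSeq_apply, swapSeq_apply, swapSeq_apply] at ha
    exact Sys.intertwine_zero ha _ (fun Z hZ => key a Z) hZ
  · simp

lemma Pre.mM {Q} (p : Pre S (fun _ => 1) Q τ) (r i) {a b a' b' : Fin n}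
    (ha : sw r a = a') (hb : sw r b = b') {Z : V} (hZ : S.wt i Z) :
    S.M a b • τ r Z = τ r (S.M a' b' • Z) +
      algebraMap k C (- dx (fun _ => 1) r i a + P.t * dx (fun _ => 1) r i b) • Z := by
  have := p.mlin r i (uM P) a b Z hZ
  rw [ha, hb] at this
  rw [Sys.M, this]
  simp [uM, Sys.M]

/-- Comparison of braid defects. -/
lemma br_cmp (hp : HPre S T) (p : Pre S (fun _ => 1) S.QI τ) (h : Rel S T τ)
    {r s : Fin (n - 1)} (hs : s.1 = r.1 + 1) (i : Fin n → ZMod e) :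
    ∃ f f' g g' : C, f' * f * S.E (w3 i r s) = S.E (w3 i r s) ∧ g' * g * S.E i = S.E i ∧
      ∀ Z : V, S.wt i Z → f • Two.br (T r) (T s) Z =
        τ r (τ s (τ r (g • Z))) - τ s (τ r (τ s (g • Z))) - S.BI i (pL r) (pR r) (pR s) • g • Z := by
  have w := hp.two hs
  have neR : ∀ {i} {Z : V}, S.wt i Z → i (pL r) ≠ i (pR r) →
      τ r Z = Two.ph (T r) (tt S) (S.x (pL r)) (S.x (pR r)) Z := by
    intro i Z hZ hi
    rw [tau_ne hp (Rel.inv h) hZ hi]; rfl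
  have neS : ∀ {i} {Z : V}, S.wt i Z → i (pR r) ≠ i (pR s) →
      τ s Z = Two.ph (T s) (tt S) (S.x (pR r)) (S.x (pR s)) Z := by
    intro i Z hZ hi
    rw [← pL_s hs] at hi ⊢
    rw [tau_ne hp (Rel.inv h) hZ hi]; rfl
  have eqR : ∀ {i} {Z : V}, S.wt i Z → i (pL r) = i (pR r) →
      τ r (S.M (pL r) (pR r) • Z) = Two.ps (T r) Z := by
    intro i Z hZ hi
    rw [Two.ps, h.eq p hZ hi, sub_add_cancel]
  have eqS : ∀ {i} {Z : V}, S.wt i Z → i (pR r) = i (pR s) →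
      τ s (S.M (pR r) (pR s) • Z) = Two.ps (T s) Z := by
    intro i Z hZ hi
    rw [← pL_s hs] at hi ⊢
    rw [Two.ps, h.eq p hZ hi, sub_add_cancel]
  have wR := fun {i} {Z : V} (hZ : S.wt i Z) => p.wt r i Z hZ
  have wS := fun {i} {Z : V} (hZ : S.wt i Z) => p.wt s i Z hZ
  -- moves for different residues
  have mR : ∀ {i} {Z : V}, S.wt i Z → i (pL r) ≠ i (pR r) → ∀ a b,
      τ r (S.M a b • Z) = S.M (sw r a) (sw r b) • τ r Z := by
    intro i Z hZ hi a b
    rw [p.mM r i (sw_sw r a) (sw_sw r b) hZ, dx_ne _ _ _ hi, dx_ne _ _ _ hi]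
    simp
  have mS : ∀ {i} {Z : V}, S.wt i Z → i (pR r) ≠ i (pR s) → ∀ a b,
      τ s (S.M a b • Z) = S.M (sw s a) (sw s b) • τ s Z := by
    intro i Z hZ hi a b
    rw [← pL_s hs] at hi
    rw [p.mM s i (sw_sw s a) (sw_sw s b) hZ, dx_ne _ _ _ hi, dx_ne _ _ _ hi]
    simp
  have v1 : w3 i r s (pL r) = i (pR s) := by
    rw [w3, swapSeq_apply, swapSeq_apply, swapSeq_apply, sw_L, sw_s2 hs, sw_r3 hs]
  have v2 : w3 i r s (pR r) = i (pR r) := by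
    rw [w3, swapSeq_apply, swapSeq_apply, swapSeq_apply, sw_R, sw_s1 hs, sw_L]
  have v3 : w3 i r s (pR s) = i (pL r) := by
    rw [w3, swapSeq_apply, swapSeq_apply, swapSeq_apply, sw_r3 hs, sw_s3 hs, sw_R]
  have d12 : i (pR s) ≠ i (pR r) → S.Di (pL r) (pR r) * (S.x (pR r) - S.x (pL r)) *
      S.E (w3 i r s) = 1 * S.E (w3 i r s) := by
    intro h; apply Sys.Di_ne; rw [v1, v2]; exact h
  have d13 : i (pR s) ≠ i (pL r) → S.Di (pL r) (pR s) * (S.x (pR s) - S.x (pL r)) *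
      S.E (w3 i r s) = 1 * S.E (w3 i r s) := by
    intro h; apply Sys.Di_ne; rw [v1, v3]; exact h
  have d23 : i (pR r) ≠ i (pL r) → S.Di (pR r) (pR s) * (S.x (pR s) - S.x (pR r)) *
      S.E (w3 i r s) = 1 * S.E (w3 i r s) := by
    intro h; apply Sys.Di_ne; rw [v2, v3]; exact h
  by_cases h12 : i (pL r) = i (pR r)
  · by_cases h23 : i (pR r) = i (pR s)
    · -- iii
      have h13 := h12.trans h23
      have er := swapSeq_eq i r h12
      have es := swapSeq_eq i s (by rw [pL_s hs]; exact h23)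
      have wR' : ∀ {Z : V}, S.wt i Z → S.wt i (τ r Z) := by
        intro Z hZ; have := wR hZ; rwa [er] at this
      have wS' : ∀ {Z : V}, S.wt i Z → S.wt i (τ s Z) := by
        intro Z hZ; have := wS hZ; rwa [es] at this
      have hs' : i (pL s) = i (pR s) := by rw [pL_s hs]; exact h23
      have R1 : ∀ {Z : V}, S.wt i Z → S.M (pR r) (pR s) • τ r Z =
          τ r (S.M (pL r) (pR s) • Z) - Z := by
        intro Z hZ
        rw [p.mM r i (sw_R r) (sw_r3 hs) hZ, dx_R _ _ _ h12, dx_far _ _ _ (p3_ne1 hs) (p3_ne2 hs)]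
        simp [sub_eq_add_neg]
      have R2 : ∀ {Z : V}, S.wt i Z → S.M (pL r) (pR s) • τ r Z =
          τ r (S.M (pR r) (pR s) • Z) + Z := by
        intro Z hZ
        rw [p.mM r i (sw_L r) (sw_r3 hs) hZ, dx_L _ _ _ h12, dx_far _ _ _ (p3_ne1 hs) (p3_ne2 hs)]
        simp
      have dL : dx (fun _ => (1 : k)) s i (pL r) = 0 :=
        dx_far _ _ _ (by rw [pL_s hs]; exact pL_ne_pR r) (p3_ne1 hs).symm
      have S1 : ∀ {Z : V}, S.wt i Z → S.M (pL r) (pR r) • τ s Z =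
          τ s (S.M (pL r) (pR s) • Z) - tt S • Z := by
        intro Z hZ
        rw [p.mM s i (sw_s1 hs) (sw_s2 hs) hZ, dL, ← pL_s hs, dx_L _ _ _ hs']
        simp [sub_eq_add_neg, tt]
      have S2 : ∀ {Z : V}, S.wt i Z → S.M (pL r) (pR s) • τ s Z =
          τ s (S.M (pL r) (pR r) • Z) + tt S • Z := by
        intro Z hZ
        rw [p.mM s i (sw_s1 hs) (sw_s3 hs) hZ, dL, dx_R _ _ _ hs']
        simp [tt]
      refine ⟨1, 1, S.M (pL r) (pR r) * S.M (pL r) (pR s) * S.M (pR r) (pR s),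
        S.Ni (pL r) (pR r) * S.Ni (pL r) (pR s) * S.Ni (pR r) (pR s), by rw [one_mul, one_mul], ?_, ?_⟩
      · have e1 := Sys.Ni_eq (S := S) h12
        have e2 := Sys.Ni_eq (S := S) h13
        have e3 := Sys.Ni_eq (S := S) h23
        linear_combination S.Ni (pL r) (pR s) * S.M (pL r) (pR s) * S.Ni (pR r) (pR s) *
          S.M (pR r) (pR s) * e1 + S.Ni (pR r) (pR s) * S.M (pR r) (pR s) * e2 + e3
      · intro Z hZ
        have sqr : ∀ {Z : V}, S.wt i Z → τ r (τ r Z) = 0 := by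
          intro Z hZ; rw [p.sq r i Z hZ, Sys.QI, if_pos h12, zero_smul]
        have sqs : ∀ {Z : V}, S.wt i Z → τ s (τ s Z) = 0 := by
          intro Z hZ; rw [p.sq s i Z hZ, Sys.QI, if_pos hs', zero_smul]
        have id := w.id_iii Z
        have hr : S.wt i (Two.ps (T r) Z) := by rw [← eqR hZ h12]; exact wR' (hZ.fn _)
        have hs2 : S.wt i (Two.ps (T s) Z) := by rw [← eqS hZ h23]; exact wS' (hZ.fn _)
        have hsr : S.wt i (Two.ps (T s) (Two.ps (T r) Z)) := by
          rw [← eqS hr h23]; exact wS' (hr.fn _)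
        have hrs : S.wt i (Two.ps (T r) (Two.ps (T s) Z)) := by
          rw [← eqR hs2 h12]; exact wR' (hs2.fn _)
        set g := S.M (pL r) (pR r) * S.M (pL r) (pR s) * S.M (pR r) (pR s) with hg
        have l1 : Two.ps (T r) (Two.ps (T s) (Two.ps (T r) Z)) =
            τ r (τ s (τ r (g • Z))) + tt S • Two.ps (T r) Z := by
          rw [← eqR hsr h12, ← eqS hr h23, ← eqR hZ h12, R1 (hZ.fn _)]
          rw [S1 ((wR' ((hZ.fn _).fn _)).sub (hZ.fn _)), smul_sub (S.M _ _), R2 ((hZ.fn _).fn _),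
            add_sub_cancel_right]
          simp only [map_sub, smul_sub, op_tt]
          rw [sqr ((hZ.fn _).fn _), smul_zero, ← mul_smul, ← mul_smul]
          rw [show S.M (pR r) (pR s) * S.M (pL r) (pR s) * S.M (pL r) (pR r) = g by rw [hg]; ring]
          abel
        have l2 : Two.ps (T s) (Two.ps (T r) (Two.ps (T s) Z)) =
            τ s (τ r (τ s (g • Z))) + tt S • Two.ps (T s) Z := by
          rw [← eqS hrs h23, ← eqR hs2 h12, ← eqS hZ h23, S1 (hZ.fn _)]
          rw [R1 ((wS' ((hZ.fn _).fn _)).sub ((hZ.fn _).fn _)), smul_sub (S.M _ _),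
            S2 ((hZ.fn _).fn _), smul_comm _ (tt S), add_sub_cancel_right]
          simp only [map_sub, smul_sub, op_tt]
          rw [sqs ((hZ.fn _).fn _), ← mul_smul, ← mul_smul]
          rw [← hg]
          abel
        have hB : S.BI i (pL r) (pR r) (pR s) = 0 := by
          rw [Sys.BI, if_neg]; exact fun h => h.2 h12
        rw [l1, l2] at id
        rw [hB]
        linear_combination (norm := module) - id
    · -- iij
      have h13 : i (pR s) ≠ i (pL r) := by rw [h12]; exact Ne.symm h23
      have er := swapSeq_eq i r h12
      refine ⟨(S.x (pR r) - S.x (pL r)) * (S.x (pR s) - S.x (pL r)),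
        S.Di (pL r) (pR r) * S.Di (pL r) (pR s), S.M (pL r) (pR r), S.Ni (pL r) (pR r), ?_, ?_, ?_⟩
      · have e1 := d12 (Ne.symm h23)
        have e2 := d13 h13
        linear_combination S.Di (pL r) (pR s) * (S.x (pR s) - S.x (pL r)) * e1 + e2
      · rw [Sys.Ni_eq h12, one_mul]
      · intro Z hZ
        have hB : S.BI i (pL r) (pR r) (pR s) = 0 := by
          rw [Sys.BI, if_neg]; exact fun h => h13 h.1
        have hr : S.wt i (Two.ps (T r) Z) := by
          rw [← eqR hZ h12]; have := wR (hZ.fn (S.M (pL r) (pR r))); rwa [er] at this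
        have n1 : swapSeq i s (pL r) ≠ swapSeq i s (pR r) := by
          rw [swapSeq_apply, swapSeq_apply, sw_s1 hs, sw_s2 hs]; exact h13.symm
        have n2 : swapSeq (swapSeq i s) r (pR r) = swapSeq (swapSeq i s) r (pR s) := by
          rw [swapSeq_apply, swapSeq_apply, swapSeq_apply, swapSeq_apply, sw_R, sw_r3 hs,
            sw_s1 hs, sw_s3 hs]; exact h12
        rw [eqR hZ h12, neR (wS hr) n1, neS hr h23, hB,
          mS hZ h23, mR (wS hZ) n1, sw_s1 hs, sw_s2 hs, sw_L, sw_r3 hs,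
          eqS (wR (wS hZ)) n2, neR (wS hZ) n1, neS hZ h23, zero_smul, sub_zero, w.id_iij Z]
  · by_cases h23 : i (pR r) = i (pR s)
    · -- jii
      have h13 : i (pR s) ≠ i (pL r) := by rw [← h23]; exact Ne.symm h12
      have es := swapSeq_eq i s (by rw [pL_s hs]; exact h23)
      refine ⟨(S.x (pR s) - S.x (pR r)) * (S.x (pR s) - S.x (pL r)),
        S.Di (pR r) (pR s) * S.Di (pL r) (pR s), S.M (pR r) (pR s), S.Ni (pR r) (pR s), ?_, ?_, ?_⟩
      · have e1 := d23 (Ne.symm h12)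
        have e2 := d13 h13
        linear_combination S.Di (pL r) (pR s) * (S.x (pR s) - S.x (pL r)) * e1 + e2
      · rw [Sys.Ni_eq h23, one_mul]
      · intro Z hZ
        have hB : S.BI i (pL r) (pR r) (pR s) = 0 := by
          rw [Sys.BI, if_neg]; exact fun h => h13 h.1
        have hr : S.wt i (Two.ps (T s) Z) := by
          rw [← eqS hZ h23]; have := wS (hZ.fn (S.M (pR r) (pR s))); rwa [es] at this
        have n1 : swapSeq i r (pR r) ≠ swapSeq i r (pR s) := by
          rw [swapSeq_apply, swapSeq_apply, sw_R, sw_r3 hs]; exact h13.symm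
        have n2 : swapSeq (swapSeq i r) s (pL r) = swapSeq (swapSeq i r) s (pR r) := by
          rw [swapSeq_apply, swapSeq_apply, swapSeq_apply, swapSeq_apply, sw_s1 hs, sw_s2 hs,
            sw_L, sw_r3 hs]; exact h23
        rw [eqS hZ h23, neS (wR hr) n1, neR hr h12, hB,
          mR hZ h12, mS (wR hZ) n1, sw_R, sw_r3 hs, sw_s1 hs, sw_s3 hs,
          eqR (wS (wR hZ)) n2, neS (wR hZ) n1, neR hZ h12, zero_smul, sub_zero, w.id_jii Z]
    · by_cases h13 : i (pR s) = i (pL r)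
      · -- iji
        refine ⟨(S.x (pR s) - S.x (pR r)) * (S.x (pR r) - S.x (pL r)),
          S.Di (pR r) (pR s) * S.Di (pL r) (pR r), S.M (pL r) (pR s), S.Ni (pL r) (pR s), ?_, ?_, ?_⟩
        · have e1 := d23 (Ne.symm h12)
          have e2 := d12 (Ne.symm h23)
          linear_combination S.Di (pL r) (pR r) * (S.x (pR r) - S.x (pL r)) * e1 + e2
        · rw [Sys.Ni_eq h13.symm, one_mul]
        · intro Z hZ
          have hB : S.BI i (pL r) (pR r) (pR s) = S.M (pR r) (pR s) - tt S * S.M (pL r) (pR r) := by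
            rw [Sys.BI, if_pos ⟨h13, h12⟩]; rfl
          have n1 : swapSeq i r (pR r) = swapSeq i r (pR s) := by
            rw [swapSeq_apply, swapSeq_apply, sw_R, sw_r3 hs]; exact h13.symm
          have n2 : swapSeq i s (pL r) = swapSeq i s (pR r) := by
            rw [swapSeq_apply, swapSeq_apply, sw_s1 hs, sw_s2 hs]; exact h13.symm
          have n1' : swapSeq i r (pL r) ≠ swapSeq i r (pR r) := by
            rw [swapSeq_apply, swapSeq_apply, sw_R, sw_L]; exact Ne.symm h12
          have n2' : swapSeq i s (pR r) ≠ swapSeq i s (pR s) := by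
            rw [swapSeq_apply, swapSeq_apply, sw_s2 hs, sw_s3 hs]; exact Ne.symm h23
          have es := swapSeq_eq (swapSeq i r) s (by rw [pL_s hs]; exact n1)
          have er := swapSeq_eq (swapSeq i s) r n2
          have W1 : S.wt (swapSeq i r) (Two.ps (T s) (τ r Z)) := by
            rw [← eqS (wR hZ) n1]; have := wS ((wR hZ).fn (S.M (pR r) (pR s))); rwa [es] at this
          have W2 : S.wt (swapSeq i s) (Two.ps (T r) (τ s Z)) := by
            rw [← eqR (wS hZ) n2]; have := wR ((wS hZ).fn (S.M (pL r) (pR r))); rwa [er] at this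
          rw [mR hZ h12, mS hZ h23, sw_L, sw_r3 hs, sw_s1 hs, sw_s3 hs, eqS (wR hZ) n1,
            eqR (wS hZ) n2, neR W1 n1', neS W2 n2', neR hZ h12, neS hZ h23, w.id_iji Z, hB,
            S.M_eq, S.M_eq, S.M_eq]
          change _ = _ + ((_ : C) - _ * _) • _ - ((1 - _ + tt S * _ : C) - _ * (1 - _ + tt S * _)) •
            (1 - _ + tt S * _ : C) • _
          abel
      · -- distinct
        refine ⟨(S.x (pR r) - S.x (pL r)) * (S.x (pR s) - S.x (pL r)) * (S.x (pR s) - S.x (pR r)),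
          S.Di (pL r) (pR r) * S.Di (pL r) (pR s) * S.Di (pR r) (pR s), 1, 1, ?_,
            by rw [one_mul, one_mul], ?_⟩
        · have e1 := d23 (Ne.symm h12)
          have e2 := d12 (Ne.symm h23)
          have e3 := d13 h13
          linear_combination S.Di (pL r) (pR r) * (S.x (pR r) - S.x (pL r)) *
            S.Di (pL r) (pR s) * (S.x (pR s) - S.x (pL r)) * e1 +
            S.Di (pL r) (pR s) * (S.x (pR s) - S.x (pL r)) * e2 + e3
        · intro Z hZ
          have hB : S.BI i (pL r) (pR r) (pR s) = 0 := by
            rw [Sys.BI, if_neg]; exact fun h => h13 h.1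
          have n1 : swapSeq i r (pR r) ≠ swapSeq i r (pR s) := by
            rw [swapSeq_apply, swapSeq_apply, sw_R, sw_r3 hs]; exact fun h => h13 h.symm
          have n2 : swapSeq i s (pL r) ≠ swapSeq i s (pR r) := by
            rw [swapSeq_apply, swapSeq_apply, sw_s1 hs, sw_s2 hs]; exact fun h => h13 h.symm
          have n3 : swapSeq (swapSeq i r) s (pL r) ≠ swapSeq (swapSeq i r) s (pR r) := by
            rw [swapSeq_apply, swapSeq_apply, swapSeq_apply, swapSeq_apply, sw_s1 hs, sw_s2 hs,
              sw_L, sw_r3 hs]; exact h23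
          have n4 : swapSeq (swapSeq i s) r (pR r) ≠ swapSeq (swapSeq i s) r (pR s) := by
            rw [swapSeq_apply, swapSeq_apply, swapSeq_apply, swapSeq_apply, sw_R, sw_r3 hs,
              sw_s1 hs, sw_s3 hs]; exact h12
          rw [hB, one_smul, zero_smul, sub_zero, neR (wS (wR hZ)) n3, neS (wR hZ) n1, neR hZ h12,
            neS (wR (wS hZ)) n4, neR (wS hZ) n2, neS hZ h23, w.id_dist Z]

/-- The braid relations for the Hecke generators. -/
def BraidH (T : Fin (n - 1) → V →ₗ[k] V) : Prop :=
  ∀ (r s : Fin (n - 1)), s.1 = r.1 + 1 → ∀ Z, T r (T s (T r Z)) = T s (T r (T s Z))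

lemma braid_HtoI (hp : HPre S T) (p : Pre S (fun _ => 1) S.QI τ) (h : Rel S T τ)
    (b : BraidH T) : BraidI S τ := by
  intro r s hs i Z hZ
  obtain ⟨f, f', g, g', -, hg, hc⟩ := br_cmp hp p h hs i
  have := hc (g' • Z) (hZ.fn _)
  rw [Two.br_apply, b r s hs, sub_self, smul_zero, ← mul_smul, mul_comm,
    hZ.congr (g := 1) (by rw [hg, one_mul]), one_smul] at this
  exact (sub_eq_zero.mp this.symm)

lemma braid_ItoH (hp : HPre S T) (p : Pre S (fun _ => 1) S.QI τ) (h : Rel S T τ)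
    (b : BraidI S τ) : BraidH T := by
  intro r s hs Z
  refine Sys.ext_V (S := S) (W := T r ∘ₗ T s ∘ₗ T r) (W' := T s ∘ₗ T r ∘ₗ T s) (fun i Z hZ => ?_) Z
  simp only [LinearMap.comp_apply]
  obtain ⟨f, f', g, g', hf, -, hc⟩ := br_cmp hp p h hs i
  have := hc Z hZ
  rw [b r s hs i _ (hZ.fn _), sub_self] at this
  have h2 := congrArg (fun v => f' • v) this
  simp only [← mul_smul, smul_zero] at h2
  rw [(hp.br_wt hs hZ).congr (g := 1) (by rw [hf, one_mul]), one_smul, Two.br_apply] at h2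
  exact sub_eq_zero.mp h2

end braid
end Paper.BK

open scoped BigOperators
open scoped Classical
set_option linter.all false

namespace Paper.BK

section link
variable {k : Type*} [Field k] {e : ℕ} [NeZero e] {P : Par k e} {n : ℕ}
variable {A : Type*} [Ring A] [Algebra k A] {B : Type*} [Ring B] [Algebra k B]
variable {C : Type*} [CommRing C] [Algebra k C] {C' : Type*} [CommRing C'] [Algebra k C']

/-- The relation between Hecke generators and KLR generators inside an algebra. -/
structure Link (ι : C →ₐ[k] A) (S : Sys P n C) (L : Fin n → A) (T : Fin (n - 1) → A)
    (E : (Fin n → ZMod e) → A) (y : Fin n → A) (ψ : Fin (n - 1) → A) : Prop where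
  hL : ∀ a, L a = ι (S.x a)
  hE : ∀ i, E i = ι (S.E i)
  hy : ∀ a, y a = ι (S.y a)
  hT : ∀ r, T r = ι (S.Di (pL r) (pR r)) * (ψ r * ι (S.G (pL r) (pR r)) * ι (S.N (pL r) (pR r)) +
    ι (S.kX (pL r) (pR r)))

lemma Link.map {ι : C →ₐ[k] A} {S : Sys P n C} {L T E y ψ} (h : Link ι S L T E y ψ) (f : A →ₐ[k] B) :
    Link (f.comp ι) S (fun a => f (L a)) (fun r => f (T r)) (fun i => f (E i)) (fun a => f (y a))
      (fun r => f (ψ r)) := by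
  refine ⟨fun a => ?_, fun a => ?_, fun a => ?_, fun a => ?_⟩
  · simp [h.hL]
  · simp [h.hE]
  · simp [h.hy]
  · simp [h.hT]

lemma Link.lin {ι : C →ₐ[k] A} {S : Sys P n C} {L T E y ψ} (h : Link ι S L T E y ψ) (u a b) :
    ι (S.lin u a b) = ∑ i, (algebraMap k A (u.u0 (i a) (i b)) +
      algebraMap k A (u.u1 (i a) (i b)) * L a + algebraMap k A (u.u2 (i a) (i b)) * L b) * E i := by
  simp [Sys.lin, h.hL, h.hE]

lemma isNil_pow {A : Type*} [Ring A] {x E : A} (hc : x * E = E * x) (hE : E * E = E)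
    (h : IsNilpotent (x * E)) : ∃ N, x ^ N * E = 0 := by
  obtain ⟨N, hN⟩ := h
  refine ⟨N, ?_⟩
  have h1 : (x * E) ^ N = x ^ N * E ^ N := Commute.mul_pow hc N
  have h2 : ∀ N, E ^ N * E = E := by
    intro N
    induction N with
    | zero => simp
    | succ N ih => rw [pow_succ, mul_assoc, hE, ih]
  calc x ^ N * E = x ^ N * E ^ N * E := by rw [mul_assoc, h2]
    _ = 0 := by rw [← h1, hN, zero_mul]

lemma coprime_zero {x E E' : A} {c c' : k} (hcc : c ≠ c') (hc : x * E' = E' * x) {N N' : ℕ}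
    (h : (x - algebraMap k A c) ^ N * E = 0) (h' : (x - algebraMap k A c') ^ N' * E' = 0) :
    E' * E = 0 := by
  have hco : IsCoprime ((Polynomial.X - Polynomial.C c : Polynomial k) ^ N)
      ((Polynomial.X - Polynomial.C c' : Polynomial k) ^ N') := by
    apply IsCoprime.pow
    apply Polynomial.isCoprime_X_sub_C_of_isUnit_sub
    exact (sub_ne_zero.mpr hcc).isUnit
  obtain ⟨u, v, huv⟩ := hco
  have := congrArg (Polynomial.aeval x) huv
  simp only [map_add, map_mul, map_pow, map_sub, Polynomial.aeval_X, Polynomial.aeval_C, map_one] at this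
  have hE' : ∀ q : Polynomial k, Polynomial.aeval x q * E' = E' * Polynomial.aeval x q := by
    intro q
    have : Commute E' (Polynomial.aeval x q) := by
      induction q using Polynomial.induction_on' with
      | add p q hp hq => rw [map_add]; exact hp.add_right hq
      | monomial m a =>
        rw [Polynomial.aeval_monomial]
        exact (show Commute E' _ from (Algebra.commutes a E').symm).mul_right ((show Commute E' x from hc.symm).pow_right m)
    exact this.symm
  have h3 : (x - algebraMap k A c') ^ N' * E' = E' * (x - algebraMap k A c') ^ N' := by
    have := hE' ((Polynomial.X - Polynomial.C c' : Polynomial k) ^ N')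
    simpa only [map_pow, map_sub, Polynomial.aeval_X, Polynomial.aeval_C] using this
  calc E' * E = E' * (Polynomial.aeval x u * (x - algebraMap k A c) ^ N +
        Polynomial.aeval x v * (x - algebraMap k A c') ^ N') * E := by rw [this, mul_one]
    _ = E' * Polynomial.aeval x u * ((x - algebraMap k A c) ^ N * E) +
        Polynomial.aeval x v * ((x - algebraMap k A c') ^ N' * E') * E := by
        rw [mul_add, add_mul, ← mul_assoc, ← mul_assoc, ← hE' v, mul_assoc _ E', ← h3]
        simp only [mul_assoc]
    _ = 0 := by rw [h, h']; simp

lemma Link.nil {ι : C →ₐ[k] A} {S : Sys P n C} {L T E y ψ} (h : Link ι S L T E y ψ) (i a) :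
    ∃ N, (L a - algebraMap k A (P.c (i a))) ^ N * E i = 0 := by
  obtain ⟨N, hN⟩ := isNil_pow (mul_comm _ _) (S.idem i) (S.nil a i)
  refine ⟨N, ?_⟩
  have := congrArg ι hN
  simpa [h.hL, h.hE] using this

lemma Link.xE {ι : C →ₐ[k] A} {S : Sys P n C} {L T E y ψ} (h : Link ι S L T E y ψ) (i a) :
    L a * E i = E i * L a := by
  rw [h.hL, h.hE, ← map_mul, mul_comm, map_mul]

lemma Link.sumE {ι : C →ₐ[k] A} {S : Sys P n C} {L T E y ψ} (h : Link ι S L T E y ψ) :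
    ∑ i, E i = 1 := by
  have := congrArg ι S.complete
  simpa [h.hE] using this

section two
variable {ι : C →ₐ[k] A} {S : Sys P n C} {ι' : C' →ₐ[k] A} {S' : Sys P n C'}
variable {L L' : Fin n → A} {T T' : Fin (n - 1) → A}
    {E E' : (Fin n → ZMod e) → A} {y y' : Fin n → A} {ψ ψ' : Fin (n - 1) → A}

lemma Link.E_unique (h : Link ι S L T E y ψ) (h' : Link ι' S' L T' E' y' ψ') : E = E' := by
  have key : ∀ i j, i ≠ j → E' j * E i = 0 := by
    intro i j hij
    obtain ⟨a, ha⟩ := Function.ne_iff.mp hij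
    obtain ⟨N, hN⟩ := h.nil i a
    obtain ⟨N', hN'⟩ := h'.nil j a
    exact coprime_zero (fun hc => ha (P.inj hc)) (h'.xE j a) hN hN'
  funext i
  have h1 : E' i * E i = E i := by
    conv_rhs => rw [← one_mul (E i), ← h'.sumE, Finset.sum_mul]
    rw [Finset.sum_eq_single i]
    · intro j _ hj; exact key i j hj.symm
    · simp
  have h2 : E' i * E i = E' i := by
    conv_rhs => rw [← mul_one (E' i), ← h.sumE, Finset.mul_sum]
    rw [Finset.sum_eq_single i]
    · intro j _ hj; exact key j i hj
    · simp
  rw [← h1, h2]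

lemma Link.lin_unique (h : Link ι S L T E y ψ) (h' : Link ι' S' L T' E y' ψ') (u a b) :
    ι (S.lin u a b) = ι' (S'.lin u a b) := by
  rw [h.lin, h'.lin]

lemma Link.linv_unique (h : Link ι S L T E y ψ) (h' : Link ι' S' L T' E y' ψ') (u hu a b) :
    ι (S.linv u hu a b) = ι' (S'.linv u hu a b) := by
  have h1 : ι (S.linv u hu a b) * ι (S.lin u a b) = 1 := by
    rw [← map_mul, S.linv_lin, map_one]
  have h2 : ι' (S'.lin u a b) * ι' (S'.linv u hu a b) = 1 := by
    rw [← map_mul, S'.lin_linv, map_one]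
  rw [h.lin_unique h'] at h1
  exact left_inv_eq_right_inv h1 h2

lemma Link.HK_unique (h : Link ι S L T E y ψ) (h' : Link ι' S' L T E' y' ψ') :
    E = E' ∧ y = y' ∧ ψ = ψ' := by
  obtain rfl := h.E_unique h'
  refine ⟨rfl, ?_, ?_⟩
  · funext a
    rw [h.hy, h'.hy, Sys.y, Sys.y]
    simp only [map_sum, map_mul, map_sub, AlgHom.commutes, ← h.hL, ← h'.hL, ← h.hE, ← h'.hE]
  · funext r
    have e1 := h.hT r
    rw [h'.hT r] at e1
    have d1 : ι (S.Di (pL r) (pR r)) = ι' (S'.Di (pL r) (pR r)) := h.linv_unique h' _ _ _ _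
    have d2 : ι (S.G (pL r) (pR r)) = ι' (S'.G (pL r) (pR r)) := h.lin_unique h' _ _ _
    have d3 : ι (S.N (pL r) (pR r)) = ι' (S'.N (pL r) (pR r)) := h.lin_unique h' _ _ _
    have d4 : ι (S.kX (pL r) (pR r)) = ι' (S'.kX (pL r) (pR r)) := h.lin_unique h' _ _ _
    rw [d1, d2, d3, d4] at e1
    have f1 : ι' (S'.Df (pL r) (pR r)) * ι' (S'.Di (pL r) (pR r)) = 1 := by
      rw [← map_mul, S'.Df_Di, map_one]
    have f2 : ι' (S'.N (pL r) (pR r)) * ι' (S'.Ni (pL r) (pR r)) = 1 := by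
      rw [← map_mul, S'.N_Ni, map_one]
    have f3 : ι' (S'.G (pL r) (pR r)) * ι' (S'.Gi (pL r) (pR r)) = 1 := by
      rw [← map_mul, S'.G_Gi, map_one]
    have e2 := congrArg (fun v => ι' (S'.Df (pL r) (pR r)) * v) e1
    simp only [← mul_assoc, f1, one_mul, add_left_inj] at e2
    have e3 := congrArg (fun v => v * ι' (S'.Ni (pL r) (pR r)) * ι' (S'.Gi (pL r) (pR r))) e2
    simp only [mul_assoc, f2, f3, mul_one] at e3
    exact e3.symm

lemma Link.KH_unique (h : Link ι S L T E y ψ) (h' : Link ι' S' L' T' E y ψ) :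
    L = L' ∧ T = T' := by
  have hL : L = L' := by
    funext a
    have aux : ∀ {C : Type _} [CommRing C] [Algebra k C] (ι : C →ₐ[k] A) (S : Sys P n C) L T,
        Link ι S L T E y ψ → L a = ∑ i, (algebraMap k A (P.q (i a)) * y a +
          algebraMap k A (P.c (i a))) * E i := by
      intro C _ _ ι S L T h
      have : S.x a = ∑ i, S.x a * S.E i := by rw [← Finset.mul_sum, S.complete, mul_one]
      rw [h.hL, this]
      simp only [S.x_E, map_sum, map_mul, map_add, AlgHom.commutes, ← h.hy, ← h.hE]
    have : S'.x a = ∑ i, S'.x a * S'.E i := by rw [← Finset.mul_sum, S'.complete, mul_one]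
    rw [aux ι S L T h, h'.hL, this]
    simp only [S'.x_E, map_sum, map_mul, map_add, AlgHom.commutes, ← h'.hy, ← h'.hE]
  subst hL
  refine ⟨rfl, ?_⟩
  funext r
  have d1 : ι (S.Di (pL r) (pR r)) = ι' (S'.Di (pL r) (pR r)) := h.linv_unique h' _ _ _ _
  have d2 : ι (S.G (pL r) (pR r)) = ι' (S'.G (pL r) (pR r)) := h.lin_unique h' _ _ _
  have d3 : ι (S.N (pL r) (pR r)) = ι' (S'.N (pL r) (pR r)) := h.lin_unique h' _ _ _
  have d4 : ι (S.kX (pL r) (pR r)) = ι' (S'.kX (pL r) (pR r)) := h.lin_unique h' _ _ _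
  rw [h.hT, h'.hT, d1, d2, d3, d4]

end two
end link

/-! ## Constructing spectral idempotents -/

section spectral
variable {k : Type*} [Field k] {e : ℕ} [NeZero e] {P : Par k e} {n : ℕ}
variable {C : Type*} [CommRing C] [Algebra k C]

lemma exists_spec (P : Par k e) (x : C) (h : IsNilpotent (∏ a, (x - algebraMap k C (P.c a)))) :
    ∃ E : ZMod e → C, (∀ a b, a ≠ b → E a * E b = 0) ∧ (∀ a, E a * E a = E a) ∧ ∑ a, E a = 1 ∧
      ∀ a, IsNilpotent ((x - algebraMap k C (P.c a)) * E a) := by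
  obtain ⟨N, hN⟩ := h
  rw [← Finset.prod_pow] at hN
  have hco : Pairwise (Function.onFun IsCoprime fun a : (Finset.univ : Finset (ZMod e)) =>
      (x - algebraMap k C (P.c a)) ^ N) := by
    intro a b hab
    apply IsCoprime.pow
    have hne : P.c b - P.c a ≠ 0 := sub_ne_zero.mpr (fun h => hab (Subtype.ext (P.inj h).symm))
    refine ⟨algebraMap k C (P.c b - P.c a)⁻¹, - algebraMap k C (P.c b - P.c a)⁻¹, ?_⟩
    have : algebraMap k C (P.c b - P.c a)⁻¹ * algebraMap k C (P.c b - P.c a) = 1 := by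
      rw [← map_mul, inv_mul_cancel₀ hne, map_one]
    rw [map_sub] at this
    linear_combination this
  obtain ⟨μ, hμ⟩ := (exists_sum_eq_one_iff_pairwise_coprime (t := (Finset.univ : Finset (ZMod e)))
    (s := fun a => (x - algebraMap k C (P.c a)) ^ N) Finset.univ_nonempty).mpr hco
  have hz : ∀ a, (x - algebraMap k C (P.c a)) ^ N *
      ∏ b ∈ Finset.univ \ {a}, (x - algebraMap k C (P.c b)) ^ N = 0 := by
    intro a
    rw [← hN, ← Finset.prod_sdiff (Finset.subset_univ {a}), Finset.prod_singleton, mul_comm]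
  have orth : ∀ a b, a ≠ b →
      (μ a * ∏ b ∈ Finset.univ \ {a}, (x - algebraMap k C (P.c b)) ^ N) *
      (μ b * ∏ b ∈ Finset.univ \ {b}, (x - algebraMap k C (P.c b)) ^ N) = 0 := by
    intro a b hab
    have h1 : b ∈ (Finset.univ \ {a} : Finset (ZMod e)) := by simp [hab.symm]
    rw [← Finset.mul_prod_erase _ _ h1]
    linear_combination μ a * μ b * (∏ b ∈ (Finset.univ \ {a}).erase b,
      (x - algebraMap k C (P.c b)) ^ N) * hz b
  refine ⟨fun a => μ a * ∏ b ∈ Finset.univ \ {a}, (x - algebraMap k C (P.c b)) ^ N, orth, ?_, hμ, ?_⟩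
  · intro a
    beta_reduce
    conv_rhs => rw [← mul_one (μ a * _), ← hμ, Finset.mul_sum]
    rw [Finset.sum_eq_single a]
    · intro b _ hb; exact orth a b hb.symm
    · simp
  · intro a
    refine ⟨N + 1, ?_⟩
    rw [mul_pow, mul_pow, pow_succ, pow_succ (∏ _ ∈ _, _)]
    linear_combination (x - algebraMap k C (P.c a)) * μ a ^ (N + 1) *
      (∏ b ∈ Finset.univ \ {a}, (x - algebraMap k C (P.c b)) ^ N) ^ N * hz a

lemma exists_sys (P : Par k e) (x : Fin n → C)
    (h : ∀ m, IsNilpotent (∏ a, (x m - algebraMap k C (P.c a)))) :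
    ∃ S : Sys P n C, S.x = x := by
  choose E orth idem complete nil using fun m => exists_spec P (x m) (h m)
  refine ⟨⟨x, fun i => ∏ m, E m (i m), ?_, ?_, ?_, ?_⟩, rfl⟩
  · intro i j hij
    obtain ⟨m, hm⟩ := Function.ne_iff.mp hij
    rw [← Finset.prod_mul_distrib]
    exact Finset.prod_eq_zero (Finset.mem_univ m) (orth m _ _ hm)
  · intro i
    rw [← Finset.prod_mul_distrib]
    exact Finset.prod_congr rfl fun m _ => idem m _
  · have := Finset.prod_univ_sum (fun _ : Fin n => (Finset.univ : Finset (ZMod e))) (fun m a => E m a)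
    simp only [complete, Finset.prod_const_one, Fintype.piFinset_univ] at this
    exact this.symm
  · intro a i
    rw [← Finset.mul_prod_erase _ _ (Finset.mem_univ a), ← mul_assoc]
    exact (Commute.all _ _).isNilpotent_mul_right (nil a (i a))

lemma exists_comm {A : Type} [Ring A] [Algebra k A] (s : Set A)
    (hs : ∀ a ∈ s, ∀ b ∈ s, a * b = b * a) :
    ∃ (C : Type) (_ : CommRing C) (_ : Algebra k C) (ι : C →ₐ[k] A), Function.Injective ι ∧
      ∀ a ∈ s, ∃ c, ι c = a := by
  refine ⟨Algebra.adjoin k s, Algebra.adjoinCommRingOfComm k (fun a ha b hb => hs a ha b hb),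
    ?_⟩
  refine ⟨?_, ?_⟩
  · exact (inferInstance : Algebra k (Algebra.adjoin k s))
  exact ⟨(Algebra.adjoin k s).val, Subtype.val_injective,
    fun a ha => ⟨⟨a, Algebra.subset_adjoin ha⟩, rfl⟩⟩

end spectral
end Paper.BK

open scoped BigOperators
open scoped Classical
set_option linter.all false

namespace Paper.BK

section hnil
variable {k : Type*} [Field k] {e : ℕ} [NeZero e] (P : Par k e)
variable {C : Type*} [CommRing C] [Algebra k C]
variable {V : Type*} [AddCommGroup V] [Module k V] [Module C V] [IsScalarTower k C V]

lemma op_alg' (W : V →ₗ[k] V) (s : k) (Z : V) :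
    W (algebraMap k C s • Z) = algebraMap k C s • W Z := by
  rw [algebraMap_smul, algebraMap_smul, map_smul]

lemma hnil_prime (x z : C) (N : ℕ)
    (hx : IsNilpotent (∏ a, (x - algebraMap k C (P.c a))))
    (hz : (∏ a, (z - algebraMap k C (P.c a))) ^ N * ((1 - x + algebraMap k C P.t * z) *
      (1 - z + algebraMap k C P.t * x)) = 0) :
    IsNilpotent (∏ a, (z - algebraMap k C (P.c a))) := by
  rw [nilpotent_iff_mem_prime] at hx ⊢
  intro J hJ
  have h1 := hx J hJ
  rw [hJ.prod_mem_iff] at h1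
  obtain ⟨a, -, ha⟩ := h1
  have hmem : ∀ b, z - algebraMap k C (P.c b) ∈ J → ∏ a, (z - algebraMap k C (P.c a)) ∈ J :=
    fun b hb => hJ.prod_mem_iff.mpr ⟨b, Finset.mem_univ _, hb⟩
  have h2 : (∏ a, (z - algebraMap k C (P.c a))) ^ N * ((1 - x + algebraMap k C P.t * z) *
      (1 - z + algebraMap k C P.t * x)) ∈ J := by rw [hz]; exact J.zero_mem
  rcases hJ.mem_or_mem h2 with h | h
  · exact hJ.mem_of_pow_mem _ h
  rcases hJ.mem_or_mem h with h | h
  · apply hmem (a - 1)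
    have hc := congrArg (algebraMap k C) (P.c_succ (a - 1))
    rw [sub_add_cancel, map_add, map_mul, map_one] at hc
    have hu' : algebraMap k C (P.t)⁻¹ * algebraMap k C P.t = 1 := by
      rw [← map_mul, inv_mul_cancel₀ P.t_ne, map_one]
    have h3 := J.mul_mem_left (algebraMap k C (P.t)⁻¹) (J.add_mem h ha)
    convert h3 using 1
    linear_combination - (z - algebraMap k C (P.c (a - 1))) * hu' + algebraMap k C (P.t)⁻¹ * hc
  · apply hmem (a + 1)
    have hc := congrArg (algebraMap k C) (P.c_succ a)
    rw [map_add, map_mul, map_one] at hc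
    have h3 := J.sub_mem (J.mul_mem_left (algebraMap k C P.t) ha) h
    convert h3 using 1
    linear_combination - hc

/-- One step of the induction proving that the `L_m` have the right eigenvalues. -/
lemma hnil_step (T : V →ₗ[k] V) (x z u : C) (hu : u = algebraMap k C P.t)
    (quad : ∀ Z, T (T Z) = (u - 1) • T Z + u • Z)
    (LT : ∀ Z, z • T Z = T (x • Z) + Z + ((u - 1) * z) • Z)
    (faith : ∀ c : C, (∀ Z : V, c • Z = 0) → c = 0)
    (hx : IsNilpotent (∏ a, (x - algebraMap k C (P.c a)))) :
    IsNilpotent (∏ a, (z - algebraMap k C (P.c a))) := by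
  have hopu : ∀ Z : V, T (u • Z) = u • T Z := by
    intro Z; rw [hu]; exact op_alg' _ _ _
  have hu' : algebraMap k C (P.t)⁻¹ * u = 1 := by
    rw [hu, ← map_mul, inv_mul_cancel₀ P.t_ne, map_one]
  have TL : ∀ Z, T (x • Z) = z • T Z - (1 + (u - 1) * z) • Z := by
    intro Z; rw [LT Z]; module
  have TR : ∀ Z, T (z • Z) = x • T Z + (1 + (u - 1) * z) • Z := by
    intro Z
    have h1 : T (x • T Z) = (u * z) • Z - T Z := by
      rw [TL, quad]; module
    have h2 := congrArg T h1
    rw [quad, h1, map_sub, quad, mul_smul, hopu] at h2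
    have h3 : u • T (z • Z) = u • (x • T Z + (1 + (u - 1) * z) • Z) := by
      linear_combination (norm := module) -h2
    have h4 := congrArg (fun v => algebraMap k C (P.t)⁻¹ • v) h3
    simpa only [← mul_smul, hu', one_smul] using h4
  have hD : ∀ Z, T ((z - x) • Z) = - (z - x) • T Z + (2 * (1 + (u - 1) * z)) • Z := by
    intro Z; rw [sub_smul, map_sub, TL, TR]; module
  have hX : ∀ Z, T ((1 + (u - 1) * z) • Z) =
      (1 + (u - 1) * x) • T Z + ((u - 1) * (1 + (u - 1) * z)) • Z := by
    intro Z
    simp only [add_smul, sub_mul, one_mul, sub_smul, mul_smul, one_smul, map_add, map_sub, hopu, TR]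
    module
  obtain ⟨Φ, hΦ⟩ : ∃ Φ : V → V, ∀ Z, Φ Z = (z - x) • T Z - (1 + (u - 1) * z) • Z := ⟨_, fun _ => rfl⟩
  have hsq : ∀ Z, Φ (Φ Z) = ((1 - x + u * z) * (1 - z + u * x)) • Z := by
    intro Z
    rw [hΦ, hΦ, map_sub, hD, hX, quad]; module
  have hz : ∀ (c : k) Z, (z - algebraMap k C c) • Φ Z = Φ ((x - algebraMap k C c) • Z) := by
    intro c Z
    rw [hΦ, hΦ, sub_smul x, map_sub, TL, op_alg']; module
  have hprod : ∀ (s : Finset (ZMod e)) Z, (∏ a ∈ s, (z - algebraMap k C (P.c a))) • Φ Z =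
      Φ ((∏ a ∈ s, (x - algebraMap k C (P.c a))) • Z) := by
    intro s
    induction s using Finset.induction_on with
    | empty => intro Z; simp
    | insert a s ha ih =>
      intro Z
      rw [Finset.prod_insert ha, Finset.prod_insert ha, mul_comm, mul_smul, hz, ih, ← mul_smul,
        mul_comm]
  have hpow : ∀ (N : ℕ) Z, (∏ a, (z - algebraMap k C (P.c a))) ^ N • Φ Z =
      Φ ((∏ a, (x - algebraMap k C (P.c a))) ^ N • Z) := by
    intro N
    induction N with
    | zero => intro Z; simp
    | succ N ih =>
      intro Z
      rw [pow_succ, mul_smul, hprod, ih, pow_succ, mul_smul]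
  have hx' := hx
  obtain ⟨N, hN⟩ := hx'
  refine hnil_prime P x z N hx (faith _ fun Z => ?_)
  rw [mul_smul, ← hu, ← hsq, hpow, hN, zero_smul, hΦ]
  simp

end hnil

section rnil
variable {k : Type*} [Field k] 
variable {C : Type*} [CommRing C] [Algebra k C]
variable {V : Type*} [AddCommGroup V] [Module k V] [Module C V] [IsScalarTower k C V]

/-- Nilpotency step for KLR generators, equal residues. -/
lemma rnil_eq (ψ : V →ₗ[k] V) (y z ε : C) (N : ℕ)
    (wt : ∀ Z : V, ε • Z = Z → ε • ψ Z = ψ Z)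
    (mv : ∀ Z : V, ε • Z = Z → z • ψ Z = ψ (y • Z) + Z)
    (sq : ∀ Z : V, ε • Z = Z → ψ (ψ Z) = 0)
    (hy : y ^ N = 0) : ∀ Z : V, ε • Z = Z → z ^ N • Z = 0 := by
  have wf : ∀ (f : C) (Z : V), ε • Z = Z → ε • (f • Z) = f • Z := by
    intro f Z h; rw [smul_comm, h]
  have hh : ∀ m : ℕ, ∃ h : C, ∀ Z : V, ε • Z = Z → z ^ m • ψ Z = ψ (y ^ m • Z) + h • Z := by
    intro m
    induction m with
    | zero => exact ⟨0, fun Z _ => by simp⟩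
    | succ m ih =>
      obtain ⟨h, hh⟩ := ih
      refine ⟨z ^ m + h * y, fun Z hZ => ?_⟩
      rw [pow_succ, mul_smul, mv Z hZ, smul_add, hh _ (wf _ _ hZ), pow_succ, mul_smul]; module
  obtain ⟨h, hh⟩ := hh N
  have h1 : ∀ Z : V, ε • Z = Z → z ^ N • ψ Z = h • Z := by
    intro Z hZ; rw [hh Z hZ, hy, zero_smul, map_zero, zero_add]
  have h2 : ∀ Z : V, ε • Z = Z → h • ψ Z = 0 := by
    intro Z hZ; rw [← h1 _ (wt _ hZ), sq _ hZ, smul_zero]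
  have h3 : ∀ Z : V, ε • Z = Z → h • Z = 0 := by
    intro Z hZ
    have := congrArg (fun v => h • v) (mv Z hZ)
    simp only [smul_add, h2 _ (wf _ _ hZ), smul_comm h z, h2 _ hZ, smul_zero, zero_add] at this
    exact this.symm
  have h4 : ∀ Z : V, ε • Z = Z → z ^ N • ψ Z = 0 := by
    intro Z hZ; rw [h1 _ hZ, h3 _ hZ]
  intro Z hZ
  have := congrArg (fun v => z ^ N • v) (mv Z hZ)
  simp only [smul_add, h4 _ (wf _ _ hZ), smul_comm (z ^ N) z, h4 _ hZ, smul_zero, zero_add] at this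
  exact this.symm

/-- Nilpotency step for KLR generators, different residues. -/
lemma rnil_ne (ψ : V →ₗ[k] V) (y z Q ε ε' : C) (N : ℕ)
    (wt : ∀ Z : V, ε • Z = Z → ε' • ψ Z = ψ Z)
    (mv : ∀ Z : V, ε' • Z = Z → z • ψ Z = ψ (y • Z))
    (sq : ∀ Z : V, ε • Z = Z → ψ (ψ Z) = Q • Z)
    (hy : y ^ N = 0) : ∀ Z : V, ε • Z = Z → (z ^ N * Q) • Z = 0 := by
  have hh : ∀ m : ℕ, ∀ Z : V, ε' • Z = Z → z ^ m • ψ Z = ψ (y ^ m • Z) := by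
    intro m
    induction m with
    | zero => intro Z _; simp
    | succ m ih =>
      intro Z hZ
      rw [pow_succ, mul_smul, mv Z hZ, ih _ (by rw [smul_comm, hZ]), pow_succ, mul_smul]
  intro Z hZ
  rw [mul_smul, ← sq Z hZ, hh _ _ (wt _ hZ), hy, zero_smul, map_zero]

end rnil
end Paper.BK

open scoped BigOperators
open scoped Classical
set_option linter.all false

namespace Paper.BK

section families
variable {k : Type*} [Field k] {e : ℕ} [NeZero e] {n : ℕ}
variable {A : Type*} [Ring A] [Algebra k A]

/-- Images of the Hecke generators. -/
def Hgen (L : Fin n → A) (T : Fin (n - 1) → A) : HeckeGen n → A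
  | .L a => L a
  | .T r => T r

/-- Images of the KLR generators. -/
def Kgen (E : (Fin n → ZMod e) → A) (y : Fin n → A) (ψ : Fin (n - 1) → A) : KLRGen n e → A
  | .idem i => E i
  | .psi r => ψ r
  | .y a => y a

/-- The Hecke relations hold. -/
def HD (t : kˣ) (ℓ : ℕ) (κ : ℕ → ℤ) (L : Fin n → A) (T : Fin (n - 1) → A) : Prop :=
  ∀ ⦃a b⦄, HeckeRel k t n ℓ κ a b →
    FreeAlgebra.lift k (Hgen L T) a = FreeAlgebra.lift k (Hgen L T) b

/-- The KLR relations hold. -/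
def KD (k : Type*) [Field k] [Algebra k A] (ℓ : ℕ) (κ : ℕ → ℤ) (E : (Fin n → ZMod e) → A)
    (y : Fin n → A) (ψ : Fin (n - 1) → A) : Prop :=
  ∀ ⦃a b⦄, KLRRel k n e ℓ κ a b →
    FreeAlgebra.lift k (Kgen E y ψ) a = FreeAlgebra.lift k (Kgen E y ψ) b

/-- The Hecke relations, in explicit form. -/
structure HF (P : Par k e) (ℓ : ℕ) (κ : ℕ → ℤ) (L : Fin n → A) (T : Fin (n - 1) → A) : Prop where
  cyc : ∀ h : 0 < n, ((List.range ℓ).map fun l =>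
    L (⟨0, h⟩ : Fin n) - algebraMap k A (P.c (κ l : ZMod e))).prod = 0
  quad : ∀ r, (T r + 1) * (T r - algebraMap k A P.t) = 0
  LL : ∀ a b, L a * L b = L b * L a
  far : ∀ r s : Fin (n - 1), (r.1 + 1 < s.1 ∨ s.1 + 1 < r.1) → T r * T s = T s * T r
  braid : ∀ r s : Fin (n - 1), s.1 = r.1 + 1 → T r * T s * T r = T s * T r * T s
  TL : ∀ (r : Fin (n - 1)) (a : Fin n), a.1 ≠ r.1 ∧ a.1 ≠ r.1 + 1 → T r * L a = L a * T r
  LT : ∀ r, L (pR r) * (T r - algebraMap k A P.t + 1) = T r * L (pL r) + 1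

lemma HD.toHF {P : Par k e} {t : kˣ} (ht : (t : k) = P.t) (hc : ∀ d : ℤ, qintU t d = P.c (d : ZMod e))
    {ℓ κ} {L : Fin n → A} {T : Fin (n - 1) → A} (h : HD t ℓ κ L T) : HF P ℓ κ L T := by
  constructor
  · intro h0
    have := h (.cyc h0)
    simpa [hL, hT, Hgen, map_list_prod, List.map_map, Function.comp_def, hc] using this
  · intro r
    have := h (.quad r)
    simpa [hL, hT, Hgen, ht] using this
  · intro a b
    have := h (.LL a b)
    simpa [hL, hT, Hgen, ht] using this
  · intro r s h0
    have := h (.TTfar r s h0)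
    simpa [hL, hT, Hgen, ht] using this
  · intro r s h0
    have := h (.braid r s h0)
    simpa [hL, hT, Hgen, ht] using this
  · intro r a h0
    have := h (.TL r a h0)
    simpa [hL, hT, Hgen, ht] using this
  · intro r
    have := h (.LT r)
    simpa [hL, hT, Hgen, ht] using this

lemma HF.toHD {P : Par k e} {t : kˣ} (ht : (t : k) = P.t) (hc : ∀ d : ℤ, qintU t d = P.c (d : ZMod e))
    {ℓ κ} {L : Fin n → A} {T : Fin (n - 1) → A} (h : HF P ℓ κ L T) : HD t ℓ κ L T := by
  intro a b hab
  cases hab with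
  | cyc h0 =>
    have := h.cyc h0
    simpa [hL, hT, Hgen, map_list_prod, List.map_map, Function.comp_def, hc] using this
  | quad r => have := h.quad r; simpa [hL, hT, Hgen, ht] using this
  | LL a b => have := h.LL a b; simpa [hL, hT, Hgen, ht] using this
  | TTfar r s h0 => have := h.far r s h0; simpa [hL, hT, Hgen, ht] using this
  | braid r s h0 => have := h.braid r s h0; simpa [hL, hT, Hgen, ht] using this
  | TL r a h0 => have := h.TL r a h0; simpa [hL, hT, Hgen, ht] using this
  | LT r => have := h.LT r; simpa [hL, hT, Hgen, ht] using this

/-- The quadratic polynomial of the KLR relations. -/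
noncomputable def QA (y : Fin n → A) (p q : ZMod e) (a b : Fin n) : A :=
  if p = q then 0 else
  if q = p + 1 then (if p = q + 1 then (y b - y a) * (y a - y b) else y a - y b)
  else (if p = q + 1 then y b - y a else 1)

/-- The braid correction of the KLR relations. -/
noncomputable def BA (y : Fin n → A) (i : Fin n → ZMod e) (a b c : Fin n) : A :=
  if i c = i a then
    (if i b = i a + 1 then (if i a = i b + 1 then y a - 2 * y b + y c else -1)
      else (if i a = i b + 1 then 1 else 0))
  else 0

/-- The KLR relations, in explicit form. -/
structure KF (ℓ : ℕ) (κ : ℕ → ℤ) (E : (Fin n → ZMod e) → A) (y : Fin n → A)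
    (ψ : Fin (n - 1) → A) : Prop where
  cyc : ∀ (h : 0 < n) (i : Fin n → ZMod e), y ⟨0, h⟩ ^
    (((Finset.range ℓ).filter fun l => ((κ l : ZMod e) = i ⟨0, h⟩)).card) * E i = 0
  orth : ∀ i j, i ≠ j → E i * E j = 0
  idem : ∀ i, E i * E i = E i
  complete : ∑ i, E i = 1
  yE : ∀ a i, y a * E i = E i * y a
  psiE : ∀ r i, ψ r * E i = E (swapSeq i r) * ψ r
  yy : ∀ a b, y a * y b = y b * y a
  psiy : ∀ r i, ψ r * y (pR r) * E i = (y (pL r) * ψ r + if i (pL r) = i (pR r) then 1 else 0) * E i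
  ypsi : ∀ r i, y (pR r) * ψ r * E i = (ψ r * y (pL r) + if i (pL r) = i (pR r) then 1 else 0) * E i
  far : ∀ (r : Fin (n - 1)) (a : Fin n), a.1 ≠ r.1 ∧ a.1 ≠ r.1 + 1 → ψ r * y a = y a * ψ r
  comm : ∀ r s : Fin (n - 1), (r.1 + 1 < s.1 ∨ s.1 + 1 < r.1) → ψ r * ψ s = ψ s * ψ r
  quad : ∀ r i, ψ r * ψ r * E i = QA y (i (pL r)) (i (pR r)) (pL r) (pR r) * E i
  braid : ∀ r s : Fin (n - 1), s.1 = r.1 + 1 → ∀ i, ψ r * ψ s * ψ r * E i =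
    (ψ s * ψ r * ψ s + BA y i (pL r) (pR r) (pR s)) * E i

lemma KD.toKF {ℓ κ} {E : (Fin n → ZMod e) → A} {y : Fin n → A} {ψ : Fin (n - 1) → A}
    (h : KD k ℓ κ E y ψ) : KF ℓ κ E y ψ := by
  constructor
  · intro h0 i
    have := h (.cyc h0 i); simpa [kE, kY, kPsi, Kgen] using this
  · intro i j hij
    have := h (.orth i j hij); simpa [kE, kY, kPsi, Kgen] using this
  · intro i
    have := h (.idem i); simpa [kE, kY, kPsi, Kgen] using this
  · have := h (.complete); simpa [kE, kY, kPsi, Kgen] using this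
  · intro a i
    have := h (.yE a i); simpa [kE, kY, kPsi, Kgen] using this
  · intro r i
    have := h (.psiE r i); simpa [kE, kY, kPsi, Kgen] using this
  · intro a b
    have := h (.yy a b); simpa [kE, kY, kPsi, Kgen] using this
  · intro r i
    by_cases hi : i (pL r) = i (pR r)
    · have := h (.psiyEq r i hi); rw [if_pos hi]; simpa [kE, kY, kPsi, Kgen] using this
    · have := h (.psiyNe r i hi); rw [if_neg hi]; simpa [kE, kY, kPsi, Kgen] using this
  · intro r i
    by_cases hi : i (pL r) = i (pR r)
    · have := h (.ypsiEq r i hi); rw [if_pos hi]; simpa [kE, kY, kPsi, Kgen] using this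
    · have := h (.ypsiNe r i hi); rw [if_neg hi]; simpa [kE, kY, kPsi, Kgen] using this
  · intro r a ha
    have := h (.psiyFar r a ha); simpa [kE, kY, kPsi, Kgen] using this
  · intro r s hs
    have := h (.psipsiFar r s hs); simpa [kE, kY, kPsi, Kgen] using this
  · intro r i
    rw [QA]
    split_ifs with h1 h2 h3 h3
    · have := h (.quadEq r i h1); simpa [kE, kY, kPsi, Kgen, pow_two] using this
    · have := h (.quadBoth r i h2 h3); simpa [kE, kY, kPsi, Kgen, pow_two] using this
    · have := h (.quadR r i h2 h3); simpa [kE, kY, kPsi, Kgen, pow_two] using this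
    · have := h (.quadL r i h3 h2); simpa [kE, kY, kPsi, Kgen, pow_two] using this
    · have := h (.quadNone r i h1 h2 h3); simpa [kE, kY, kPsi, Kgen, pow_two] using this
  · intro r s hs i
    have hr : r.1 + 1 < n - 1 := by have := s.2; omega
    obtain rfl : s = ⟨r.1 + 1, hr⟩ := Fin.ext hs
    have hM : pM r hr = pR ⟨r.1 + 1, hr⟩ := rfl
    rw [BA]
    split_ifs with h1 h2 h3 h3
    · have := h (.braidBoth r hr i h1 h2 h3)
      have h2' : FreeAlgebra.lift k (Kgen E y ψ) 2 = 2 := map_ofNat _ 2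
      simpa [kE, kY, kPsi, Kgen, hM, h2', sub_eq_add_neg, add_assoc] using this
    · have := h (.braidR r hr i h1 h2 h3); simpa [kE, kY, kPsi, Kgen, sub_eq_add_neg] using this
    · have := h (.braidL r hr i h1 h3 h2); simpa [kE, kY, kPsi, Kgen] using this
    · have := h (.braidNone r hr i (fun hh => hh.2.elim h2 h3)); simpa [kE, kY, kPsi, Kgen] using this
    · have := h (.braidNone r hr i (fun hh => h1 hh.1)); simpa [kE, kY, kPsi, Kgen] using this

lemma KF.toKD (P : Par k e) {ℓ κ} {E : (Fin n → ZMod e) → A} {y : Fin n → A} {ψ : Fin (n - 1) → A}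
    (h : KF ℓ κ E y ψ) : KD k ℓ κ E y ψ := by
  intro a b hab
  cases hab with
  | cyc h0 i => have := h.cyc h0 i; simpa [kE, kY, kPsi, Kgen] using this
  | orth i j hij => have := h.orth i j hij; simpa [kE, kY, kPsi, Kgen] using this
  | idem i => have := h.idem i; simpa [kE, kY, kPsi, Kgen] using this
  | complete => have := h.complete; simpa [kE, kY, kPsi, Kgen] using this
  | yE a i => have := h.yE a i; simpa [kE, kY, kPsi, Kgen] using this
  | psiE r i => have := h.psiE r i; simpa [kE, kY, kPsi, Kgen] using this
  | yy a b => have := h.yy a b; simpa [kE, kY, kPsi, Kgen] using this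
  | psiyEq r i hi => have := h.psiy r i; rw [if_pos hi] at this; simpa [kE, kY, kPsi, Kgen] using this
  | psiyNe r i hi => have := h.psiy r i; rw [if_neg hi] at this; simpa [kE, kY, kPsi, Kgen] using this
  | ypsiEq r i hi => have := h.ypsi r i; rw [if_pos hi] at this; simpa [kE, kY, kPsi, Kgen] using this
  | ypsiNe r i hi => have := h.ypsi r i; rw [if_neg hi] at this; simpa [kE, kY, kPsi, Kgen] using this
  | psiyFar r a ha => have := h.far r a ha; simpa [kE, kY, kPsi, Kgen] using this
  | psipsiFar r s hs => have := h.comm r s hs; simpa [kE, kY, kPsi, Kgen] using this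
  | quadEq r i h1 =>
    have := h.quad r i; rw [QA, if_pos h1] at this
    simpa [kE, kY, kPsi, Kgen, pow_two] using this
  | quadR r i h1 h2 =>
    have h0 : i (pL r) ≠ i (pR r) := fun h0 => h2 (by rw [h0] at h1 ⊢; exact h1)
    have := h.quad r i; rw [QA, if_neg h0, if_pos h1, if_neg h2] at this
    simpa [kE, kY, kPsi, Kgen, pow_two] using this
  | quadL r i h1 h2 =>
    have h0 : i (pL r) ≠ i (pR r) := fun h0 => h2 (by rw [h0] at h1 ⊢; exact h1)
    have := h.quad r i; rw [QA, if_neg h0, if_neg h2, if_pos h1] at this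
    simpa [kE, kY, kPsi, Kgen, pow_two] using this
  | quadBoth r i h1 h2 =>
    by_cases h0 : i (pL r) = i (pR r)
    · rw [h0] at h1
      exact absurd h1 (P.ne_succ _)
    have := h.quad r i; rw [QA, if_neg h0, if_pos h1, if_pos h2] at this
    simpa [kE, kY, kPsi, Kgen, pow_two] using this
  | quadNone r i h1 h2 h3 =>
    have := h.quad r i; rw [QA, if_neg h1, if_neg h2, if_neg h3] at this
    simpa [kE, kY, kPsi, Kgen, pow_two] using this
  | braidR r hr i h0 h1 h2 =>
    have hM : pM r hr = pR ⟨r.1 + 1, hr⟩ := rfl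
    have := h.braid r ⟨r.1 + 1, hr⟩ rfl i
    rw [BA, ← hM, if_pos h0, if_pos h1, if_neg h2] at this
    simpa [kE, kY, kPsi, Kgen, sub_eq_add_neg] using this
  | braidL r hr i h0 h1 h2 =>
    have hM : pM r hr = pR ⟨r.1 + 1, hr⟩ := rfl
    have := h.braid r ⟨r.1 + 1, hr⟩ rfl i
    rw [BA, ← hM, if_pos h0, if_neg h2, if_pos h1] at this
    simpa [kE, kY, kPsi, Kgen] using this
  | braidBoth r hr i h0 h1 h2 =>
    have hM : pM r hr = pR ⟨r.1 + 1, hr⟩ := rfl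
    have := h.braid r ⟨r.1 + 1, hr⟩ rfl i
    rw [BA, ← hM, if_pos h0, if_pos h1, if_pos h2] at this
    have h2' : FreeAlgebra.lift k (Kgen E y ψ) 2 = 2 := map_ofNat _ 2
    simpa [kE, kY, kPsi, Kgen, h2', sub_eq_add_neg, add_assoc] using this
  | braidNone r hr i hh =>
    have hM : pM r hr = pR ⟨r.1 + 1, hr⟩ := rfl
    have := h.braid r ⟨r.1 + 1, hr⟩ rfl i
    rw [BA, ← hM] at this
    split_ifs at this with h1 h2 h3 h3
    · exact absurd ⟨h1, .inl h2⟩ hh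
    · exact absurd ⟨h1, .inl h2⟩ hh
    · exact absurd ⟨h1, .inr h3⟩ hh
    · simpa [kE, kY, kPsi, Kgen] using this
    · simpa [kE, kY, kPsi, Kgen] using this

end families
end Paper.BK

open scoped BigOperators
open scoped Classical
set_option linter.all false

namespace Paper.BK

section cyc
variable {k : Type*} [Field k] {e : ℕ} [NeZero e] {P : Par k e} {n : ℕ}
variable {C : Type*} [CommRing C] [Algebra k C] {A : Type*} [Ring A] [Algebra k A]

lemma prod_list (ι : C →ₐ[k] A) (f : ℕ → C) (g : ℕ → A) (h : ∀ l, ι (f l) = g l) (ℓ : ℕ) :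
    ι (∏ l ∈ Finset.range ℓ, f l) = ((List.range ℓ).map g).prod := by
  induction ℓ with
  | zero => simp
  | succ ℓ ih => rw [Finset.prod_range_succ, map_mul, ih, List.range_succ]; simp [h]

lemma cyc_unit (S : Sys P n C) (a : Fin n) (i : Fin n → ZMod e) (κ : ℕ → ZMod e) (ℓ : ℕ) :
    ∃ w w' : C, w' * w = 1 ∧ (∏ l ∈ Finset.range ℓ, (S.x a - algebraMap k C (P.c (κ l)))) * S.E i =
      w * S.y a ^ (((Finset.range ℓ).filter fun l => κ l = i a).card) * S.E i := by
  induction ℓ with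
  | zero => exact ⟨1, 1, by simp, by simp⟩
  | succ ℓ ih =>
    obtain ⟨w, w', hw, h⟩ := ih
    rw [Finset.prod_range_succ, Finset.range_add_one, Finset.filter_insert]
    by_cases hl : κ ℓ = i a
    · rw [if_pos hl, Finset.card_insert_of_notMem (by simp)]
      refine ⟨w * algebraMap k C (P.q (i a)), w' * algebraMap k C (P.q (i a))⁻¹, ?_, ?_⟩
      · have h1 : algebraMap k C (P.q (i a))⁻¹ * algebraMap k C (P.q (i a)) = 1 := by
          rw [← map_mul, inv_mul_cancel₀ (P.q_ne _), map_one]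
        linear_combination (algebraMap k C (P.q (i a))⁻¹ * algebraMap k C (P.q (i a))) * hw + h1
      · rw [hl]
        linear_combination (S.x a - algebraMap k C (P.c (i a))) * h +
          w * S.y a ^ (((Finset.range ℓ).filter fun l => κ l = i a).card) * S.x_E a i
    · rw [if_neg hl]
      have hu : IsUnit (algebraMap k C (P.c (i a) - P.c (κ ℓ))) :=
        (IsUnit.mk0 _ (sub_ne_zero.mpr fun hc => hl (P.inj hc).symm)).map _
      have h2 := IsNilpotent.isUnit_add_left_of_commute (S.nil a i) hu (Commute.all _ _)
      obtain ⟨v', hv⟩ := h2.exists_left_inv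
      refine ⟨w * (algebraMap k C (P.c (i a) - P.c (κ ℓ)) +
        (S.x a - algebraMap k C (P.c (i a))) * S.E i), w' * v', ?_, ?_⟩
      · linear_combination hv * (w' * w) + hw
      · rw [map_sub]
        linear_combination (S.x a - algebraMap k C (P.c (κ ℓ))) * h -
          w * S.y a ^ (((Finset.range ℓ).filter fun l => κ l = i a).card) * 
            (S.x a - algebraMap k C (P.c (i a))) * S.idem i

end cyc

section more
variable {k : Type*} [Field k] {e : ℕ} [NeZero e] {P : Par k e} {n : ℕ}
variable {C : Type*} [CommRing C] [Algebra k C] {A : Type*} [Ring A] [Algebra k A]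
variable {V : Type*} [AddCommGroup V] [Module k V] [Module C V] [IsScalarTower k C V]
variable {S : Sys P n C} {Q : Fin (n - 1) → (Fin n → ZMod e) → C} {h : ZMod e → k}
variable {ψ : Fin (n - 1) → V →ₗ[k] V}

lemma Pre.psiE (p : Pre S h Q ψ) (r i) (Z : V) :
    ψ r (S.E i • Z) = S.E (swapSeq i r) • ψ r Z := by
  refine Sys.ext_V (S := S) (W := ψ r ∘ₗ mulC (S.E i)) (W' := mulC (S.E (swapSeq i r)) ∘ₗ ψ r) ?_ Z
  intro j Z hZ
  simp only [LinearMap.comp_apply, mulC_apply]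
  by_cases hj : j = i
  · subst hj
    have h1 := p.wt r _ Z hZ
    rw [Sys.wt] at h1
    rw [h1, hZ]
  · rw [hZ.ne (Ne.symm hj), map_zero, (p.wt r _ Z hZ).ne]
    intro hh
    apply hj
    have := congrArg (fun i => swapSeq i r) hh
    simpa [swapSeq_swapSeq] using this.symm

lemma dx_q (h : ZMod e → k) (r : Fin (n - 1)) (i : Fin n → ZMod e) (a) :
    dx h r i a = h (i (sw r a)) * dx (fun _ => 1) r i a := by
  by_cases hi : i (pL r) = i (pR r)
  · by_cases h1 : a = pL r
    · rw [h1, dx_L _ _ _ hi, dx_L _ _ _ hi, sw_L, ← hi]; ring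
    by_cases h2 : a = pR r
    · rw [h2, dx_R _ _ _ hi, dx_R _ _ _ hi, sw_R]; ring
    rw [dx_far _ _ _ h1 h2, dx_far _ _ _ h1 h2]; ring
  · rw [dx_ne _ _ _ hi, dx_ne _ _ _ hi]; ring

lemma Pre.mvy (p : Pre S P.q Q ψ) (r i) (Z : V) (hZ : S.wt i Z) (a) :
    S.y a • ψ r Z = ψ r (S.y (sw r a) • Z) + algebraMap k C (dx (fun _ => 1) r i a) • Z := by
  rw [(p.wt r i Z hZ).congr (S.y_E a _), hZ.congr (S.y_E (sw r a) _), swapSeq_apply]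
  rw [mul_smul, mul_smul, Sys.op_alg, sub_smul, sub_smul, p.mv r i Z hZ, map_sub, Sys.op_alg, dx_q,
    map_mul]
  have h1 : algebraMap k C (P.q (i (sw r a)))⁻¹ * algebraMap k C (P.q (i (sw r a))) = 1 := by
    rw [← map_mul, inv_mul_cancel₀ (P.q_ne _), map_one]
  have h2 : (algebraMap k C (P.q (i (sw r a)))⁻¹ * algebraMap k C (P.q (i (sw r a)))) • 
    (algebraMap k C (dx (fun _ => 1) r i a)) • Z = (algebraMap k C (dx (fun _ => 1) r i a)) • Z := by
    rw [h1, one_smul]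
  linear_combination (norm := module) h2

lemma map_QK (ι : C →ₐ[k] A) (S : Sys P n C) (p q a b) :
    ι (S.QK' p q a b) = QA (fun a => ι (S.y a)) p q a b := by
  rw [Sys.QK', QA]
  split_ifs <;> simp

lemma map_BK (ι : C →ₐ[k] A) (S : Sys P n C) (i a b c) :
    ι (S.BK i a b c) = BA (fun a => ι (S.y a)) i a b c := by
  rw [Sys.BK, BA]
  have h2 : ι 2 = 2 := map_ofNat _ 2
  split_ifs <;> simp [h2]

end more
end Paper.BK

open scoped BigOperators
open scoped Classical
set_option linter.all false

namespace Paper.BK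

section HtoK
variable {k : Type*} [Field k] {e : ℕ} [NeZero e] {P : Par k e} {n : ℕ}
variable {C : Type*} [CommRing C] [Algebra k C] {A : Type*} [Ring A] [Algebra k A]
variable [Module C A] [IsScalarTower k C A]
variable {ℓ : ℕ} {κ : ℕ → ℤ}

lemma HF.quad' {L : Fin n → A} {T} (h : HF P ℓ κ L T) (r) (Z : A) :
    T r * (T r * Z) = (algebraMap k A P.t - 1) * (T r * Z) + algebraMap k A P.t * Z := by
  have h1 := congrArg (fun a => a * Z) (h.quad r)
  simp only [mul_sub, add_mul, sub_mul, ← Algebra.commutes P.t (T r), one_mul, zero_mul, mul_assoc] at h1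
  rw [sub_mul, one_mul]
  linear_combination (norm := abel) h1

lemma HF.LT' {L : Fin n → A} {T} (h : HF P ℓ κ L T) (r) (Z : A) :
    L (pR r) * (T r * Z) = T r * (L (pL r) * Z) + Z + (algebraMap k A P.t - 1) * L (pR r) * Z := by
  have h1 := congrArg (fun a => a * Z) (h.LT r)
  simp only [mul_sub, mul_add, add_mul, sub_mul, mul_one, ← Algebra.commutes P.t (L (pR r)), one_mul,
    mul_assoc] at h1
  simp only [sub_mul, one_mul, mul_assoc]
  linear_combination (norm := abel) h1

lemma HF.nilp (ι : C →ₐ[k] A) (hι : ∀ (c : C) (a : A), c • a = ι c * a) (hi : Function.Injective ι)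
    {L : Fin n → A} {T : Fin (n - 1) → A} (h : HF P ℓ κ L T) (x : Fin n → C)
    (hx : ∀ a, ι (x a) = L a) :
    ∀ (m : ℕ) (hm : m < n), IsNilpotent (∏ a, (x ⟨m, hm⟩ - algebraMap k C (P.c a))) := by
  intro m
  induction m with
  | zero =>
    intro hm
    have h0 : ∏ l ∈ Finset.range ℓ, (x ⟨0, hm⟩ - algebraMap k C (P.c (κ l : ZMod e))) = 0 := by
      apply hi
      rw [prod_list ι _ (fun l => L ⟨0, hm⟩ - algebraMap k A (P.c (κ l : ZMod e))) (by simp [hx]),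
        h.cyc hm, map_zero]
    rw [nilpotent_iff_mem_prime]
    intro J hJ
    have h1 : ∏ l ∈ Finset.range ℓ, (x ⟨0, hm⟩ - algebraMap k C (P.c (κ l : ZMod e))) ∈ J := by
      rw [h0]; exact J.zero_mem
    rw [hJ.prod_mem_iff] at h1 ⊢
    obtain ⟨l, -, hl⟩ := h1
    exact ⟨_, Finset.mem_univ _, hl⟩
  | succ m ih =>
    intro hm
    have ih' := ih (by omega)
    let r : Fin (n - 1) := ⟨m, by omega⟩
    refine hnil_step P (LinearMap.mulLeft k (T r)) (x (pL r)) (x (pR r)) _ rfl ?_ ?_ ?_ ih'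
    · intro Z
      simp only [LinearMap.mulLeft_apply, hι, map_sub, map_one, AlgHom.commutes]
      exact h.quad' r Z
    · intro Z
      simp only [LinearMap.mulLeft_apply, hι, map_sub, map_one, AlgHom.commutes, map_mul, hx]
      exact h.LT' r Z
    · intro c hc
      have := hc (1 : A)
      rw [hι, mul_one] at this
      exact hi (by rw [this, map_zero])

lemma HF.toHPre (ι : C →ₐ[k] A) (hι : ∀ (c : C) (a : A), c • a = ι c * a)
    {L : Fin n → A} {T : Fin (n - 1) → A} (h : HF P ℓ κ L T) (S : Sys P n C)
    (hx : ∀ a, ι (S.x a) = L a) :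
    HPre S (fun r => LinearMap.mulLeft k (T r)) ∧ BraidH (fun r => LinearMap.mulLeft k (T r)) := by
  refine ⟨⟨?_, ?_, ?_, ?_⟩, ?_⟩
  · intro r Z
    simp only [LinearMap.mulLeft_apply, hι, map_sub, map_one, AlgHom.commutes, tt]
    exact h.quad' r Z
  · intro r a h1 h2 Z
    simp only [LinearMap.mulLeft_apply, hι, hx, ← mul_assoc]
    rw [h.TL r a ⟨fun hh => h1 (Fin.ext hh), fun hh => h2 (Fin.ext hh)⟩]
  · intro r Z
    simp only [LinearMap.mulLeft_apply, hι, map_sub, map_one, AlgHom.commutes, map_mul, hx, tt]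
    exact h.LT' r Z
  · intro r s hrs Z
    simp only [LinearMap.mulLeft_apply, ← mul_assoc, h.far r s hrs]
  · intro r s hrs Z
    simp only [LinearMap.mulLeft_apply, ← mul_assoc, h.braid r s hrs]

/-- KLR operators give the KLR relations. -/
lemma kf_of_pre (ι : C →ₐ[k] A) (hι : ∀ (c : C) (a : A), c • a = ι c * a) (S : Sys P n C)
    (ψ : Fin (n - 1) → A) (p : Pre S P.q S.QK (fun r => LinearMap.mulLeft k (ψ r)))
    (b : BraidK S (fun r => LinearMap.mulLeft k (ψ r)))
    (hcyc : ∀ h : 0 < n, ((List.range ℓ).map fun l =>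
      ι (S.x (⟨0, h⟩ : Fin n)) - algebraMap k A (P.c (κ l : ZMod e))).prod = 0) :
    KF ℓ κ (fun i => ι (S.E i)) (fun a => ι (S.y a)) ψ := by
  have hw : ∀ i, S.wt i (ι (S.E i)) := by
    intro i; rw [Sys.wt, hι, ← map_mul, S.idem]
  have hmv := fun r i => p.mvy r i _ (hw i)
  simp only [LinearMap.mulLeft_apply, hι, AlgHom.commutes] at hmv
  have hcm : ∀ f g : C, ι f * ι g = ι g * ι f := by
    intro f g; rw [← map_mul, mul_comm, map_mul]
  refine ⟨?_, ?_, ?_, ?_, ?_, ?_, ?_, ?_, ?_, ?_, ?_, ?_, ?_⟩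
  · intro h0 i
    obtain ⟨w, w', hw, h1⟩ := cyc_unit S ⟨0, h0⟩ i (fun l => (κ l : ZMod e)) ℓ
    have h2 := congrArg (fun z => ι (w' * z)) h1
    rw [← mul_assoc w', ← mul_assoc w', ← mul_assoc w', hw, one_mul, map_mul, map_mul, prod_list ι _ _ (fun l => by
      rw [map_sub, AlgHom.commutes]), hcyc h0, mul_zero, zero_mul, map_mul, map_pow] at h2
    exact h2.symm
  · intro i j hij; rw [← map_mul, S.orth i j hij, map_zero]
  · intro i; rw [← map_mul, S.idem]
  · rw [← map_sum, S.complete, map_one]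
  · intro a i; exact hcm _ _
  · intro r i
    have := p.psiE r i 1
    simpa only [LinearMap.mulLeft_apply, hι, mul_one] using this
  · intro a b; exact hcm _ _
  · intro r i
    have := hmv r i (pL r)
    rw [sw_L] at this
    simp only [add_mul, mul_assoc]
    split_ifs with hi
    · rw [dx_L _ _ _ hi] at this
      rw [this]; simp
    · rw [dx_ne _ _ _ hi] at this
      rw [this]; simp
  · intro r i
    have := hmv r i (pR r)
    rw [sw_R] at this
    simp only [add_mul, mul_assoc]
    split_ifs with hi
    · rw [dx_R _ _ _ hi] at this
      rw [this]; simp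
    · rw [dx_ne _ _ _ hi] at this
      rw [this]; simp
  · intro r a ha
    have := Sys.ext_V (S := S) (W := LinearMap.mulLeft k (ψ r * ι (S.y a)))
      (W' := LinearMap.mulLeft k (ι (S.y a) * ψ r)) (fun i Z hZ => ?_) 1
    · simpa using this
    have h1 : a ≠ pL r := fun hh => ha.1 (by rw [hh]; rfl)
    have h2 : a ≠ pR r := fun hh => ha.2 (by rw [hh]; rfl)
    have h3 := p.mvy r i Z hZ a
    rw [sw_far _ h1 h2, dx_far _ _ _ h1 h2] at h3
    simp only [LinearMap.mulLeft_apply, hι, map_zero, zero_mul, add_zero] at h3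
    simp only [LinearMap.mulLeft_apply, mul_assoc, h3]
  · intro r s hrs
    have := p.comm r s hrs 1
    simpa using this
  · intro r i
    have := p.sq r i _ (hw i)
    simp only [LinearMap.mulLeft_apply, hι, Sys.QK, map_QK] at this
    rw [mul_assoc, this]
  · intro r s hrs i
    have := b r s hrs i _ (hw i)
    simp only [LinearMap.mulLeft_apply, hι, map_BK] at this
    rw [add_mul, ← this]
    simp only [mul_assoc]; abel

lemma HtoK_core (ι : C →ₐ[k] A) (hι : ∀ (c : C) (a : A), c • a = ι c * a)
    {L : Fin n → A} {T : Fin (n - 1) → A} (h : HF P ℓ κ L T) (S : Sys P n C)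
    (hx : ∀ a, ι (S.x a) = L a) : ∃ E y ψ, Link ι S L T E y ψ ∧ KF ℓ κ E y ψ := by
  obtain ⟨hp, hb⟩ := h.toHPre ι hι S hx
  let τ : Fin (n - 1) → A := fun r => ι (S.Df (pL r) (pR r)) * T r * ι (S.Ni (pL r) (pR r)) -
    ι (S.kX (pL r) (pR r) * S.Ni (pL r) (pR r))
  let ψ : Fin (n - 1) → A := fun r => τ r * ι (S.Gi (pL r) (pR r))
  have hτ : ∀ r Z, LinearMap.mulLeft k (τ r) Z = S.Df (pL r) (pR r) • LinearMap.mulLeft k (T r)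
      (S.Ni (pL r) (pR r) • Z) - (S.kX (pL r) (pR r) * S.Ni (pL r) (pR r)) • Z := by
    intro r Z
    simp only [LinearMap.mulLeft_apply, hι, τ, sub_mul, mul_assoc]
  have hψ : ∀ r Z, LinearMap.mulLeft k (ψ r) Z = LinearMap.mulLeft k (τ r)
      (S.Gi (pL r) (pR r) • Z) := by
    intro r Z
    simp only [LinearMap.mulLeft_apply, hι, ψ, mul_assoc]
  have hψ' : ∀ r Z, LinearMap.mulLeft k (τ r) Z = LinearMap.mulLeft k (ψ r)
      (S.G (pL r) (pR r) • Z) := by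
    intro r Z
    rw [hψ, ← mul_smul, mul_comm, S.G_Gi, one_smul]
  have pI := pre_of_hpre (τ := fun r => LinearMap.mulLeft k (τ r)) hp hτ
  have rel : Rel S (fun r => LinearMap.mulLeft k (T r)) (fun r => LinearMap.mulLeft k (τ r)) :=
    Rel.of_inv hτ
  have pK := pre_ItoK (ψ := fun r => LinearMap.mulLeft k (ψ r)) pI hψ
  have bI := braid_HtoI hp pI rel hb
  have bK := braid_ItoK pK hψ' bI
  refine ⟨_, _, ψ, ⟨fun a => (hx a).symm, fun i => rfl, fun a => rfl, ?_⟩,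
    kf_of_pre ι hι S ψ pK bK fun h0 => ?_⟩
  · intro r
    have h1 := rel r 1
    rw [hψ'] at h1
    simpa only [LinearMap.mulLeft_apply, hι, mul_one, mul_assoc] using h1
  · simp only [hx]; exact h.cyc h0

end HtoK

section HtoK'
variable {k : Type*} [Field k] {e : ℕ} [NeZero e] {P : Par k e} {n : ℕ}
variable {A : Type} [Ring A] [Algebra k A] {ℓ : ℕ} {κ : ℕ → ℤ}

/-- From the Hecke relations to the KLR relations. -/
theorem HtoK {L : Fin n → A} {T : Fin (n - 1) → A} (h : HF P ℓ κ L T) :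
    ∃ (C : Type) (_ : CommRing C) (_ : Algebra k C) (ι : C →ₐ[k] A) (S : Sys P n C),
      ∃ E y ψ, Link ι S L T E y ψ ∧ KF ℓ κ E y ψ := by
  obtain ⟨C, iC, iA, ι, hi, hs⟩ := exists_comm (k := k) (Set.range L) (by
    rintro _ ⟨a, rfl⟩ _ ⟨b, rfl⟩; exact h.LL a b)
  choose x hx using fun a => hs (L a) ⟨a, rfl⟩
  letI : Module C A := Module.compHom A ι.toRingHom
  have hι : ∀ (c : C) (a : A), c • a = ι c * a := fun c a => rfl
  haveI : IsScalarTower k C A := ⟨fun s c a => by rw [hι, hι, map_smul, smul_mul_assoc]⟩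
  obtain ⟨S, rfl⟩ := exists_sys P x (fun m => h.nilp ι hι hi x hx m.1 m.2)
  exact ⟨C, iC, iA, ι, S, HtoK_core ι hι h S hx⟩

end HtoK'
end Paper.BK

open scoped BigOperators
open scoped Classical
set_option linter.all false

namespace Paper.BK

section KtoH
variable {k : Type*} [Field k] {e : ℕ} [NeZero e] {P : Par k e} {n : ℕ}
variable {C : Type*} [CommRing C] [Algebra k C] {A : Type*} [Ring A] [Algebra k A]
variable [Module C A] [IsScalarTower k C A]
variable {ℓ : ℕ} {κ : ℕ → ℤ}
variable {E : (Fin n → ZMod e) → A} {y : Fin n → A} {ψ : Fin (n - 1) → A}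

lemma KF.mv (h : KF ℓ κ E y ψ) (r i) (Z : A) (hZ : E i * Z = Z) (a) :
    y a * (ψ r * Z) = ψ r * (y (sw r a) * Z) + algebraMap k A (dx (fun _ => 1) r i a) * Z := by
  by_cases h1 : a = pL r
  · have := congrArg (fun u => u * Z) (h.psiy r i)
    simp only [mul_assoc, hZ, add_mul] at this
    rw [h1, sw_L, this]
    split_ifs with hi
    · rw [dx_L _ _ _ hi]; simp
    · rw [dx_ne _ _ _ hi]; simp
  by_cases h2 : a = pR r
  · have := congrArg (fun u => u * Z) (h.ypsi r i)
    simp only [mul_assoc, hZ, add_mul] at this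
    rw [h2, sw_R, this]
    split_ifs with hi
    · rw [dx_R _ _ _ hi]; simp
    · rw [dx_ne _ _ _ hi]; simp
  · rw [sw_far _ h1 h2, dx_far _ _ _ h1 h2, map_zero, zero_mul, add_zero, ← mul_assoc, ← mul_assoc,
      h.far r a ⟨fun hh => h1 (Fin.ext hh), fun hh => h2 (Fin.ext hh)⟩]

lemma KF.wt' (h : KF ℓ κ E y ψ) (r i) (Z : A) (hZ : E i * Z = Z) :
    E (swapSeq i r) * (ψ r * Z) = ψ r * Z := by
  rw [← mul_assoc, ← h.psiE, mul_assoc, hZ]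

lemma KF.sq' (h : KF ℓ κ E y ψ) (r i) (Z : A) (hZ : E i * Z = Z) :
    ψ r * (ψ r * Z) = QA y (i (pL r)) (i (pR r)) (pL r) (pR r) * Z := by
  have := congrArg (fun u => u * Z) (h.quad r i)
  simpa only [mul_assoc, hZ] using this

lemma QA_mem {C : Type*} [CommRing C] (J : Ideal C) (hJ : J.IsPrime) (y : Fin n → C) (p q : ZMod e) (a b)
    (hpq : p ≠ q) (ha : y a ∈ J) (h : QA y p q a b ∈ J) : y b ∈ J := by
  have h1 : y a - y b ∈ J → y b ∈ J := fun h => by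
    have := J.sub_mem ha h; simpa using this
  have h2 : y b - y a ∈ J → y b ∈ J := fun h => by
    have := J.add_mem ha h; simpa using this
  rw [QA, if_neg hpq] at h
  split_ifs at h
  · exact (hJ.mem_or_mem h).elim h2 h1
  · exact h1 h
  · exact h2 h
  · exact absurd ((Ideal.eq_top_iff_one J).mpr h) hJ.ne_top

lemma map_QA (ι : C →ₐ[k] A) (y : Fin n → C) (p q : ZMod e) (a b) :
    ι (QA y p q a b) = QA (fun a => ι (y a)) p q a b := by
  rw [QA, QA]
  split_ifs <;> simp

lemma KF.nilp (ι : C →ₐ[k] A) (hι : ∀ (c : C) (a : A), c • a = ι c * a) (hi : Function.Injective ι)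
    (h : KF ℓ κ E y ψ) (y' : Fin n → C) (E' : (Fin n → ZMod e) → C) (hy : ∀ a, ι (y' a) = y a)
    (hE : ∀ i, ι (E' i) = E i) :
    ∀ (m : ℕ) (hm : m < n), IsNilpotent (y' ⟨m, hm⟩) := by
  have hsum : ∑ i, E' i = 1 := hi (by rw [map_sum, map_one, ← h.complete]; simp [hE])
  have hid : ∀ i, E' i * E' i = E' i := fun i => hi (by rw [map_mul, hE, h.idem])
  have hy' : (fun a => ι (y' a)) = y := funext hy
  intro m
  induction m with
  | zero =>
    intro hm
    refine ⟨ℓ, hi ?_⟩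
    rw [map_pow, hy, map_zero, ← mul_one (y _ ^ ℓ), ← h.complete, Finset.mul_sum]
    refine Finset.sum_eq_zero fun i _ => ?_
    have hle : ((Finset.range ℓ).filter fun l => ((κ l : ZMod e) = i ⟨0, hm⟩)).card ≤ ℓ := by
      simpa using Finset.card_filter_le (Finset.range ℓ) (fun l => ((κ l : ZMod e) = i ⟨0, hm⟩))
    have h1 := h.cyc hm i
    obtain ⟨d, hd⟩ := Nat.exists_eq_add_of_le hle
    generalize ((Finset.range ℓ).filter fun l => ((κ l : ZMod e) = i ⟨0, hm⟩)).card = c at *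
    rw [hd, add_comm, pow_add, mul_assoc, h1, mul_zero]
  | succ m ih =>
    intro hm
    obtain ⟨N, hN⟩ := ih (by omega)
    let r : Fin (n - 1) := ⟨m, by omega⟩
    change y' (pL r) ^ N = 0 at hN
    change IsNilpotent (y' (pR r))
    have hyL : IsNilpotent (y' (pL r)) := ⟨N, hN⟩
    have key : ∀ i, ∀ J : Ideal C, J.IsPrime → y' (pR r) * E' i ∈ J := by
      intro i J hJ
      by_cases hlr : i (pL r) = i (pR r)
      · have h1 := rnil_eq (V := A) (LinearMap.mulLeft k (ψ r)) (y' (pL r)) (y' (pR r)) (E' i) N ?_ ?_ ?_ hN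
          (E i) (by rw [hι, hE, h.idem])
        · rw [hι, ← hE, ← map_mul] at h1
          have h2 : y' (pR r) ^ N * E' i ∈ J := by
            rw [hi (h1.trans (map_zero ι).symm)]; exact J.zero_mem
          rcases hJ.mem_or_mem h2 with h3 | h3
          · exact J.mul_mem_right _ (hJ.mem_of_pow_mem _ h3)
          · exact J.mul_mem_left _ h3
        · intro Z hZ
          rw [hι, hE] at hZ ⊢
          have := h.wt' r i Z hZ
          rwa [swapSeq_eq _ _ hlr] at this
        · intro Z hZ
          rw [hι, hE] at hZ
          have := h.mv (k := k) r i Z hZ (pR r)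
          rw [dx_R _ _ _ hlr, sw_R, map_one, one_mul] at this
          simpa only [LinearMap.mulLeft_apply, hι, hy] using this
        · intro Z hZ
          rw [hι, hE] at hZ
          have := h.sq' r i Z hZ
          rw [QA, if_pos hlr, zero_mul] at this
          exact this
      · have hlr' : swapSeq i r (pL r) ≠ swapSeq i r (pR r) := by
          rw [swapSeq_apply, swapSeq_apply, sw_L, sw_R]; exact Ne.symm hlr
        have h1 := rnil_ne (V := A) (LinearMap.mulLeft k (ψ r)) (y' (pL r)) (y' (pR r))
          (QA y' (i (pL r)) (i (pR r)) (pL r) (pR r)) (E' i) (E' (swapSeq i r)) N ?_ ?_ ?_ hN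
          (E i) (by rw [hι, hE, h.idem])
        · rw [hι, ← hE, ← map_mul] at h1
          have h2 : y' (pR r) ^ N * QA y' (i (pL r)) (i (pR r)) (pL r) (pR r) * E' i ∈ J := by
            rw [hi (h1.trans (map_zero ι).symm)]; exact J.zero_mem
          rcases hJ.mem_or_mem h2 with h3 | h3
          · apply J.mul_mem_right
            rcases hJ.mem_or_mem h3 with h3 | h3
            · exact hJ.mem_of_pow_mem _ h3
            · exact QA_mem J hJ y' _ _ _ _ hlr (nilpotent_iff_mem_prime.mp hyL J hJ) h3
          · exact J.mul_mem_left _ h3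
        · intro Z hZ
          rw [hι, hE] at hZ ⊢
          exact h.wt' r i Z hZ
        · intro Z hZ
          rw [hι, hE] at hZ
          have := h.mv (k := k) r _ Z hZ (pR r)
          rw [dx_ne _ _ _ hlr', sw_R, map_zero, zero_mul, add_zero] at this
          simpa only [LinearMap.mulLeft_apply, hι, hy] using this
        · intro Z hZ
          rw [hι, hE] at hZ
          have := h.sq' r i Z hZ
          rw [hι, map_QA, hy']
          exact this
    rw [nilpotent_iff_mem_prime]
    intro J hJ
    rw [← mul_one (y' (pR r)), ← hsum, Finset.mul_sum]
    exact J.sum_mem fun i _ => key i J hJ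

lemma KF.toPre (ι : C →ₐ[k] A) (hι : ∀ (c : C) (a : A), c • a = ι c * a)
    (h : KF ℓ κ E y ψ) (S : Sys P n C) (hy : ∀ a, ι (S.y a) = y a)
    (hE : ∀ i, ι (S.E i) = E i) :
    Pre S P.q S.QK (fun r => LinearMap.mulLeft k (ψ r)) ∧
      BraidK S (fun r => LinearMap.mulLeft k (ψ r)) := by
  have hy' : (fun a => ι (S.y a)) = y := funext hy
  have hwt : ∀ i (Z : A), S.wt i Z → E i * Z = Z := by
    intro i Z hZ; rw [Sys.wt, hι, hE] at hZ; exact hZ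
  have hw : ∀ r i (Z : A), S.wt i Z → S.wt (swapSeq i r) (LinearMap.mulLeft k (ψ r) Z) := by
    intro r i Z hZ
    rw [Sys.wt, hι, hE]
    exact h.wt' r i Z (hwt _ _ hZ)
  refine ⟨⟨hw, ?_, ?_, ?_⟩, ?_⟩
  · intro r i Z hZ a
    have h1 := h.mv (k := k) r i Z (hwt _ _ hZ) a
    have h2 : S.y a • LinearMap.mulLeft k (ψ r) Z = LinearMap.mulLeft k (ψ r) (S.y (sw r a) • Z) +
        algebraMap k C (dx (fun _ => 1) r i a) • Z := by
      simpa only [LinearMap.mulLeft_apply, hι, hy, AlgHom.commutes] using h1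
    rw [(hw r i Z hZ).congr (S.x_E a _), hZ.congr (S.x_E (sw r a) _), swapSeq_apply, add_smul, mul_smul,
      h2, add_smul, map_add, mul_smul, Sys.op_alg, Sys.op_alg, dx_q P.q, map_mul]
    module
  · intro r i Z hZ
    rw [hι, Sys.QK, map_QK, hy']
    exact h.sq' r i Z (hwt _ _ hZ)
  · intro r s hrs Z
    simp only [LinearMap.mulLeft_apply, ← mul_assoc, h.comm r s hrs]
  · intro r s hrs i Z hZ
    have := congrArg (fun u => u * Z) (h.braid r s hrs i)
    simp only [mul_assoc, hwt _ _ hZ, add_mul] at this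
    rw [hι, map_BK, hy']
    simp only [LinearMap.mulLeft_apply, this]; abel

lemma KtoH_core (ι : C →ₐ[k] A) (hι : ∀ (c : C) (a : A), c • a = ι c * a)
    (h : KF ℓ κ E y ψ) (S : Sys P n C) (hy : ∀ a, ι (S.y a) = y a)
    (hE : ∀ i, ι (S.E i) = E i) : ∃ L T, Link ι S L T E y ψ ∧ HF P ℓ κ L T := by
  obtain ⟨pK, bK⟩ := h.toPre ι hι S hy hE
  let τ : Fin (n - 1) → A := fun r => ψ r * ι (S.G (pL r) (pR r))
  let T : Fin (n - 1) → A := fun r => ι (S.Di (pL r) (pR r)) *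
    (τ r * ι (S.N (pL r) (pR r)) + ι (S.kX (pL r) (pR r)))
  have hτ : ∀ r Z, LinearMap.mulLeft k (τ r) Z = LinearMap.mulLeft k (ψ r)
      (S.G (pL r) (pR r) • Z) := by
    intro r Z
    simp only [LinearMap.mulLeft_apply, hι, τ, mul_assoc]
  have pI := pre_KtoI (τ := fun r => LinearMap.mulLeft k (τ r)) pK hτ
  have bI : BraidI S (fun r => LinearMap.mulLeft k (τ r)) := braid_KtoI pK hτ bK
  have rel : Rel S (fun r => LinearMap.mulLeft k (T r)) (fun r => LinearMap.mulLeft k (τ r)) := by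
    intro r Z
    simp only [LinearMap.mulLeft_apply, hι, T, mul_assoc, add_mul]
  have hp := hpre_of_pre pI rel
  have hb := braid_ItoH hp pI rel bI
  have hcm : ∀ f g : C, ι f * ι g = ι g * ι f := by
    intro f g; rw [← map_mul, mul_comm, map_mul]
  refine ⟨fun a => ι (S.x a), T, ⟨fun a => rfl, fun i => (hE i).symm, fun a => (hy a).symm,
    fun r => rfl⟩, ?_, ?_, ?_, ?_, ?_, ?_, ?_⟩
  · intro h0
    rw [← prod_list ι (fun l => S.x ⟨0, h0⟩ - algebraMap k C (P.c (κ l : ZMod e))) _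
      (fun l => by rw [map_sub, AlgHom.commutes]), ← mul_one (ι _), ← map_one ι, ← S.complete,
      ← map_mul, Finset.mul_sum, map_sum]
    refine Finset.sum_eq_zero fun i _ => ?_
    obtain ⟨w, w', hw, h1⟩ := cyc_unit S ⟨0, h0⟩ i (fun l => (κ l : ZMod e)) ℓ
    rw [h1, mul_assoc, map_mul, map_mul, map_pow, hy, hE, h.cyc h0 i, mul_zero]
  · intro r
    have := hp.quad r 1
    simp only [LinearMap.mulLeft_apply, hι, map_sub, map_one, AlgHom.commutes, tt, mul_one] at this
    simp only [mul_sub, add_mul, this, ← Algebra.commutes P.t (T r), one_mul, sub_mul]; abel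
  · intro a b; exact hcm _ _
  · intro r s hrs
    have := hp.comm r s hrs 1
    simpa only [LinearMap.mulLeft_apply, mul_one] using this
  · intro r s hrs
    have := hb r s hrs 1
    simpa only [LinearMap.mulLeft_apply, mul_one, mul_assoc] using this
  · intro r a ha
    have h1 : a ≠ pL r := fun hh => ha.1 (by rw [hh]; rfl)
    have h2 : a ≠ pR r := fun hh => ha.2 (by rw [hh]; rfl)
    have := hp.far r a h1 h2 1
    simpa only [LinearMap.mulLeft_apply, hι, mul_one] using this
  · intro r
    have := hp.LT r 1
    simp only [LinearMap.mulLeft_apply, hι, map_sub, map_one, map_mul, AlgHom.commutes, tt, mul_one] at this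
    simp only [mul_sub, mul_add, this, ← Algebra.commutes P.t (ι (S.x (pR r))), mul_one, one_mul, sub_mul]
    abel

end KtoH

section KtoH'
variable {k : Type*} [Field k] {e : ℕ} [NeZero e] {n : ℕ}
variable {A : Type} [Ring A] [Algebra k A] {ℓ : ℕ} {κ : ℕ → ℤ}

lemma exists_sys_of_y (P : Par k e) {C : Type*} [CommRing C] [Algebra k C]
    (y : Fin n → C) (E : (Fin n → ZMod e) → C)
    (orth : ∀ i j, i ≠ j → E i * E j = 0) (idem : ∀ i, E i * E i = E i) (complete : ∑ i, E i = 1)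
    (hy : ∀ a, IsNilpotent (y a)) : ∃ S : Sys P n C, S.E = E ∧ S.y = y := by
  have hs : ∀ (f : (Fin n → ZMod e) → C) (i : Fin n → ZMod e), (∑ j, f j * E j) * E i = f i * E i := by
    intro f i
    rw [Finset.sum_mul, Finset.sum_eq_single i]
    · rw [mul_assoc, idem]
    · intro j _ hj; rw [mul_assoc, orth j i hj, mul_zero]
    · simp
  let S : Sys P n C := 
    { x := fun a => ∑ i, (algebraMap k C (P.q (i a)) * y a + algebraMap k C (P.c (i a))) * E i
      E := E
      orth := orth
      idem := idem
      complete := complete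
      nil := by
        intro a i
        rw [sub_mul, hs]
        have : (algebraMap k C (P.q (i a)) * y a + algebraMap k C (P.c (i a))) * E i -
          algebraMap k C (P.c (i a)) * E i = y a * (algebraMap k C (P.q (i a)) * E i) := by ring
        rw [this]
        exact (Commute.all _ _).isNilpotent_mul_right (hy a) }
  refine ⟨S, rfl, ?_⟩
  funext a
  apply S.ext_E
  intro i
  rw [S.y_E]
  have h1 : algebraMap k C (P.q (i a))⁻¹ * algebraMap k C (P.q (i a)) = 1 := by
    rw [← map_mul, inv_mul_cancel₀ (P.q_ne _), map_one]
  have h2 : S.x a * S.E i = (algebraMap k C (P.q (i a)) * y a + algebraMap k C (P.c (i a))) * S.E i :=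
    hs _ i
  linear_combination algebraMap k C (P.q (i a))⁻¹ * h2 + y a * S.E i * h1

/-- From the KLR relations to the Hecke relations. -/
theorem KtoH (P : Par k e) {E : (Fin n → ZMod e) → A} {y : Fin n → A} {ψ : Fin (n - 1) → A}
    (h : KF ℓ κ E y ψ) :
    ∃ (C : Type) (_ : CommRing C) (_ : Algebra k C) (ι : C →ₐ[k] A) (S : Sys P n C),
      ∃ L T, Link ι S L T E y ψ ∧ HF P ℓ κ L T := by
  have hEE : ∀ i j, E i * E j = E j * E i := by
    intro i j
    by_cases hij : i = j
    · rw [hij]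
    · rw [h.orth i j hij, h.orth j i (Ne.symm hij)]
  obtain ⟨C, iC, iA, ι, hi, hs⟩ := exists_comm (k := k) (Set.range y ∪ Set.range E) (by
    rintro _ (⟨a, rfl⟩ | ⟨a, rfl⟩) _ (⟨b, rfl⟩ | ⟨b, rfl⟩)
    · exact h.yy a b
    · exact h.yE a b
    · exact (h.yE b a).symm
    · exact hEE a b)
  choose y' hy using fun a => hs (y a) (.inl ⟨a, rfl⟩)
  choose E' hE using fun a => hs (E a) (.inr ⟨a, rfl⟩)
  letI : Module C A := Module.compHom A ι.toRingHom
  have hι : ∀ (c : C) (a : A), c • a = ι c * a := fun c a => rfl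
  haveI : IsScalarTower k C A := ⟨fun s c a => by rw [hι, hι, map_smul, smul_mul_assoc]⟩
  obtain ⟨S, rfl, rfl⟩ := exists_sys_of_y P y' E'
    (fun i j hij => hi (by rw [map_mul, hE, hE, h.orth i j hij, map_zero]))
    (fun i => hi (by rw [map_mul, hE, h.idem]))
    (hi (by rw [map_sum, map_one, ← h.complete]; simp [hE]))
    (fun m => h.nilp ι hι hi y' E' hy hE m.1 m.2)
  exact ⟨C, iC, iA, ι, S, KtoH_core ι hι h S hy hE⟩

end KtoH'
end Paper.BK

open scoped BigOperators
open scoped Classical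
set_option linter.all false

namespace Paper.BK

section qints
variable {R : Type*} [CommRing R] (t : Rˣ)

lemma qintU_nat (m : ℕ) : qintU t (m : ℤ) = ∑ j ∈ Finset.range m, (t : R) ^ j := by
  simp [qintU]

lemma qintU_neg (m : ℕ) : qintU t (-(m : ℤ)) =
    -∑ j ∈ Finset.range m, ((t ^ (-((j : ℤ) + 1)) : Rˣ) : R) := by
  rcases Nat.eq_zero_or_pos m with rfl | hm
  · simp [qintU]
  · have : ¬ (0 : ℤ) ≤ -(m : ℤ) := by omega
    rw [qintU, if_neg this]
    simp

lemma qintU_zero : qintU t 0 = 0 := by simp [qintU]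

lemma qintU_succ (d : ℤ) : qintU t (d + 1) = 1 + t * qintU t d := by
  rcases le_or_gt 0 d with hd | hd
  · obtain ⟨m, rfl⟩ := Int.eq_ofNat_of_zero_le hd
    have : ((m : ℤ) + 1) = ((m + 1 : ℕ) : ℤ) := by push_cast; ring
    rw [this, qintU_nat, qintU_nat, Finset.sum_range_succ', Finset.mul_sum]
    simp only [pow_succ', pow_zero]; ring
  · obtain ⟨m, hm⟩ := Int.eq_ofNat_of_zero_le (show 0 ≤ -d - 1 by omega)
    obtain rfl : d = -((m + 1 : ℕ) : ℤ) := by push_cast; omega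
    have : -((m + 1 : ℕ) : ℤ) + 1 = -(m : ℤ) := by push_cast; ring
    have hj : ∀ j : ℤ, (t : R) * ((t ^ (-(j + 1)) : Rˣ) : R) = ((t ^ (-j) : Rˣ) : R) := by
      intro j
      rw [← Units.val_mul, ← zpow_one_add]; congr 2; ring
    rw [this, qintU_neg, qintU_neg, Finset.sum_range_succ', mul_neg, mul_add, Finset.mul_sum]
    simp only [hj]
    push_cast
    simp

lemma qintU_add (a b : ℤ) : qintU t (a + b) = qintU t a + ((t ^ a : Rˣ) : R) * qintU t b := by
  induction a using Int.induction_on with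
  | zero => simp [qintU_zero]
  | succ a ih =>
    have : (a : ℤ) + 1 + b = (a + b) + 1 := by ring
    rw [this, qintU_succ, ih, qintU_succ, zpow_add_one, Units.val_mul]; ring
  | pred a ih =>
    have h1 := qintU_succ t (-(a : ℤ) - 1 + b)
    have h2 := qintU_succ t (-(a : ℤ) - 1)
    have e1 : -(a : ℤ) - 1 + b + 1 = -(a : ℤ) + b := by ring
    rw [e1, ih] at h1
    rw [sub_add_cancel] at h2
    have h3 : ((t ^ (-(a : ℤ)) : Rˣ) : R) = t * ((t ^ (-(a : ℤ) - 1) : Rˣ) : R) := by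
      rw [← Units.val_mul, ← zpow_one_add]; congr 2; ring
    apply t.isUnit.mul_left_cancel
    rw [h3] at h1
    linear_combination h2 - h1

lemma qintU_map {R' : Type*} [CommRing R'] (f : R →+* R') (d : ℤ) :
    qintU (Units.map f.toMonoidHom t) d = f (qintU t d) := by
  unfold qintU
  split_ifs
  · simp
  · simp [← map_zpow]

end qints

section par
variable {k : Type*} [Field k] {e : ℕ} [NeZero e] (t : kˣ)

lemma exists_par (he : 2 ≤ e) (h1 : ∀ d : ℤ, ¬(e : ℤ) ∣ d → qintU t d ≠ 0)
    (h2 : ∀ d : ℤ, (e : ℤ) ∣ d → qintU t d = 0) :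
    ∃ P : Par k e, (t : k) = P.t ∧ ∀ d : ℤ, qintU t d = P.c (d : ZMod e) := by
  have hc : ∀ d : ℤ, qintU t d = qintU t (((d : ZMod e).val : ℕ) : ℤ) := by
    intro d
    rw [ZMod.val_intCast]
    conv_lhs => rw [← Int.emod_add_mul_ediv d e, qintU_add, h2 _ (Dvd.intro _ rfl), mul_zero, add_zero]
  refine ⟨⟨t, fun a => qintU t ((a.val : ℕ) : ℤ), t.ne_zero, ?_, ?_, he⟩, rfl, hc⟩
  · intro a b hab
    simp only at hab
    have h3 : (a.val : ℤ) = (b.val : ℤ) + ((a.val : ℤ) - b.val) := by ring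
    rw [h3, qintU_add] at hab
    have h4 : qintU t ((a.val : ℤ) - b.val) = 0 := by
      have h5 : ((t ^ (b.val : ℤ) : kˣ) : k) * qintU t ((a.val : ℤ) - b.val) = 0 := by
        linear_combination hab
      exact (mul_eq_zero.mp h5).resolve_left (Units.ne_zero _)
    have h6 : (e : ℤ) ∣ (a.val : ℤ) - b.val := by
      by_contra hh; exact h1 _ hh h4
    have h7 := (ZMod.intCast_zmod_eq_zero_iff_dvd _ _).mpr h6
    push_cast at h7
    rw [ZMod.natCast_zmod_val, ZMod.natCast_zmod_val] at h7
    exact sub_eq_zero.mp h7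
  · intro a
    have h3 := hc ((a.val : ℤ) + 1)
    push_cast at h3
    rw [ZMod.natCast_zmod_val] at h3
    rw [← h3, qintU_succ]

end par

section assembly
variable {k : Type} [Field k] {e : ℕ} [NeZero e] {n ℓ : ℕ} {κ : ℕ → ℤ} {t : kˣ}

lemma lift_H : FreeAlgebra.lift k (Hgen (Lgen k t n ℓ κ) (Tgen k t n ℓ κ)) =
    RingQuot.mkAlgHom k (HeckeRel k t n ℓ κ) := by
  apply FreeAlgebra.hom_ext
  funext a
  cases a <;> simp [Hgen, Lgen, Tgen, hL, hT]

lemma HD_univ : HD t ℓ κ (Lgen k t n ℓ κ) (Tgen k t n ℓ κ) := by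
  intro a b h
  rw [lift_H]
  exact RingQuot.mkAlgHom_rel k h

lemma lift_K : FreeAlgebra.lift k (Kgen (KeGen k n e ℓ κ) (KyGen k n e ℓ κ) (KpsiGen k n e ℓ κ)) =
    RingQuot.mkAlgHom k (KLRRel k n e ℓ κ) := by
  apply FreeAlgebra.hom_ext
  funext a
  cases a <;> simp [Kgen, KeGen, KyGen, KpsiGen, kE, kY, kPsi]

lemma KD_univ : KD k ℓ κ (KeGen k n e ℓ κ) (KyGen k n e ℓ κ) (KpsiGen k n e ℓ κ) := by
  intro a b h
  rw [lift_K]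
  exact RingQuot.mkAlgHom_rel k h

variable {A : Type} [Ring A] [Algebra k A]

lemma H_lift {L : Fin n → A} {T} (h : HD t ℓ κ L T) : ∃ f : CycHecke k t n ℓ κ →ₐ[k] A,
    (∀ a, f (Lgen k t n ℓ κ a) = L a) ∧ ∀ r, f (Tgen k t n ℓ κ r) = T r := by
  have h' : ∀ ⦃x y : FreeAlgebra k (HeckeGen n)⦄, HeckeRel k t n ℓ κ x y →
      FreeAlgebra.lift k (Hgen L T) x = FreeAlgebra.lift k (Hgen L T) y := h
  refine ⟨RingQuot.liftAlgHom k ⟨FreeAlgebra.lift k (Hgen L T), h'⟩, ?_, ?_⟩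
  · intro a
    rw [Lgen, RingQuot.liftAlgHom_mkAlgHom_apply]; simp [hL, Hgen]
  · intro a
    rw [Tgen, RingQuot.liftAlgHom_mkAlgHom_apply]; simp [hT, Hgen]

lemma K_lift {E : (Fin n → ZMod e) → A} {y ψ} (h : KD k ℓ κ E y ψ) : ∃ f : KLR k n e ℓ κ →ₐ[k] A,
    (∀ i, f (KeGen k n e ℓ κ i) = E i) ∧ (∀ a, f (KyGen k n e ℓ κ a) = y a) ∧
      ∀ r, f (KpsiGen k n e ℓ κ r) = ψ r := by
  have h' : ∀ ⦃x z : FreeAlgebra k (KLRGen n e)⦄, KLRRel k n e ℓ κ x z →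
      FreeAlgebra.lift k (Kgen E y ψ) x = FreeAlgebra.lift k (Kgen E y ψ) z := h
  refine ⟨RingQuot.liftAlgHom k ⟨FreeAlgebra.lift k (Kgen E y ψ), h'⟩, ?_, ?_, ?_⟩
  · intro a
    rw [KeGen, RingQuot.liftAlgHom_mkAlgHom_apply]; simp [kE, Kgen]
  · intro a
    rw [KyGen, RingQuot.liftAlgHom_mkAlgHom_apply]; simp [kY, Kgen]
  · intro a
    rw [KpsiGen, RingQuot.liftAlgHom_mkAlgHom_apply]; simp [kPsi, Kgen]

lemma H_ext {f g : CycHecke k t n ℓ κ →ₐ[k] A} (h1 : ∀ a, f (Lgen k t n ℓ κ a) = g (Lgen k t n ℓ κ a))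
    (h2 : ∀ a, f (Tgen k t n ℓ κ a) = g (Tgen k t n ℓ κ a)) : f = g := by
  apply RingQuot.ringQuot_ext'
  apply FreeAlgebra.hom_ext
  funext a
  cases a with
  | L a => exact h1 a
  | T a => exact h2 a

lemma K_ext {f g : KLR k n e ℓ κ →ₐ[k] A} (h1 : ∀ a, f (KeGen k n e ℓ κ a) = g (KeGen k n e ℓ κ a))
    (h2 : ∀ a, f (KyGen k n e ℓ κ a) = g (KyGen k n e ℓ κ a))
    (h3 : ∀ a, f (KpsiGen k n e ℓ κ a) = g (KpsiGen k n e ℓ κ a)) : f = g := by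
  apply RingQuot.ringQuot_ext'
  apply FreeAlgebra.hom_ext
  funext a
  cases a with
  | idem a => exact h1 a
  | psi a => exact h3 a
  | y a => exact h2 a

theorem main_field (P : Par k e) (ht : (t : k) = P.t) (hc : ∀ d : ℤ, qintU t d = P.c (d : ZMod e)) :
    Nonempty (KLR k n e ℓ κ ≃ₐ[k] CycHecke k t n ℓ κ) := by
  obtain ⟨C, iC, iA, ι, S, E, y, ψ, lH, kf⟩ := HtoK ((HD_univ (t := t) (n := n) (ℓ := ℓ) (κ := κ)).toHF ht hc)
  obtain ⟨C', iC', iA', ι', S', L, T, lK, hf⟩ := KtoH P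
    ((KD_univ (k := k) (e := e) (n := n) (ℓ := ℓ) (κ := κ)).toKF)
  obtain ⟨f, f1, f2, f3⟩ := K_lift (kf.toKD P)
  obtain ⟨g, g1, g2⟩ := H_lift (hf.toHD ht hc)
  have m1 := lK.map f
  simp only [f1, f2, f3] at m1
  have m2 := lH.map g
  simp only [g1, g2] at m2
  obtain ⟨u1, u2⟩ := lH.KH_unique m1
  obtain ⟨v1, v2, v3⟩ := lK.HK_unique m2
  refine ⟨AlgEquiv.ofAlgHom f g ?_ ?_⟩
  · apply H_ext
    · intro a
      rw [AlgHom.comp_apply, g1]; exact (congrFun u1 a).symm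
    · intro a
      rw [AlgHom.comp_apply, g2]; exact (congrFun u2 a).symm
  · apply K_ext
    · intro a
      rw [AlgHom.comp_apply, f1]; exact (congrFun v1 a).symm
    · intro a
      rw [AlgHom.comp_apply, f2]; exact (congrFun v2 a).symm
    · intro a
      rw [AlgHom.comp_apply, f3]; exact (congrFun v3 a).symm

end assembly
end Paper.BK


namespace Paper

/-- Brundan–Kleshchev isomorphism: for `(O, t)` an `e`-idempotent
subring of a field `K` and `m` a maximal ideal of `O`, the cyclotomic quiver Hecke
algebra `R_n^Λ(O/m)`, with `Λ = Σ_l Λ_{κ_l mod e}`, is isomorphic as an `O/m`-algebra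
to the cyclotomic Hecke algebra `H_n(O/m, t̄, κ)`. -/
theorem brundan_kleshchev_isomorphism
    (n ℓ e : ℕ) (hℓ : 1 ≤ ℓ) (he : 2 ≤ e) [NeZero e]
    (κ : ℕ → ℤ) (hκ : ∀ l, l + 1 < ℓ → (n : ℤ) ≤ κ l - κ (l + 1))
    (K : Type) [Field K] (O : Subring K) (t : Oˣ)
    (hO : IsIdempotentSubring O t e n ℓ κ)
    (m : Ideal ↥O) (hm : m.IsMaximal) :
    Nonempty (KLR (↥O ⧸ m) n e ℓ κ ≃ₐ[↥O ⧸ m]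
      CycHecke (↥O ⧸ m) (Units.map (Ideal.Quotient.mk m).toMonoidHom t) n ℓ κ) := by
  letI : Field (↥O ⧸ m) := Ideal.Quotient.field m
  obtain ⟨-, h1, h2⟩ := hO
  obtain ⟨P, ht, hc⟩ := BK.exists_par (k := ↥O ⧸ m) (e := e)
    (Units.map (Ideal.Quotient.mk m).toMonoidHom t) he
    (fun d hd => by
      rw [BK.qintU_map]
      exact ((h1 d hd).map (Ideal.Quotient.mk m)).ne_zero)
    (fun d hd => by
      rw [BK.qintU_map, Ideal.Quotient.eq_zero_iff_mem]
      exact (Ideal.mem_sInf.mp (h2 d hd)) ⟨bot_le, hm⟩)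
  exact BK.main_field P ht hc

end Paper
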